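/- arXiv:2505.09804 — 4 statements merged into one kernel-verified Lean document; each statement's English description precedes it below -/
import Mathlib

section
/- (Birch–Merriman) Let n ≥ 3. There are only finitely many (K,S)-equivalence classes of binary forms f ∈ O_{K,S}[x,y] of degree n with discriminant Δ(f) ∈ O_{K,S}^×. -/
open IsDedekindDomain NumberField
open scoped MatrixGroups

set_option synthInstance.maxHeartbeats 1000000
set_option maxHeartbeats 1000000

/-- The linear-substitution action of a matrix on binary forms:
`(γ·f)(x,y) = f((x,y)γ)`. -/
noncomputable def substForm {R : Type*} [CommRing R] (γ : Matrix (Fin 2) (Fin 2) R)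
    (f : MvPolynomial (Fin 2) R) : MvPolynomial (Fin 2) R :=
  MvPolynomial.bind₁ (fun i => ∑ j, MvPolynomial.C (γ j i) * MvPolynomial.X j) f

/-- A binary form of degree `n` over `𝒪_{K,S}` has discriminant a unit of
`𝒪_{K,S}`: writing `f = a·∏ (βᵢx − αᵢy)` over an algebraic closure of `K`, the
discriminant `Δ(f) = a^(2n−2) ∏_{i<j} (αᵢβⱼ − αⱼβᵢ)²` is (the image of) a unit. -/
def HasUnitDisc {K : Type*} [Field K] [NumberField K]
    (S : Finset (HeightOneSpectrum (𝓞 K))) (n : ℕ)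
    (f : MvPolynomial (Fin 2) ↥((S : Set (HeightOneSpectrum (𝓞 K))).integer K)) : Prop :=
  ∃ (a : AlgebraicClosure K) (α β : Fin n → AlgebraicClosure K),
    MvPolynomial.map ((algebraMap K (AlgebraicClosure K)).comp
        ((S : Set (HeightOneSpectrum (𝓞 K))).integer K).val.toRingHom) f =
      MvPolynomial.C a * ∏ i : Fin n,
        (MvPolynomial.C (β i) * MvPolynomial.X 0 - MvPolynomial.C (α i) * MvPolynomial.X 1) ∧
    ∃ u : (↥((S : Set (HeightOneSpectrum (𝓞 K))).integer K))ˣ,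
      a ^ (2 * n - 2) * ∏ i : Fin n, ∏ j ∈ Finset.Ioi i, (α i * β j - α j * β i) ^ 2 =
        algebraMap K (AlgebraicClosure K) (((u : ↥((S : Set (HeightOneSpectrum (𝓞 K))).integer K)) : K))

/-- Two binary forms over `𝒪_{K,S}` are `(K,S)`-equivalent if `λf = γ·g` for some
unit `λ ∈ 𝒪_{K,S}^×` and some `γ ∈ GL₂(𝒪_{K,S})`. -/
def KSEquiv {K : Type*} [Field K] [NumberField K]
    (S : Finset (HeightOneSpectrum (𝓞 K)))
    (f g : MvPolynomial (Fin 2) ↥((S : Set (HeightOneSpectrum (𝓞 K))).integer K)) : Prop :=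
  ∃ (lam : (↥((S : Set (HeightOneSpectrum (𝓞 K))).integer K))ˣ)
    (γ : GL (Fin 2) ↥((S : Set (HeightOneSpectrum (𝓞 K))).integer K)),
    MvPolynomial.C (lam : ↥((S : Set (HeightOneSpectrum (𝓞 K))).integer K)) * f =
      substForm (γ : Matrix (Fin 2) (Fin 2) ↥((S : Set (HeightOneSpectrum (𝓞 K))).integer K)) g

section Pade

open Polynomial Finset

variable {K : Type*} [Field K]

/-- The functional `f ↦ ∫₀ˣ f(t) dt` on polynomials, defined formally. -/
noncomputable def formalIntegral (x : K) : K[X] →ₗ[K] K :=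
  Polynomial.lsum fun n => (x ^ (n + 1) / (n + 1 : K)) • LinearMap.id

lemma formalIntegral_monomial (x : K) (n : ℕ) (a : K) :
    formalIntegral x (monomial n a) = a * (x ^ (n + 1) / (n + 1 : K)) := by
  simp [formalIntegral, Polynomial.lsum_apply, mul_comm]

lemma formalIntegral_C_mul_X_pow (x : K) (n : ℕ) (a : K) :
    formalIntegral x (C a * X ^ n) = a * (x ^ (n + 1) / (n + 1 : K)) := by
  rw [C_mul_X_pow_eq_monomial, formalIntegral_monomial]

variable [CharZero K]

lemma formalIntegral_derivative (x : K) (f : K[X]) :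
    formalIntegral x (derivative f) = f.eval x - f.eval 0 := by
  induction f using Polynomial.induction_on' with
  | add p q hp hq => rw [derivative_add, map_add, hp, hq, eval_add, eval_add]; ring
  | monomial n a =>
    rw [derivative_monomial, formalIntegral_monomial]
    rcases n with _ | n
    · simp
    · have : (n + 1 : K) ≠ 0 := by exact_mod_cast n.succ_ne_zero
      simp only [Nat.cast_add, Nat.cast_one, Nat.add_sub_cancel, eval_monomial]
      field_simp
      simp

lemma exists_derivative_eq (f : K[X]) : ∃ g : K[X], derivative g = f := by
  induction f using Polynomial.induction_on' with
  | add p q hp hq =>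
    obtain ⟨g, rfl⟩ := hp
    obtain ⟨h, rfl⟩ := hq
    exact ⟨g + h, derivative_add⟩
  | monomial n a =>
    refine ⟨monomial (n + 1) (a / (n + 1 : K)), ?_⟩
    have : (n + 1 : K) ≠ 0 := by exact_mod_cast n.succ_ne_zero
    rw [derivative_monomial]
    simp [this]

lemma formalIntegral_comp_one_sub (x : K) (f : K[X]) :
    formalIntegral x (f.comp (1 - X)) = formalIntegral 1 f - formalIntegral (1 - x) f := by
  obtain ⟨g, rfl⟩ := exists_derivative_eq f
  have : (derivative g).comp (1 - X) = derivative (-(g.comp (1 - X))) := by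
    rw [derivative_neg, derivative_comp]; simp
  rw [this, formalIntegral_derivative, formalIntegral_derivative, formalIntegral_derivative]
  simp only [eval_neg, eval_comp, eval_sub, eval_one, eval_X, sub_zero]
  ring

/-- The integrand `t^(m+e) (1-t)^m (z-t)^m` producing the Padé-type approximations. -/
noncomputable def padeIntegrand (z : K) (m e : ℕ) : K[X] :=
  X ^ (m + e) * (1 - X) ^ m * (C z - X) ^ m

omit [CharZero K] in
lemma one_sub_X_pow (m : ℕ) :
    ((1 : K[X]) - X) ^ m = ∑ a ∈ range (m + 1), C ((-1) ^ a * (m.choose a : K)) * X ^ a := by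
  rw [sub_eq_neg_add, add_pow]
  refine sum_congr rfl fun a _ => ?_
  rw [neg_pow]
  simp
  ring

omit [CharZero K] in
lemma C_sub_X_pow (z : K) (m : ℕ) :
    (C z - X) ^ m =
      ∑ b ∈ range (m + 1), C ((-1) ^ b * (m.choose b : K) * z ^ (m - b)) * X ^ b := by
  rw [sub_eq_neg_add, add_pow]
  refine sum_congr rfl fun a _ => ?_
  rw [neg_pow]
  simp
  ring

omit [CharZero K] in
lemma padeIntegrand_eq_sum (z : K) (m e : ℕ) :
    padeIntegrand z m e = ∑ a ∈ range (m + 1), ∑ b ∈ range (m + 1),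
      C ((-1) ^ (a + b) * (m.choose a * m.choose b : K) * z ^ (m - b)) * X ^ (m + e + a + b) := by
  rw [padeIntegrand, one_sub_X_pow, C_sub_X_pow, mul_assoc, sum_mul_sum, mul_sum]
  refine sum_congr rfl fun a _ => ?_
  rw [mul_sum]
  refine sum_congr rfl fun b _ => ?_
  simp only [map_mul, pow_add]
  ring

omit [CharZero K] in
lemma formalIntegral_padeIntegrand (z x : K) (m e : ℕ) :
    formalIntegral x (padeIntegrand z m e) = ∑ a ∈ range (m + 1), ∑ b ∈ range (m + 1),
      (-1) ^ (a + b) * (m.choose a * m.choose b : K) * z ^ (m - b) *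
        (x ^ (m + e + a + b + 1) / ((m + e + a + b + 1 : ℕ) : K)) := by
  simp only [padeIntegrand_eq_sum, map_sum, formalIntegral_C_mul_X_pow]
  push_cast
  rfl

lemma sum_bound (z : K) {m N : ℕ} (hN : ∀ d ∈ Finset.Icc 1 (3 * m + 2), d ∣ N)
    (d k : ℕ → ℕ → ℕ)
    (hd : ∀ a ∈ range (m + 1), ∀ b ∈ range (m + 1), d a b ∈ Finset.Icc 1 (3 * m + 2))
    (hk : ∀ a ∈ range (m + 1), ∀ b ∈ range (m + 1), k a b ≤ m + 1) {G : K}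
    (hG : G = ∑ a ∈ range (m + 1), ∑ b ∈ range (m + 1),
      (-1) ^ (a + b) * (m.choose a * m.choose b : K) * (z ^ k a b / (d a b : K))) :
    (∀ O : Subring K, z ∈ O → (N : K) * G ∈ O) ∧
      ∀ v : AbsoluteValue K ℝ, v (N * G) ≤ N * 4 ^ m * max 1 (v z) ^ (m + 1) := by
  have key : (N : K) * G = ∑ a ∈ range (m + 1), ∑ b ∈ range (m + 1),
      (-1) ^ (a + b) * ((m.choose a * m.choose b * (N / d a b) : ℕ) : K) * z ^ k a b := by
    rw [hG, mul_sum]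
    refine sum_congr rfl fun a ha => ?_
    rw [mul_sum]
    refine sum_congr rfl fun b hb => ?_
    have h1 := hd a ha b hb
    obtain ⟨c, hc⟩ := hN _ h1
    rw [mem_Icc] at h1
    have h0 : ((d a b : ℕ) : K) ≠ 0 := by exact_mod_cast (by omega : d a b ≠ 0)
    rw [hc, Nat.mul_div_cancel_left _ (by omega)]
    push_cast
    field_simp
  constructor
  · intro O hz
    rw [key]
    exact sum_mem fun a _ => sum_mem fun b _ => mul_mem (mul_mem
      (pow_mem (neg_mem (one_mem _)) _) (natCast_mem _ _)) (pow_mem hz _)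
  · intro v
    have hnat : ∀ n : ℕ, v (n : K) ≤ n := fun n => by
      induction n with
      | zero => simp
      | succ n ih => push_cast; exact (v.add_le _ _).trans (by simpa using ih)
    rw [key]
    have h1 : ∀ a ∈ range (m + 1), ∀ b ∈ range (m + 1),
        v ((-1) ^ (a + b) * ((m.choose a * m.choose b * (N / d a b) : ℕ) : K) * z ^ k a b) ≤
          N * max 1 (v z) ^ (m + 1) * ((m.choose a : ℝ) * m.choose b) := by
      intro a ha b hb
      rw [map_mul, map_mul, map_pow, map_pow, v.map_neg, map_one, one_pow, one_mul]
      have h2 : v z ^ k a b ≤ max 1 (v z) ^ (m + 1) :=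
        (pow_le_pow_left₀ (v.nonneg _) (le_max_right _ _) _).trans
          (pow_le_pow_right₀ (le_max_left _ _) (hk a ha b hb))
      have h3 : v ((m.choose a * m.choose b * (N / d a b) : ℕ) : K) ≤
          (m.choose a : ℝ) * m.choose b * N := by
        refine (hnat _).trans ?_
        have : m.choose a * m.choose b * (N / d a b) ≤ m.choose a * m.choose b * N :=
          Nat.mul_le_mul_left _ (Nat.div_le_self _ _)
        exact_mod_cast this
      calc _ ≤ ((m.choose a : ℝ) * m.choose b * N) * max 1 (v z) ^ (m + 1) :=
            mul_le_mul h3 h2 (pow_nonneg (v.nonneg _) _) (by positivity)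
        _ = _ := by ring
    have h4 : ∑ a ∈ range (m + 1), (m.choose a : ℝ) = 2 ^ m := by
      exact_mod_cast Nat.sum_range_choose m
    calc _ ≤ ∑ a ∈ range (m + 1), ∑ b ∈ range (m + 1),
          N * max 1 (v z) ^ (m + 1) * ((m.choose a : ℝ) * m.choose b) :=
          (v.sum_le _ _).trans (sum_le_sum fun a ha =>
            (v.sum_le _ _).trans (sum_le_sum fun b hb => h1 a ha b hb))
      _ = N * max 1 (v z) ^ (m + 1) * ((∑ a ∈ range (m + 1), (m.choose a : ℝ)) *
            ∑ b ∈ range (m + 1), (m.choose b : ℝ)) := by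
          rw [sum_mul_sum, mul_sum]
          exact sum_congr rfl fun a _ => by rw [mul_sum]
      _ = _ := by
          rw [h4, ← mul_pow]; norm_num; ring

lemma exists_formalIntegral_self_eq (z : K) {m N e : ℕ} (he : e ≤ 1)
    (hN : ∀ d ∈ Finset.Icc 1 (3 * m + 2), d ∣ N) :
    ∃ G : K, formalIntegral z (padeIntegrand z m e) = z ^ (2 * m + 1) * G ∧
      (∀ O : Subring K, z ∈ O → (N : K) * G ∈ O) ∧
      ∀ v : AbsoluteValue K ℝ, v (N * G) ≤ N * 4 ^ m * max 1 (v z) ^ (m + 1) := by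
  refine ⟨_, ?_, sum_bound z hN (fun a b => m + e + a + b + 1) (fun a b => e + a)
    (fun a ha b hb => ?_) (fun a ha b hb => ?_) rfl⟩
  · rw [formalIntegral_padeIntegrand, mul_sum]
    refine sum_congr rfl fun a ha => ?_
    rw [mul_sum]
    refine sum_congr rfl fun b hb => ?_
    rw [mem_range] at hb
    have : z ^ (m - b) * z ^ (m + e + a + b + 1) = z ^ (2 * m + 1) * z ^ (e + a) := by
      rw [← pow_add, ← pow_add]; congr 1; omega
    rw [mul_assoc ((-1) ^ (a + b) * _), ← mul_div_assoc, this]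
    ring
  · simp only [mem_range, mem_Icc] at *; omega
  · simp only [mem_range] at *; omega

lemma formalIntegral_one_bound (z : K) {m N e : ℕ} (he : e ≤ 1)
    (hN : ∀ d ∈ Finset.Icc 1 (3 * m + 2), d ∣ N) :
    (∀ O : Subring K, z ∈ O → (N : K) * formalIntegral 1 (padeIntegrand z m e) ∈ O) ∧
      ∀ v : AbsoluteValue K ℝ, v (N * formalIntegral 1 (padeIntegrand z m e)) ≤
        N * 4 ^ m * max 1 (v z) ^ (m + 1) := by
  refine sum_bound z hN (fun a b => m + e + a + b + 1) (fun a b => m - b)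
    (fun a ha b hb => ?_) (fun a ha b hb => ?_) ?_
  · simp only [mem_range, mem_Icc] at *; omega
  · simp only [mem_range] at *; omega
  · rw [formalIntegral_padeIntegrand]
    refine sum_congr rfl fun a ha => sum_congr rfl fun b hb => ?_
    rw [one_pow, mul_assoc, mul_one_div]

lemma exists_formalIntegral_one_sub_eq (z : K) {m N e : ℕ} (he : e ≤ 1)
    (hN : ∀ d ∈ Finset.Icc 1 (3 * m + 2), d ∣ N) :
    ∃ G : K, formalIntegral 1 (padeIntegrand z m e) - formalIntegral z (padeIntegrand z m e) =
        (1 - z) ^ (2 * m + 1) * G ∧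
      ∀ v : AbsoluteValue K ℝ, v (N * G) ≤ 2 * (N * 4 ^ m * max 1 (v (1 - z)) ^ (m + 1)) := by
  have hrefl : formalIntegral 1 (padeIntegrand z m e) - formalIntegral z (padeIntegrand z m e) =
      formalIntegral (1 - z) ((padeIntegrand z m e).comp (1 - X)) := by
    rw [formalIntegral_comp_one_sub]; simp
  have hcomp : (padeIntegrand z m e).comp (1 - X) =
      C ((-1) ^ m) * (padeIntegrand (1 - z) m 0 * (1 - X) ^ e) := by
    have : (C z - (1 - X) : K[X]) = C (-1) * (C (1 - z) - X) := by simp; ring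
    simp only [padeIntegrand, mul_comp, pow_comp, X_comp, sub_comp, one_comp, C_comp, this,
      mul_pow, map_pow]
    ring
  obtain ⟨G0, h0, -, hb0⟩ := exists_formalIntegral_self_eq (1 - z) (m := m) zero_le_one hN
  obtain ⟨G1, h1, -, hb1⟩ := exists_formalIntegral_self_eq (1 - z) (m := m) le_rfl hN
  have hpos : ∀ v : AbsoluteValue K ℝ, 0 ≤ N * 4 ^ m * max 1 (v (1 - z)) ^ (m + 1) :=
    fun v => by positivity
  rw [hrefl, hcomp, ← smul_eq_C_mul, map_smul, smul_eq_mul]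
  interval_cases e
  · refine ⟨(-1) ^ m * G0, ?_, fun v => ?_⟩
    · rw [pow_zero, mul_one, h0]; ring
    · rw [mul_left_comm, map_mul, map_pow, v.map_neg, map_one, one_pow, one_mul]
      linarith [hb0 v, hpos v]
  · refine ⟨(-1) ^ m * (G0 - G1), ?_, fun v => ?_⟩
    · have : padeIntegrand (1 - z) m 0 * (1 - X) ^ 1 =
          padeIntegrand (1 - z) m 0 - padeIntegrand (1 - z) m 1 := by
        simp only [padeIntegrand]; ring
      rw [this, map_sub, h0, h1]; ring
    · rw [mul_left_comm, map_mul, map_pow, v.map_neg, map_one, one_pow, one_mul, mul_sub]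
      have := v.sub_le_add (N * G0) (N * G1)
      linarith [hb0 v, hb1 v]

end Pade

section PadeNonvanishing

open Polynomial Finset

variable {K : Type*} [Field K] [CharZero K]

omit [CharZero K] in
lemma pow_dvd_derivative_of_pow_succ_dvd {P f : K[X]} {m : ℕ} (h : P ^ (m + 1) ∣ f) :
    P ^ m ∣ derivative f := by
  obtain ⟨q, rfl⟩ := h
  rw [derivative_mul, derivative_pow_succ]
  exact dvd_add ⟨C (m + 1 : K) * derivative P * q, by ring⟩ ⟨P * derivative q, by ring⟩

omit [CharZero K] in
lemma exists_interpolation {P Q : K[X]} (h : IsCoprime P Q) (m : ℕ) :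
    ∃ G : K[X], P ∣ G ∧ Q ∣ G - 1 ∧ (P * Q) ^ m ∣ derivative G := by
  obtain ⟨a, b, hab⟩ := h.pow (m := m + 1) (n := m + 1)
  have h1 : a * P ^ (m + 1) - 1 = -b * Q ^ (m + 1) := by linear_combination hab
  refine ⟨a * P ^ (m + 1), (dvd_pow_self P m.succ_ne_zero).mul_left a, ?_, ?_⟩
  · rw [h1]
    exact (dvd_pow_self Q m.succ_ne_zero).mul_left _
  · rw [mul_pow]
    refine (h.pow).mul_dvd (pow_dvd_derivative_of_pow_succ_dvd (dvd_mul_left _ _)) ?_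
    have : derivative (a * P ^ (m + 1)) = derivative (a * P ^ (m + 1) - 1) := by simp
    rw [this, h1]
    exact pow_dvd_derivative_of_pow_succ_dvd (dvd_mul_left _ _)

lemma formalIntegral_padeIntegrand_independent {z c₁ c₂ : K} (hz0 : z ≠ 0) (hz1 : z ≠ 1) (m : ℕ)
    (h : ∀ e ≤ 1, c₁ * formalIntegral z (padeIntegrand z m e) +
      c₂ * formalIntegral 1 (padeIntegrand z m e) = 0) : c₁ = 0 ∧ c₂ = 0 := by
  set ℓ : K[X] →ₗ[K] K := c₁ • formalIntegral z + c₂ • formalIntegral 1 with hℓ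
  have hℓa : ∀ f, ℓ f = c₁ * formalIntegral z f + c₂ * formalIntegral 1 f := fun f => by
    simp [hℓ]
  set w : K[X] := (1 - X) * (C z - X) with hw
  set u : K[X] := X * w with hu
  have hU : ∀ e, padeIntegrand z m e = u ^ m * X ^ e := fun e => by
    simp only [padeIntegrand, hu, hw, mul_pow, pow_add]; ring
  have hmono : ∀ k : ℕ, ℓ (u ^ m * X ^ k) = 0 := by
    intro k
    induction k using Nat.strong_induction_on with
    | _ k ih =>
    rcases lt_or_ge k 2 with hk | hk
    · rw [← hU, hℓa]
      exact h k (by omega)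
    · obtain ⟨j, rfl⟩ := Nat.exists_eq_add_of_le' hk
      have hX : X * derivative (X ^ j : K[X]) = C (j : K) * X ^ j := by
        rcases j with _ | j
        · simp
        · rw [derivative_X_pow]; simp only [Nat.add_sub_cancel]; ring
      have hd : derivative (u ^ (m + 1) * X ^ j) =
          (3 * (m + 1) + j : K) • (u ^ m * X ^ (j + 2)) +
            (-(1 + z) * (2 * (m + 1) + j) : K) • (u ^ m * X ^ (j + 1)) +
            (z * (m + 1 + j) : K) • (u ^ m * X ^ j) := by
        have h1 : derivative u = 3 * X ^ 2 - 2 * (1 + C z) * X + C z := by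
          simp only [hu, hw, derivative_mul, derivative_X, derivative_sub, derivative_one,
            derivative_C]
          ring
        rw [derivative_mul, derivative_pow_succ, h1]
        have h2 : u ^ (m + 1) * derivative (X ^ j : K[X]) = u ^ m * w * (C (j : K) * X ^ j) := by
          rw [← hX, pow_succ, hu]; ring
        rw [h2, hw]
        simp only [smul_eq_C_mul, map_add, map_mul, map_neg, map_one, map_natCast, map_ofNat]
        ring
      have h0 : ℓ (derivative (u ^ (m + 1) * X ^ j)) = 0 := by
        rw [hℓa, formalIntegral_derivative, formalIntegral_derivative]
        simp [hu, hw]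
      rw [hd, map_add, map_add, map_smul, map_smul, map_smul, ih (j + 1) (by omega),
        ih j (by omega), smul_zero, smul_zero, add_zero, add_zero, smul_eq_mul] at h0
      have : (3 * (m + 1) + j : K) ≠ 0 := by exact_mod_cast (by omega : 3 * (m + 1) + j ≠ 0)
      exact (mul_eq_zero.mp h0).resolve_left this
  have hall : ∀ p : K[X], ℓ (u ^ m * p) = 0 := by
    intro p
    induction p using Polynomial.induction_on' with
    | add p q hp hq => rw [mul_add, map_add, hp, hq, add_zero]
    | monomial n a =>
      rw [← C_mul_X_pow_eq_monomial, mul_left_comm, ← smul_eq_C_mul, map_smul, hmono, smul_zero]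
  have hvan : ∀ G : K[X], u ^ m ∣ derivative G → G.eval 0 = 0 →
      c₁ * G.eval z + c₂ * G.eval 1 = 0 := by
    rintro G ⟨p, hp⟩ hG
    have := hall p
    rwa [← hp, hℓa, formalIntegral_derivative, formalIntegral_derivative, hG, sub_zero,
      sub_zero] at this
  have hcop : ∀ a b : K, a ≠ b → IsCoprime (C a - X : K[X]) (C b - X) := fun a b hab => by
    have := (isCoprime_X_sub_C_of_isUnit_sub (sub_ne_zero.mpr hab).isUnit :
      IsCoprime (X - C a) (X - C b))
    simpa using this.neg_neg
  have h01 : IsCoprime (X : K[X]) (1 - X) := by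
    simpa using (hcop 0 1 zero_ne_one).neg_left
  have h0z : IsCoprime (X : K[X]) (C z - X) := by
    simpa using (hcop 0 z hz0.symm).neg_left
  have h1z : IsCoprime (1 - X : K[X]) (C z - X) := by
    simpa using hcop 1 z hz1.symm
  constructor
  · obtain ⟨G, hP, hQ, hG⟩ := exists_interpolation (h0z.mul_left h1z) m
    obtain ⟨p, hp⟩ := hP
    obtain ⟨q, hq⟩ := hQ
    have e0 : G.eval 0 = 0 := by rw [hp]; simp
    have e1 : G.eval 1 = 0 := by rw [hp]; simp
    have ez : G.eval z = 1 := by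
      rw [sub_eq_iff_eq_add.mp hq]; simp
    have := hvan G (by convert! hG using 2; rw [hu, hw]; ring) e0
    rwa [e1, ez, mul_one, mul_zero, add_zero] at this
  · obtain ⟨G, hP, hQ, hG⟩ := exists_interpolation (h01.mul_left h1z.symm) m
    obtain ⟨p, hp⟩ := hP
    obtain ⟨q, hq⟩ := hQ
    have e0 : G.eval 0 = 0 := by rw [hp]; simp
    have ez : G.eval z = 0 := by rw [hp]; simp
    have e1 : G.eval 1 = 1 := by
      rw [sub_eq_iff_eq_add.mp hq]; simp
    have := hvan G (by convert! hG using 2; rw [hu, hw]; ring) e0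
    rwa [e1, ez, mul_one, mul_zero, zero_add] at this

end PadeNonvanishing

section LocalDistances

open Finset

variable {K : Type*} [Field K]

lemma exists_padeForm [CharZero K] {z : K} (hz0 : z ≠ 0) (hz1 : z ≠ 1) (w : K) (m : ℕ) {N : ℕ}
    (hN0 : N ≠ 0) (hN : ∀ d ∈ Finset.Icc 1 (3 * m + 2), d ∣ N) :
    ∃ Δ : K, Δ ≠ 0 ∧ (∀ O : Subring K, z ∈ O → w ∈ O → Δ ∈ O) ∧
      ∀ v : AbsoluteValue K ℝ,
        v Δ ≤ N * 4 ^ m * 2 ^ (m + 3) * max 1 (v z) ^ (m + 1) * max (v z ^ (2 * m + 1)) (v w) ∧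
        v Δ ≤ N * 4 ^ m * 2 ^ (m + 3) * max 1 (v z) ^ (m + 1) *
          max (v (1 - z) ^ (2 * m + 1)) (v (1 - w)) := by
  obtain ⟨e, he, hne⟩ : ∃ e ≤ 1, 1 * formalIntegral z (padeIntegrand z m e) +
      (-w) * formalIntegral 1 (padeIntegrand z m e) ≠ 0 := by
    by_contra! h
    exact one_ne_zero (formalIntegral_padeIntegrand_independent hz0 hz1 m h).1
  obtain ⟨G, hG, hGO, hGv⟩ := exists_formalIntegral_self_eq z he hN
  obtain ⟨hRO, hRv⟩ := formalIntegral_one_bound z he hN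
  obtain ⟨G', hG', hGv'⟩ := exists_formalIntegral_one_sub_eq z he hN
  set P := formalIntegral z (padeIntegrand z m e)
  set R := formalIntegral 1 (padeIntegrand z m e)
  refine ⟨N * (1 * P + (-w) * R), mul_ne_zero (by exact_mod_cast hN0) hne, fun O hz hw => ?_,
    fun v => ?_⟩
  · rw [show (N : K) * (1 * P + (-w) * R) = z ^ (2 * m + 1) * (N * G) - w * (N * R) by
      rw [hG]; ring]
    exact sub_mem (mul_mem (pow_mem hz _) (hGO O hz)) (mul_mem hw (hRO O hz))
  set M := max 1 (v z) with hM
  have hM1 : 1 ≤ M := le_max_left _ _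
  set B : ℝ := N * 4 ^ m * M ^ (m + 1) with hB
  have hB0 : 0 ≤ B := by positivity
  have h2 : (1 : ℝ) ≤ 2 ^ m := one_le_pow₀ (by norm_num)
  have hfin : N * 4 ^ m * 2 ^ (m + 3) * M ^ (m + 1) = B * 2 ^ m * 8 := by rw [hB, pow_add]; ring
  rw [hfin]
  constructor
  · set T := max (v z ^ (2 * m + 1)) (v w)
    have hT : 0 ≤ T := le_max_of_le_right (v.nonneg _)
    calc v (N * (1 * P + (-w) * R))
        = v (z ^ (2 * m + 1) * (N * G) - w * (N * R)) := by rw [hG]; ring_nf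
      _ ≤ v z ^ (2 * m + 1) * v (N * G) + v w * v (N * R) := by
          refine (v.sub_le_add _ _).trans ?_
          rw [map_mul, map_mul v w, map_pow]
      _ ≤ T * B + T * B := add_le_add
          (mul_le_mul (le_max_left _ _) (hGv v) (v.nonneg _) hT)
          (mul_le_mul (le_max_right _ _) (hRv v) (v.nonneg _) hT)
      _ ≤ B * 2 ^ m * 8 * T := by nlinarith [mul_nonneg hB0 hT]
  · set T := max (v (1 - z) ^ (2 * m + 1)) (v (1 - w))
    have hT : 0 ≤ T := le_max_of_le_right (v.nonneg _)
    have hM' : max 1 (v (1 - z)) ≤ 2 * M := by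
      have := v.sub_le_add 1 z
      rw [map_one] at this
      exact max_le (by linarith) (by linarith [le_max_right 1 (v z)])
    have hG'' : v (N * G') ≤ B * 2 ^ m * 4 := by
      refine (hGv' v).trans ?_
      have := pow_le_pow_left₀ (by positivity) hM' (m + 1)
      calc _ ≤ 2 * (N * 4 ^ m * (2 * M) ^ (m + 1)) := by gcongr
        _ = _ := by rw [hB, mul_pow]; ring
    calc v (N * (1 * P + (-w) * R))
        = v ((1 - w) * (N * R) - (1 - z) ^ (2 * m + 1) * (N * G')) := by
          congr 1; linear_combination -(N : K) * hG'
      _ ≤ v (1 - w) * v (N * R) + v (1 - z) ^ (2 * m + 1) * v (N * G') := by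
          refine (v.sub_le_add _ _).trans ?_
          rw [map_mul, map_mul v ((1 - z) ^ _), map_pow]
      _ ≤ T * B + T * (B * 2 ^ m * 4) := add_le_add
          (mul_le_mul (le_max_right _ _) (hRv v) (v.nonneg _) hT)
          (mul_le_mul (le_max_left _ _) hG'' (v.nonneg _) hT)
      _ ≤ B * 2 ^ m * 8 * T := by nlinarith [mul_nonneg hB0 hT]

/-- The `v`-adic logarithmic proximities of `z` to `0`, `1` and `∞`. -/
noncomputable def proximity (v : AbsoluteValue K ℝ) (z : K) : Fin 3 → ℝ :=
  ![Real.log (max 1 (v z)) - Real.log (v z),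
    Real.log (max 1 (v z)) - Real.log (v (1 - z)) + Real.log 2, Real.log (max 1 (v z))]

lemma proximity_nonneg (v : AbsoluteValue K ℝ) {z : K} (hz0 : z ≠ 0) (hz1 : z ≠ 1) (j : Fin 3) :
    0 ≤ proximity v z j := by
  have h1 : 0 < v (1 - z) := v.pos (sub_ne_zero.mpr hz1.symm)
  have h2 : v (1 - z) ≤ 1 + v z := (v.sub_le_add 1 z).trans_eq (by rw [map_one])
  have hM := le_max_right 1 (v z)
  have hM1 := le_max_left 1 (v z)
  fin_cases j
  · simpa [proximity] using Real.log_le_log (v.pos hz0) hM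
  · have : Real.log (v (1 - z)) ≤ Real.log (2 * max 1 (v z)) :=
      Real.log_le_log h1 (by linarith)
    rw [Real.log_mul (by norm_num) (by positivity)] at this
    simp [proximity]
    linarith
  · simpa [proximity] using Real.log_nonneg hM1

lemma exists_sum_proximity_le (v : AbsoluteValue K ℝ) {z : K} (hz0 : z ≠ 0) (hz1 : z ≠ 1) :
    ∃ j, ∑ i, proximity v z i ≤ proximity v z j + 4 * Real.log 2 := by
  have h0 : 0 < v z := v.pos hz0
  have h1 : 0 < v (1 - z) := v.pos (sub_ne_zero.mpr hz1.symm)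
  have h2 : 1 ≤ v z + v (1 - z) := by
    have := v.add_le z (1 - z)
    rwa [add_sub_cancel, map_one] at this
  have h3 : v z ≤ 1 + v (1 - z) := by
    have := v.sub_le_add 1 (1 - z)
    rwa [sub_sub_cancel, map_one] at this
  have hl2 : 0 < Real.log 2 := Real.log_pos (by norm_num)
  have hM1 := le_max_left 1 (v z)
  have hMpos : 0 < max 1 (v z) := by positivity
  have hup : ∀ a b : ℝ, 0 < a → 0 < b → a ≤ 2 * b → Real.log a ≤ Real.log b + Real.log 2 := by
    intro a b ha hb hab
    have := Real.log_le_log ha hab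
    rw [Real.log_mul (by norm_num) hb.ne'] at this
    linarith
  simp only [Fin.sum_univ_three, proximity, Matrix.cons_val_zero, Matrix.cons_val_one,
    Matrix.cons_val]
  rcases le_or_gt (v z) 2⁻¹ with hz | hz
  · refine ⟨0, ?_⟩
    have hM : max 1 (v z) = 1 := max_eq_left (by linarith [show (2⁻¹ : ℝ) ≤ 1 by norm_num])
    have := hup 1 (v (1 - z)) one_pos h1 (by linarith)
    simp only [hM, Matrix.cons_val_zero, Real.log_one] at *
    linarith
  have hMz : Real.log (max 1 (v z)) ≤ Real.log (v z) + Real.log 2 :=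
    hup _ _ hMpos h0 (max_le (by linarith) (by linarith))
  rcases le_or_gt (v (1 - z)) 2⁻¹ with hw | hw
  · refine ⟨1, ?_⟩
    have : Real.log (max 1 (v z)) ≤ Real.log 1 + Real.log 2 :=
      hup _ 1 hMpos one_pos (max_le (by norm_num) (by linarith))
    simp only [Matrix.cons_val_one, Matrix.cons_val_zero, Real.log_one] at *
    linarith
  · refine ⟨2, ?_⟩
    have h4 : Real.log (max 1 (v z)) ≤ Real.log (v (1 - z) * 2) + Real.log 2 :=
      hup _ _ hMpos (by positivity) (max_le (by linarith) (by linarith))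
    rw [Real.log_mul h1.ne' (by norm_num)] at h4
    simp only [Matrix.cons_val]
    linarith

lemma exists_log_padeForm_le [CharZero K] : ∃ C : ℝ, 0 ≤ C ∧ ∀ (z w : K) (_ : z ≠ 0) (_ : z ≠ 1)
    (_ : w ≠ 0) (_ : w ≠ 1) (m : ℕ) (_ : 1 ≤ m), ∃ Δ : K, Δ ≠ 0 ∧
      (∀ O : Subring K, z ∈ O → w ∈ O → Δ ∈ O) ∧
      ∀ (v : AbsoluteValue K ℝ) (j : Fin 3), Real.log (v Δ) ≤ C * m +
        (3 * m + 2) * Real.log (max 1 (v z)) + Real.log (max 1 (v w)) -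
        min ((2 * m + 1) * proximity v z j) (proximity v w j) := by
  have hl2 : 0 < Real.log 2 := Real.log_pos (by norm_num)
  have hl4 : 0 < Real.log 4 := Real.log_pos (by norm_num)
  refine ⟨(Real.log 4 + 4) * 5 + Real.log 4 + 7 * Real.log 2, by positivity,
    fun z w hz0 hz1 hw0 hw1 m hm => ?_⟩
  have hN0 : Nat.lcmUpto (3 * m + 2) ≠ 0 := Nat.lcmUpto_ne_zero _
  obtain ⟨Δ, hΔ, hO, hv⟩ := exists_padeForm hz0 hz1 w m hN0 (fun d hd => dvd_lcm (f := id) hd)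
  refine ⟨Δ, hΔ, hO, fun v j => ?_⟩
  obtain ⟨hv1, hv2⟩ := hv v
  have hm' : (1 : ℝ) ≤ m := by exact_mod_cast hm
  set N := Nat.lcmUpto (3 * m + 2) with hNdef
  have hNpos : (0 : ℝ) < N := by exact_mod_cast Nat.pos_of_ne_zero hN0
  have hlogN : Real.log N ≤ (Real.log 4 + 4) * (3 * m + 2) := by
    have h1 := Chebyshev.psi_le_const_mul_self (x := ((3 * m + 2 : ℕ) : ℝ)) (by positivity)
    rw [Chebyshev.psi_eq_log_lcmUpto] at h1
    push_cast at h1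
    exact h1
  set D : ℝ := N * 4 ^ m * 2 ^ (m + 3) with hD
  have hDpos : 0 < D := by positivity
  have hlogD : Real.log D ≤ ((Real.log 4 + 4) * 5 + Real.log 4 + 4 * Real.log 2) * m := by
    rw [hD, Real.log_mul (by positivity) (by positivity), Real.log_mul (by positivity)
      (by positivity), Real.log_pow, Real.log_pow]
    push_cast
    nlinarith
  set L := Real.log (max 1 (v z)) with hL
  set L' := Real.log (max 1 (v w)) with hL'
  have hL0 : 0 ≤ L := Real.log_nonneg (le_max_left _ _)
  have hL0' : 0 ≤ L' := Real.log_nonneg (le_max_left _ _)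
  have hgen : ∀ a b : ℝ, 0 < a → 0 < b →
      v Δ ≤ D * max 1 (v z) ^ (m + 1) * max (a ^ (2 * m + 1)) b →
      Real.log (v Δ) ≤ Real.log D + (m + 1) * L + max ((2 * m + 1) * Real.log a) (Real.log b) := by
    intro a b ha hb h
    have h1 := Real.log_le_log (v.pos hΔ) h
    rw [Real.log_mul (by positivity) (by positivity), Real.log_mul (by positivity) (by positivity),
      Real.log_pow] at h1
    have h2 : Real.log (max (a ^ (2 * m + 1)) b) = max ((2 * m + 1) * Real.log a) (Real.log b) := by
      rcases le_total (a ^ (2 * m + 1)) b with h | h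
      · have := Real.log_le_log (by positivity) h
        rw [Real.log_pow] at this
        push_cast at this
        rw [max_eq_right h, max_eq_right this]
      · have := Real.log_le_log (by positivity) h
        rw [Real.log_pow] at this
        push_cast at this
        rw [max_eq_left h, max_eq_left this, Real.log_pow]
        push_cast
        rfl
    rw [h2] at h1
    push_cast at h1
    exact h1
  have hz := v.pos hz0
  have hw := v.pos hw0
  have hz' : 0 < v (1 - z) := v.pos (sub_ne_zero.mpr hz1.symm)
  have hw' : 0 < v (1 - w) := v.pos (sub_ne_zero.mpr hw1.symm)
  have e1 := hgen _ _ hz hw hv1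
  have e2 := hgen _ _ hz' hw' hv2
  have hlz : Real.log (v z) ≤ L := Real.log_le_log hz (le_max_right _ _)
  have hlw : Real.log (v w) ≤ L' := Real.log_le_log hw (le_max_right _ _)
  have hmL : 0 ≤ m * L := by positivity
  have hmL' : 0 ≤ m * L' := by positivity
  have hml2 : Real.log 2 ≤ m * Real.log 2 := by nlinarith
  fin_cases j
  · simp only [proximity, Fin.zero_eta, Matrix.cons_val_zero]
    rcases max_cases ((2 * m + 1) * Real.log (v z)) (Real.log (v w)) with ⟨h, -⟩ | ⟨h, -⟩ <;>
    rw [h] at e1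
    · have := min_le_left ((2 * m + 1) * (L - Real.log (v z))) (L' - Real.log (v w))
      linarith
    · have := min_le_right ((2 * m + 1) * (L - Real.log (v z))) (L' - Real.log (v w))
      linarith
  · simp only [proximity, Fin.mk_one, Matrix.cons_val_one, Matrix.cons_val_zero]
    rcases max_cases ((2 * m + 1) * Real.log (v (1 - z))) (Real.log (v (1 - w)))
      with ⟨h, -⟩ | ⟨h, -⟩ <;> rw [h] at e2
    · have := min_le_left ((2 * m + 1) * (L - Real.log (v (1 - z)) + Real.log 2))
        (L' - Real.log (v (1 - w)) + Real.log 2)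
      linarith
    · have := min_le_right ((2 * m + 1) * (L - Real.log (v (1 - z)) + Real.log 2))
        (L' - Real.log (v (1 - w)) + Real.log 2)
      linarith
  · simp only [proximity, Fin.reduceFinMk, Matrix.cons_val]
    rcases max_cases ((2 * m + 1) * Real.log (v z)) (Real.log (v w)) with ⟨h, -⟩ | ⟨h, -⟩ <;>
    rw [h] at e1
    · have h3 := min_le_right ((2 * m + 1) * L) L'
      have h4 : (2 * m + 1) * Real.log (v z) ≤ (2 * m + 1) * L :=
        mul_le_mul_of_nonneg_left hlz (by positivity)
      linarith
    · have := min_le_left ((2 * m + 1) * L) L'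
      linarith

end LocalDistances

section UnitEquation

open Finset

variable {K : Type*} [Field K] {ι : Type*} [Fintype ι]

lemma sum_proximity (v : AbsoluteValue K ℝ) (z : K) :
    ∑ j, proximity v z j = 3 * Real.log (max 1 (v z)) - Real.log (v z) - Real.log (v (1 - z))
      + Real.log 2 := by
  simp only [Fin.sum_univ_three, proximity, Matrix.cons_val_zero, Matrix.cons_val_one,
    Matrix.cons_val]
  ring

/-- Over a ring of `S`-integers, described by finitely many absolute values through the product
formula and the Northcott property, the unit equation `z + z' = 1` has finitely many solutions. -/
theorem finite_unit_equation_of_northcott [CharZero K] (O : Subring K) (v : ι → AbsoluteValue K ℝ)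
    (k : ι → ℕ) (hk : ∀ i, 1 ≤ k i)
    (hprod : ∀ x ∈ O, x ≠ 0 → 0 ≤ ∑ i, k i * Real.log (v i x))
    (hnorthcott : ∀ B : ℝ, {x | x ∈ O ∧ ∑ i, k i * Real.log (max 1 (v i x)) ≤ B}.Finite) :
    {z : K | z ≠ 0 ∧ z ≠ 1 ∧ z ∈ O ∧ z⁻¹ ∈ O ∧ (1 - z)⁻¹ ∈ O}.Finite := by
  obtain ⟨C, hC, hform⟩ := exists_log_padeForm_le (K := K)
  have hl2 : 0 < Real.log 2 := Real.log_pos (by norm_num)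
  set U := {z : K | z ≠ 0 ∧ z ≠ 1 ∧ z ∈ O ∧ z⁻¹ ∈ O ∧ (1 - z)⁻¹ ∈ O} with hU
  set h : K → ℝ := fun z => ∑ i, k i * Real.log (max 1 (v i z)) with hh
  set W : ℝ := ∑ i, (k i : ℝ) with hW
  have hW0 : 0 ≤ W := sum_nonneg fun i _ => by positivity
  have hunit : ∀ x ∈ O, x⁻¹ ∈ O → x ≠ 0 → ∑ i, k i * Real.log (v i x) = 0 := by
    intro x hx hx' hx0
    have h1 := hprod x hx hx0
    have h2 := hprod _ hx' (inv_ne_zero hx0)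
    simp only [map_inv₀, Real.log_inv, mul_neg, sum_neg_distrib] at h2
    linarith
  have hsum : ∀ z ∈ U, ∑ i, k i * ∑ j, proximity (v i) z j = 3 * h z + W * Real.log 2 := by
    rintro z ⟨hz0, hz1, hzO, hzO', hzO''⟩
    have e1 := hunit z hzO hzO' hz0
    have e2 := hunit (1 - z) (sub_mem (one_mem O) hzO) hzO'' (sub_ne_zero.mpr hz1.symm)
    have : ∑ i, k i * ∑ j, proximity (v i) z j = 3 * h z - ∑ i, k i * Real.log (v i z)
        - ∑ i, k i * Real.log (v i (1 - z)) + W * Real.log 2 := by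
      simp only [hh, hW, sum_proximity, mul_sum, sum_mul, ← sum_sub_distrib, ← sum_add_distrib]
      exact sum_congr rfl fun i _ => by ring
    rw [this, e1, e2]
    ring
  set H₀ : ℝ := 2 * W * (C + 9 * Real.log 2) + W * Real.log 2 + 1 with hH₀
  have hWC : 0 ≤ W * (C + 9 * Real.log 2) := by positivity
  have hWl : 0 ≤ W * Real.log 2 := by positivity
  set ε : ℝ := 1 / (10 * (W + 1)) with hε
  have hε0 : 0 < ε := by positivity
  have hWε : W * ε ≤ 1 / 10 := by
    rw [hε, mul_one_div, div_le_div_iff₀ (by positivity) (by norm_num)]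
    linarith
  have hsmall : {z ∈ U | h z ≤ H₀}.Finite :=
    (hnorthcott H₀).subset fun z hz => ⟨hz.1.2.2.1, hz.2⟩
  suffices hbig : {z ∈ U | H₀ < h z}.Finite by
    refine (hsmall.union hbig).subset fun z hz => ?_
    rcases le_or_gt (h z) H₀ with hz' | hz'
    exacts [Or.inl ⟨hz, hz'⟩, Or.inr ⟨hz, hz'⟩]
  have hprox : ∀ z ∈ U, H₀ < h z → ∀ i j, proximity (v i) z j ≤ 4 * h z := by
    intro z hz hzH i j
    have h0 := fun i j => proximity_nonneg (v i) hz.1 hz.2.1 j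
    have h1 : proximity (v i) z j ≤ ∑ j, proximity (v i) z j :=
      single_le_sum (f := fun j => proximity (v i) z j) (fun j _ => h0 i j) (mem_univ j)
    have h2 : 0 ≤ ∑ j, proximity (v i) z j := sum_nonneg fun j _ => h0 i j
    have h3 : k i * ∑ j, proximity (v i) z j ≤ ∑ i, k i * ∑ j, proximity (v i) z j :=
      single_le_sum (f := fun i => k i * ∑ j, proximity (v i) z j)
        (fun i _ => mul_nonneg (by positivity) (sum_nonneg fun j _ => h0 i j)) (mem_univ i)
    have h4 : (1 : ℝ) ≤ k i := by exact_mod_cast hk i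
    rw [hsum z hz] at h3
    nlinarith
  set q : K → ι → Fin 3 → ℕ := fun z i j => ⌊proximity (v i) z j / (ε * h z)⌋₊ with hq
  refine Set.Finite.of_finite_fibers q ?_ ?_
  · refine (Set.Finite.pi' fun _ : ι => Set.Finite.pi' fun _ : Fin 3 =>
      Set.finite_Iic ⌊4 / ε⌋₊).subset ?_
    rintro _ ⟨z, ⟨hz, hzH⟩, rfl⟩ i j
    refine Nat.floor_le_floor ?_
    have : 0 < h z := by linarith
    rw [div_le_div_iff₀ (by positivity) hε0]
    nlinarith [mul_le_mul_of_nonneg_right (hprox z hz hzH i j) hε0.le]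
  rintro _ ⟨z, ⟨hz, hzH⟩, rfl⟩
  refine (hnorthcott (21 * h z)).subset ?_
  rintro w ⟨⟨hw, hwH⟩, hqw⟩
  refine ⟨hw.2.2.1, ?_⟩
  by_contra! hzw
  change 21 * h z < h w at hzw
  replace hqw : q w = q z := hqw
  have hHpos : 0 < h z := by linarith
  have hHpos' : 0 < h w := by linarith
  set m := ⌊(h w / h z - 1) / 2⌋₊ with hm
  have hratio : 21 < h w / h z := by rwa [lt_div_iff₀ hHpos]
  have hm10 : 10 ≤ m := Nat.le_floor (by push_cast; linarith)
  have hm1 : (2 * m + 1) * h z ≤ h w := by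
    have := Nat.floor_le (a := (h w / h z - 1) / 2) (by linarith)
    rw [← hm] at this
    rw [← le_div_iff₀ hHpos]
    linarith
  have hm2 : h w ≤ (2 * m + 3) * h z := by
    have := Nat.lt_floor_add_one ((h w / h z - 1) / 2)
    rw [← hm] at this
    rw [← div_le_iff₀ hHpos]
    linarith
  have hm10' : (10 : ℝ) ≤ m := by exact_mod_cast hm10
  obtain ⟨Δ, hΔ, hΔO, hΔv⟩ := hform z w hz.1 hz.2.1 hw.1 hw.2.1 m (by omega)
  have hmain := hprod Δ (hΔO O hz.2.2.1 hw.2.2.1) hΔ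
  have hloc : ∀ i, Real.log (v i Δ) ≤ C * m + (3 * m + 2) * Real.log (max 1 (v i z)) +
      Real.log (max 1 (v i w)) -
      (2 * m + 1) * (∑ j, proximity (v i) z j - 4 * Real.log 2 - ε * h z) := by
    intro i
    obtain ⟨j, hj⟩ := exists_sum_proximity_le (v i) hz.1 hz.2.1
    have h1 := hΔv (v i) j
    have h2 : (2 * m + 1) * (proximity (v i) z j - ε * h z) ≤
        min ((2 * m + 1) * proximity (v i) z j) (proximity (v i) w j) := by
      have hεh : 0 < ε * h z := by positivity
      refine le_min (mul_le_mul_of_nonneg_left (by linarith) (by positivity)) ?_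
      have f1 := Nat.lt_floor_add_one (proximity (v i) z j / (ε * h z))
      have f2 := Nat.floor_le (a := proximity (v i) w j / (ε * h w))
        (div_nonneg (proximity_nonneg _ hw.1 hw.2.1 j) (by positivity))
      have f3 : ⌊proximity (v i) w j / (ε * h w)⌋₊ = ⌊proximity (v i) z j / (ε * h z)⌋₊ :=
        congrFun (congrFun hqw i) j
      rw [f3, le_div_iff₀ (by positivity)] at f2
      rw [div_lt_iff₀ hεh] at f1
      set a : ℝ := (⌊proximity (v i) z j / (ε * h z)⌋₊ : ℝ)
      have ha : 0 ≤ a * ε := by positivity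
      have := mul_le_mul_of_nonneg_left hm1 ha
      have := mul_le_mul_of_nonneg_left f1.le (show (0 : ℝ) ≤ 2 * m + 1 by positivity)
      linarith
    have h3 := mul_le_mul_of_nonneg_left hj (show (0 : ℝ) ≤ 2 * m + 1 by positivity)
    linarith
  have htot : ∑ i, k i * Real.log (v i Δ) ≤ W * (C * m) + (3 * m + 2) * h z + h w -
      (2 * m + 1) * (3 * h z + W * Real.log 2 - W * (4 * Real.log 2 + ε * h z)) := by
    rw [← hsum z hz]
    calc _ ≤ ∑ i, k i * (C * m + (3 * m + 2) * Real.log (max 1 (v i z)) +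
          Real.log (max 1 (v i w)) -
          (2 * m + 1) * (∑ j, proximity (v i) z j - 4 * Real.log 2 - ε * h z)) :=
          sum_le_sum fun i _ => mul_le_mul_of_nonneg_left (hloc i) (by positivity)
      _ = _ := by
          generalize ε * h z = x
          generalize hs : (fun i => ∑ j, proximity (v i) z j) = s
          simp only [funext_iff] at hs
          simp only [hs, hh, hW, mul_sum, sum_mul, ← sum_sub_distrib, ← sum_add_distrib]
          exact sum_congr rfl fun i _ => by ring
  have hfinal : W * ε * h z ≤ 1 / 10 * h z := by gcongr
  have hz' : 2 * W * (C + 9 * Real.log 2) < h z := by linarith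
  have := mul_lt_mul_of_pos_left hz' (show (0 : ℝ) < m by linarith)
  nlinarith

end UnitEquation

section UnitEquationNumberField

open Finset

variable {M : Type*} [Field M] [NumberField M]

lemma finitePlace_mk_le_one {p : HeightOneSpectrum (𝓞 M)} {x : M} (h : p.valuation M x ≤ 1) :
    FinitePlace.mk p x ≤ 1 := by
  rw [FinitePlace.mk_apply, FinitePlace.norm_embedding, HeightOneSpectrum.adicAbv_def]
  exact_mod_cast (WithZeroMulInt.toNNReal_le_one_iff
    (HeightOneSpectrum.one_lt_absNorm_nnreal p)).mpr h

lemma hasFiniteMulSupport_mk {x : M} (hx : x ≠ 0) :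
    (Function.mulSupport fun p : HeightOneSpectrum (𝓞 M) => FinitePlace.mk p x).Finite := by
  refine ((FinitePlace.hasFiniteMulSupport hx).image FinitePlace.maximalIdeal).subset ?_
  intro p hp
  exact ⟨FinitePlace.mk p, hp, FinitePlace.maximalIdeal_mk p⟩

theorem finite_unit_equation (T : Finset (HeightOneSpectrum (𝓞 M))) :
    {z : M | z ≠ 0 ∧ z ≠ 1 ∧ z ∈ (T : Set (HeightOneSpectrum (𝓞 M))).integer M ∧
      z⁻¹ ∈ (T : Set (HeightOneSpectrum (𝓞 M))).integer M ∧
      (1 - z)⁻¹ ∈ (T : Set (HeightOneSpectrum (𝓞 M))).integer M}.Finite := by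
  classical
  refine finite_unit_equation_of_northcott (ι := InfinitePlace M ⊕ T)
    ((T : Set (HeightOneSpectrum (𝓞 M))).integer M).toSubring
    (Sum.elim (fun w => w.1) fun p => (FinitePlace.mk p.1).1)
    (Sum.elim InfinitePlace.mult fun _ => 1) ?_ ?_ ?_
  · rintro (w | p)
    exacts [w.mult_pos, le_rfl]
  · intro x hx hx0
    have hfin := hasFiniteMulSupport_mk hx0
    have hprod := NumberField.prod_abs_eq_one hx0
    have hsub : (Function.mulSupport fun p : HeightOneSpectrum (𝓞 M) => FinitePlace.mk p x) ⊆
        (hfin.toFinset ∪ T : Finset _) := by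
      intro p hp
      exact mem_coe.mpr (mem_union_left _ (hfin.mem_toFinset.mpr hp))
    have hpos : ∀ p : HeightOneSpectrum (𝓞 M), FinitePlace.mk p x ≠ 0 :=
      fun p => (FinitePlace.pos_iff.mpr hx0).ne'
    have hpos' : ∀ w : InfinitePlace M, w x ≠ 0 := fun w => (InfinitePlace.pos_iff.mpr hx0).ne'
    rw [← finprod_comp_equiv FinitePlace.equivHeightOneSpectrum.symm] at hprod
    change _ * ∏ᶠ p : HeightOneSpectrum (𝓞 M), FinitePlace.mk p x = 1 at hprod
    rw [finprod_eq_prod_of_mulSupport_subset _ hsub] at hprod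
    have hlog := congrArg Real.log hprod
    rw [Real.log_one, Real.log_mul (prod_ne_zero_iff.mpr fun w _ => pow_ne_zero _ (hpos' w))
      (prod_ne_zero_iff.mpr fun p _ => hpos p),
      Real.log_prod (fun w _ => pow_ne_zero _ (hpos' w)), Real.log_prod (fun p _ => hpos p)] at hlog
    simp only [Real.log_pow] at hlog
    have hle : ∑ p ∈ hfin.toFinset ∪ T, Real.log (FinitePlace.mk p x) ≤
        ∑ p ∈ T, Real.log (FinitePlace.mk p x) := by
      rw [← sum_sdiff (subset_union_right : T ⊆ hfin.toFinset ∪ T)]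
      refine add_le_of_nonpos_left (sum_nonpos fun p hp => ?_)
      exact Real.log_nonpos (apply_nonneg _ _) (finitePlace_mk_le_one (hx p
        (by simpa using (mem_sdiff.mp hp).2)))
    rw [Fintype.sum_sum_type]
    simp only [Sum.elim_inl, Sum.elim_inr, Nat.cast_one, one_mul]
    rw [sum_coe_sort T fun p => Real.log ((FinitePlace.mk p).1 x)]
    change 0 ≤ _ + ∑ p ∈ T, Real.log (FinitePlace.mk p x)
    refine le_trans ?_ (add_le_add_right hle _)
    rw [← hlog]
    exact le_rfl
  · intro B
    refine (finite_setOfPred_logHeight₁_le M B).subset ?_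
    rintro x ⟨hx, hB⟩
    refine le_trans (le_of_eq ?_) hB
    rw [logHeight₁_eq]
    simp only [Fintype.sum_sum_type, Sum.elim_inl, Sum.elim_inr, Nat.cast_one, one_mul]
    rw [sum_coe_sort T fun p => Real.log (max 1 ((FinitePlace.mk p).1 x)),
      ← finsum_comp_equiv FinitePlace.equivHeightOneSpectrum.symm]
    have hsub : (Function.support fun p : HeightOneSpectrum (𝓞 M) =>
        Real.posLog (FinitePlace.equivHeightOneSpectrum.symm p x)) ⊆ (T : Set _) := by
      intro p hp
      by_contra hpT
      refine hp ((Real.posLog_eq_zero_iff _).mpr ?_)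
      rw [abs_of_nonneg (apply_nonneg _ _)]
      exact finitePlace_mk_le_one (hx p hpT)
    rw [finsum_eq_sum_of_support_subset _ hsub]
    congr 1
    · refine sum_congr rfl fun w _ => ?_
      rw [Real.posLog_eq_log_max_one (apply_nonneg _ _)]
      rfl
    · refine sum_congr rfl fun p _ => ?_
      rw [Real.posLog_eq_log_max_one (apply_nonneg _ _)]
      rfl

end UnitEquationNumberField

section LocalForms

open MvPolynomial Finset

/-- The binary form `a ∏ (βᵢ x - αᵢ y)`. -/
noncomputable def formOfRoots {R : Type*} [CommRing R] {n : ℕ} (a : R) (α β : Fin n → R) :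
    MvPolynomial (Fin 2) R :=
  C a * ∏ i, (C (β i) * X 0 - C (α i) * X 1)

lemma map_formOfRoots {R R' : Type*} [CommRing R] [CommRing R'] (φ : R →+* R') {n : ℕ} (a : R)
    (α β : Fin n → R) :
    map φ (formOfRoots a α β) = formOfRoots (φ a) (φ ∘ α) (φ ∘ β) := by
  simp [formOfRoots, map_prod]

lemma linearForm_ne_zero {R : Type*} [CommRing R] {α β : R} (h : α ≠ 0 ∨ β ≠ 0) :
    (C β * X 0 - C α * X 1 : MvPolynomial (Fin 2) R) ≠ 0 := by
  intro h0
  have h1 := congrArg (eval ![1, 0]) h0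
  have h2 := congrArg (eval ![0, 1]) h0
  simp at h1 h2
  tauto

lemma prod_Ioi_mul_sq {M : Type*} [CommMonoid M] {n : ℕ} (x : Fin n → M) :
    ∏ i, ∏ j ∈ Ioi i, (x i * x j) ^ 2 = (∏ i, x i) ^ (2 * n - 2) := by
  have h : ∏ i, ∏ j ∈ Ioi i, x j ^ 2 = ∏ j, ∏ _i ∈ Iio j, x j ^ 2 :=
    prod_comm' (by simp)
  simp only [mul_pow, prod_mul_distrib]
  rw [h, ← prod_mul_distrib, ← prod_pow]
  refine prod_congr rfl fun i _ => ?_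
  rw [prod_const, prod_const, Fin.card_Ioi, Fin.card_Iio, ← pow_mul, ← pow_mul, ← pow_add]
  congr 1
  omega

variable {L Γ : Type*} [Field L] [LinearOrderedCommGroupWithZero Γ] (v : Valuation L Γ)
  {n : ℕ} {a : L} {α β : Fin n → L}

/-- The Gauss lemma for a form that splits into linear factors. -/
lemma valuation_mul_prod_max_le_one (hne : ∀ i, α i ≠ 0 ∨ β i ≠ 0)
    (hint : ∀ m, v ((formOfRoots a α β).coeff m) ≤ 1) :
    v a * ∏ i, max (v (α i)) (v (β i)) ≤ 1 := by
  have hx : ∀ i, ∃ x : L, x ≠ 0 ∧ v x = max (v (α i)) (v (β i)) := by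
    intro i
    rcases le_total (v (α i)) (v (β i)) with h | h
    · refine ⟨β i, fun h0 => ?_, (max_eq_right h).symm⟩
      rw [h0, map_zero, le_zero_iff, map_eq_zero] at h
      simpa [h0, h] using hne i
    · refine ⟨α i, fun h0 => ?_, (max_eq_left h).symm⟩
      rw [h0, map_zero, le_zero_iff, map_eq_zero] at h
      simpa [h0, h] using hne i
  choose x hx0 hx using hx
  have hα : ∀ i, α i / x i ∈ v.valuationSubring := fun i => by
    rw [Valuation.mem_valuationSubring_iff, map_div₀, hx]
    exact div_le_one_of_le₀ (le_max_left _ _) zero_le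
  have hβ : ∀ i, β i / x i ∈ v.valuationSubring := fun i => by
    rw [Valuation.mem_valuationSubring_iff, map_div₀, hx]
    exact div_le_one_of_le₀ (le_max_right _ _) zero_le
  set α' : Fin n → v.valuationSubring := fun i => ⟨_, hα i⟩
  set β' : Fin n → v.valuationSubring := fun i => ⟨_, hβ i⟩
  set F := formOfRoots 1 α' β' with hF
  have hiff : ∀ y : v.valuationSubring, IsLocalRing.residue v.valuationSubring y ≠ 0 ↔
      v (y : L) = 1 := by
    intro y
    rw [IsLocalRing.residue_ne_zero_iff_isUnit]
    exact (Valuation.integer.integers v).isUnit_iff_valuation_eq_one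
  have hprim : map (IsLocalRing.residue v.valuationSubring) F ≠ 0 := by
    rw [hF, map_formOfRoots, formOfRoots, map_one, C_1, one_mul, prod_ne_zero_iff]
    intro i _
    refine linearForm_ne_zero ?_
    have hx1 : v (x i) ≠ 0 := v.ne_zero_iff.mpr (hx0 i)
    rcases max_choice (v (α i)) (v (β i)) with h | h
    · refine Or.inl ((hiff _).mpr ?_)
      rw [← hx] at h
      simp only [α', map_div₀, ← h, div_self hx1]
    · refine Or.inr ((hiff _).mpr ?_)
      rw [← hx] at h
      simp only [β', map_div₀, ← h, div_self hx1]
  obtain ⟨m, hm⟩ := ne_zero_iff.mp hprim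
  rw [coeff_map] at hm
  have hcoe : formOfRoots a α β = C (a * ∏ i, x i) * map v.valuationSubring.subtype F := by
    rw [hF, map_formOfRoots, formOfRoots, formOfRoots, map_one, C_1, one_mul, C_mul, mul_assoc,
      map_prod, ← prod_mul_distrib]
    congr 1
    refine prod_congr rfl fun i _ => ?_
    rw [mul_sub, ← mul_assoc, ← mul_assoc, ← C_mul, ← C_mul]
    simp [α', β', mul_div_cancel₀ _ (hx0 i)]
  have h1 := hint m
  have h2 : v (v.valuationSubring.subtype (F.coeff m)) = 1 := (hiff _).mp hm
  rwa [hcoe, coeff_C_mul, coeff_map, map_mul, h2, mul_one, map_mul, map_prod,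
    prod_congr rfl fun i _ => hx i] at h1

lemma valuation_det_le (i j : Fin n) : v (α i * β j - α j * β i) ≤
    max (v (α i)) (v (β i)) * max (v (α j)) (v (β j)) := by
  refine (v.map_sub _ _).trans (max_le ?_ ?_)
  · rw [map_mul]
    exact mul_le_mul' (le_max_left _ _) (le_max_right _ _)
  · rw [map_mul, mul_comm]
    exact mul_le_mul' (le_max_right _ _) (le_max_left _ _)

variable (hn : 2 ≤ n) (hint : ∀ m, v ((formOfRoots a α β).coeff m) ≤ 1)
  (hdisc : v (a ^ (2 * n - 2) * ∏ i, ∏ j ∈ Ioi i, (α i * β j - α j * β i) ^ 2) = 1)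

include hdisc in
lemma det_ne_zero_of_lt {i j : Fin n} (hij : i < j) : α i * β j - α j * β i ≠ 0 := by
  intro h0
  have : ∏ i, ∏ j ∈ Ioi i, (α i * β j - α j * β i) ^ 2 = 0 :=
    prod_eq_zero (mem_univ i) (prod_eq_zero (mem_Ioi.mpr hij) (by rw [h0]; ring))
  rw [this, mul_zero, map_zero] at hdisc
  exact zero_ne_one hdisc

include hn hdisc in
lemma root_ne_zero (i : Fin n) : α i ≠ 0 ∨ β i ≠ 0 := by
  by_contra! h
  obtain ⟨j, hj⟩ : ∃ j : Fin n, j ≠ i := by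
    have : Nontrivial (Fin n) := Fin.nontrivial_iff_two_le.mpr hn
    exact exists_ne i
  rcases lt_or_gt_of_ne hj with hij | hij
  · exact det_ne_zero_of_lt v hdisc hij (by simp [h])
  · exact det_ne_zero_of_lt v hdisc hij (by simp [h])

include hn hint hdisc in
lemma valuation_mul_prod_max_eq_one : v a * ∏ i, max (v (α i)) (v (β i)) = 1 := by
  refine le_antisymm (valuation_mul_prod_max_le_one v (root_ne_zero v hn hdisc) hint) ?_
  rw [← one_le_pow_iff (n := 2 * n - 2) (by omega), ← hdisc, mul_pow, ← prod_Ioi_mul_sq, map_mul,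
    map_pow, map_prod]
  refine mul_le_mul' le_rfl (prod_le_prod' fun i _ => ?_)
  rw [map_prod]
  refine prod_le_prod' fun j _ => ?_
  rw [map_pow]
  exact pow_le_pow_left₀ zero_le (valuation_det_le v i j) 2

include hn hint hdisc in
lemma valuation_det_eq {i j : Fin n} (hij : i ≠ j) : v (α i * β j - α j * β i) =
    max (v (α i)) (v (β i)) * max (v (α j)) (v (β j)) := by
  wlog h : i < j generalizing i j
  · rw [v.map_sub_swap, mul_comm (max _ _), ← this hij.symm (lt_of_le_of_ne (not_lt.mp h) hij.symm)]
  set N := fun i => max (v (α i)) (v (β i)) with hN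
  have hA := valuation_mul_prod_max_eq_one v hn hint hdisc
  have hN0 : ∀ i, N i ≠ 0 := by
    intro i h0
    rw [prod_eq_zero (mem_univ i) h0, mul_zero] at hA
    exact zero_ne_one hA
  have hle : ∀ i j, (v (α i * β j - α j * β i) / (N i * N j)) ^ 2 ≤ 1 := fun i j =>
    pow_le_one₀ zero_le (div_le_one_of_le₀ (valuation_det_le v i j) zero_le)
  have hprod : ∏ i, ∏ j ∈ Ioi i, (v (α i * β j - α j * β i) / (N i * N j)) ^ 2 = 1 := by
    simp only [div_pow, prod_div_distrib]
    rw [prod_Ioi_mul_sq, div_eq_one_iff_eq (pow_ne_zero _ (prod_ne_zero_iff.mpr fun i _ => hN0 i)),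
      eq_comm]
    have ha : v a ^ (2 * n - 2) ≠ 0 := by
      refine pow_ne_zero _ fun h0 => ?_
      rw [h0, zero_mul] at hA
      exact zero_ne_one hA
    refine mul_left_cancel₀ ha ?_
    rw [← mul_pow, hA, one_pow, ← hdisc, map_mul, map_pow]
    simp only [map_prod, map_pow]
  rw [prod_eq_one_iff_of_le_one' fun i _ => prod_le_one' fun j _ => hle i j] at hprod
  have h1 := hprod i (mem_univ i)
  rw [prod_eq_one_iff_of_le_one' fun j _ => hle i j] at h1
  have h2 := h1 j (mem_Ioi.mpr h)
  rw [pow_eq_one_iff_of_nonneg zero_le two_ne_zero] at h2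
  exact (div_eq_one_iff_eq (mul_ne_zero (hN0 i) (hN0 j))).mp h2

include hn hint hdisc in
lemma valuation_le_one_of_mul_coeff {c : L}
    (hc : ∀ m, v (c * (formOfRoots a α β).coeff m) ≤ 1) : v c ≤ 1 := by
  have h := valuation_mul_prod_max_le_one v (a := c * a) (root_ne_zero v hn hdisc) (fun m => by
    rw [show formOfRoots (c * a) α β = C c * formOfRoots a α β by
      rw [formOfRoots, formOfRoots, C_mul, mul_assoc], coeff_C_mul]
    exact hc m)
  rwa [map_mul, mul_assoc, valuation_mul_prod_max_eq_one v hn hint hdisc, mul_one] at h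

end LocalForms

section PrimesAbove

variable {K : Type*} [Field K] [NumberField K] (L : Type*) [Field L] [NumberField L] [Algebra K L]

lemma valuation_le_one_iff_under (P : HeightOneSpectrum (𝓞 L)) (x : K) :
    P.valuation L (algebraMap K L x) ≤ 1 ↔ (P.under (𝓞 K)).valuation K x ≤ 1 := by
  have : P.asIdeal.LiesOver (P.under (𝓞 K)).asIdeal := ⟨rfl⟩
  rw [← HeightOneSpectrum.valuation_liesOver L (P.under (𝓞 K)) P x]
  exact pow_le_one_iff
    (Ideal.IsDedekindDomain.ramificationIdx'_ne_zero_of_liesOver _ (P.under (𝓞 K)).ne_bot)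

omit [NumberField L] in
lemma exists_under_eq (p : HeightOneSpectrum (𝓞 K)) :
    ∃ P : HeightOneSpectrum (𝓞 L), P.under (𝓞 K) = p := by
  obtain ⟨P, hP, hPp⟩ := Ideal.exists_maximal_ideal_liesOver_of_isIntegral (S := 𝓞 L) p.asIdeal
  refine ⟨⟨P, hP.isPrime, ?_⟩, ?_⟩
  · exact Ideal.ne_bot_of_liesOver_of_ne_bot p.ne_bot P
  · ext1
    exact hPp.over.symm

lemma finite_under_mem (S : Finset (HeightOneSpectrum (𝓞 K))) :
    {P : HeightOneSpectrum (𝓞 L) | P.under (𝓞 K) ∈ S}.Finite := by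
  refine Set.Finite.preimage' (f := fun P : HeightOneSpectrum (𝓞 L) => P.under (𝓞 K))
    S.finite_toSet fun p _ => ?_
  refine Set.Finite.of_finite_image (f := HeightOneSpectrum.asIdeal) ?_
    fun _ _ _ _ h => HeightOneSpectrum.ext h
  refine (IsDedekindDomain.primesOver_finite p.asIdeal (𝓞 L)).subset ?_
  rintro _ ⟨P, hP, rfl⟩
  exact ⟨P.isPrime, ⟨(congrArg HeightOneSpectrum.asIdeal hP).symm⟩⟩

/-- The primes of `L` lying above a prime in `S`. -/
noncomputable def primesAbove (S : Finset (HeightOneSpectrum (𝓞 K))) :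
    Finset (HeightOneSpectrum (𝓞 L)) :=
  (finite_under_mem L S).toFinset

lemma mem_primesAbove {S : Finset (HeightOneSpectrum (𝓞 K))} {P : HeightOneSpectrum (𝓞 L)} :
    P ∈ primesAbove L S ↔ P.under (𝓞 K) ∈ S := by
  simp [primesAbove]

lemma algebraMap_mem_integer_iff {S : Finset (HeightOneSpectrum (𝓞 K))} {x : K} :
    algebraMap K L x ∈ (primesAbove L S : Set (HeightOneSpectrum (𝓞 L))).integer L ↔
      x ∈ (S : Set (HeightOneSpectrum (𝓞 K))).integer K := by
  constructor
  · intro h p hp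
    obtain ⟨P, rfl⟩ := exists_under_eq L p
    exact (valuation_le_one_iff_under L P x).mp (h P (by simpa [mem_primesAbove] using hp))
  · intro h P hP
    exact (valuation_le_one_iff_under L P x).mpr (h _ (by simpa [mem_primesAbove] using hP))

end PrimesAbove

section Projectivities

variable {ι : Type*} {L : Type*} [Field L]

/-- The determinant of the points `(αᵢ, βᵢ)` and `(αⱼ, βⱼ)`. -/
abbrev rootDet {R : Type*} [CommRing R] (α β : ι → R) (i j : ι) : R := α i * β j - α j * β i

/-- The matrix `γ`, acting on row vectors, maps each point `(αᵢ, βᵢ)` to the line spanned by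
`(α'ᵢ, β'ᵢ)`. -/
def MapsRoots {R : Type*} [CommRing R] (γ : Matrix (Fin 2) (Fin 2) R) (α β α' β' : ι → R) : Prop :=
  ∀ i, (α i * γ 0 0 + β i * γ 1 0) * β' i = (α i * γ 0 1 + β i * γ 1 1) * α' i

variable {α β α' β' : ι → L} {i₀ i₁ i₂ : ι} {γ : Matrix (Fin 2) (Fin 2) L}

lemma exists_mapsRoots (h01 : rootDet α β i₀ i₁ ≠ 0) (h02 : rootDet α β i₀ i₂ ≠ 0)
    (h21 : rootDet α β i₂ i₁ ≠ 0) (h01' : rootDet α' β' i₀ i₁ ≠ 0)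
    (h02' : rootDet α' β' i₀ i₂ ≠ 0) (h21' : rootDet α' β' i₂ i₁ ≠ 0)
    (hcross : ∀ i, rootDet α β i i₁ * rootDet α β i₀ i₂ *
        (rootDet α' β' i₀ i * rootDet α' β' i₂ i₁) =
      rootDet α' β' i i₁ * rootDet α' β' i₀ i₂ * (rootDet α β i₀ i * rootDet α β i₂ i₁)) :
    ∃ γ : Matrix (Fin 2) (Fin 2) L, γ.det ≠ 0 ∧ MapsRoots γ α β α' β' := by
  refine ⟨!![β i₁ * (rootDet α' β' i₂ i₁ * rootDet α β i₀ i₂) * α' i₀ -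
      β i₀ * (rootDet α' β' i₀ i₂ * rootDet α β i₂ i₁) * α' i₁,
    β i₁ * (rootDet α' β' i₂ i₁ * rootDet α β i₀ i₂) * β' i₀ -
      β i₀ * (rootDet α' β' i₀ i₂ * rootDet α β i₂ i₁) * β' i₁;
    -α i₁ * (rootDet α' β' i₂ i₁ * rootDet α β i₀ i₂) * α' i₀ +
      α i₀ * (rootDet α' β' i₀ i₂ * rootDet α β i₂ i₁) * α' i₁,
    -α i₁ * (rootDet α' β' i₂ i₁ * rootDet α β i₀ i₂) * β' i₀ +
      α i₀ * (rootDet α' β' i₀ i₂ * rootDet α β i₂ i₁) * β' i₁], ?_, fun i => ?_⟩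
  · rw [Matrix.det_fin_two_of]
    have : rootDet α' β' i₂ i₁ * rootDet α β i₀ i₂ * (rootDet α' β' i₀ i₂ * rootDet α β i₂ i₁) *
        rootDet α β i₀ i₁ * rootDet α' β' i₀ i₁ ≠ 0 := by simp only [ne_eq, mul_eq_zero]; tauto
    convert this using 1
    simp only [rootDet]
    ring
  · have := hcross i
    simp only [Matrix.of_apply, Matrix.cons_val_zero, Matrix.cons_val_one, Matrix.cons_val',
      Matrix.cons_val_fin_one]
    simp only [rootDet] at this ⊢
    linear_combination this

lemma MapsRoots.exists_smul (h : MapsRoots γ α β α' β')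
    (h' : ∀ i, α' i ≠ 0 ∨ β' i ≠ 0) : ∃ μ : ι → L, ∀ i,
      α i * γ 0 0 + β i * γ 1 0 = μ i * α' i ∧ α i * γ 0 1 + β i * γ 1 1 = μ i * β' i := by
  have this (i : ι) : ∃ μ, α i * γ 0 0 + β i * γ 1 0 = μ * α' i ∧
      α i * γ 0 1 + β i * γ 1 1 = μ * β' i := by
    have hi := h i
    rcases h' i with h0 | h0
    · refine ⟨(α i * γ 0 0 + β i * γ 1 0) / α' i, by field_simp, ?_⟩
      rw [div_mul_eq_mul_div, eq_div_iff h0, hi]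
    · refine ⟨(α i * γ 0 1 + β i * γ 1 1) / β' i, ?_, by field_simp⟩
      rw [div_mul_eq_mul_div, eq_div_iff h0, hi]
  exact ⟨fun i => (this i).choose, fun i => (this i).choose_spec⟩

section

variable {μ : ι → L} (hμ : ∀ i,
      α i * γ 0 0 + β i * γ 1 0 = μ i * α' i ∧ α i * γ 0 1 + β i * γ 1 1 = μ i * β' i)

include hμ

lemma det_mul_rootDet (i j : ι) :
    γ.det * rootDet α β i j = μ i * μ j * rootDet α' β' i j := by
  rw [Matrix.det_fin_two]
  simp only [rootDet]
  linear_combination (α i * γ 0 0 + β i * γ 1 0) * (hμ j).2 + μ j * β' j * (hμ i).1 -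
    (α j * γ 0 0 + β j * γ 1 0) * (hμ i).2 - μ i * β' i * (hμ j).1

lemma rootDet_mul_entry (i j : ι) :
    rootDet α β i j * γ 0 0 = β j * (μ i * α' i) - β i * (μ j * α' j) ∧
    rootDet α β i j * γ 0 1 = β j * (μ i * β' i) - β i * (μ j * β' j) ∧
    rootDet α β i j * γ 1 0 = α i * (μ j * α' j) - α j * (μ i * α' i) ∧
    rootDet α β i j * γ 1 1 = α i * (μ j * β' j) - α j * (μ i * β' i) := by
  simp only [rootDet, ← (hμ i).1, ← (hμ i).2, ← (hμ j).1, ← (hμ j).2]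
  refine ⟨?_, ?_, ?_, ?_⟩ <;> ring

lemma det_ne_zero_of_mapsRoots (h01 : rootDet α β i₀ i₁ ≠ 0) (h02 : rootDet α β i₀ i₂ ≠ 0)
    (h12 : rootDet α β i₁ i₂ ≠ 0) (h01' : rootDet α' β' i₀ i₁ ≠ 0)
    (h02' : rootDet α' β' i₀ i₂ ≠ 0) (h12' : rootDet α' β' i₁ i₂ ≠ 0) (hγ : γ ≠ 0) :
    γ.det ≠ 0 := by
  intro h0
  have key : ∀ i j, rootDet α β i j ≠ 0 → ¬ (μ i = 0 ∧ μ j = 0) := by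
    rintro i j hij ⟨hi, hj⟩
    have h := rootDet_mul_entry hμ i j
    simp only [hi, hj, zero_mul, mul_zero, sub_zero, mul_eq_zero, hij, false_or] at h
    apply hγ
    ext a b
    fin_cases a <;> fin_cases b <;> simp [h]
  have h1 := det_mul_rootDet hμ i₀ i₁
  have h2 := det_mul_rootDet hμ i₀ i₂
  have h3 := det_mul_rootDet hμ i₁ i₂
  simp only [h0, zero_mul, eq_comm (a := (0 : L)), mul_eq_zero, h01', h02', h12', or_false]
    at h1 h2 h3
  have k1 := key _ _ h01
  have k2 := key _ _ h02
  have k3 := key _ _ h12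
  tauto

lemma valuation_entry_mul_entry_le {Γ : Type*} [LinearOrderedCommGroupWithZero Γ]
    (v : Valuation L Γ) (N N' : ι → Γ) (hN : ∀ i, max (v (α i)) (v (β i)) = N i)
    (hN' : ∀ i, max (v (α' i)) (v (β' i)) = N' i) (hN0 : ∀ i, N i ≠ 0)
    (hd : ∀ i j, i ≠ j → v (rootDet α β i j) = N i * N j)
    (hd' : ∀ i j, i ≠ j → v (rootDet α' β' i j) = N' i * N' j)
    (h01 : i₀ ≠ i₁) (h02 : i₀ ≠ i₂) (h12 : i₁ ≠ i₂) (hγ : γ.det ≠ 0) (a b c d : Fin 2) :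
    v (γ a b * γ c d) ≤ v γ.det := by
  set r : ι → Γ := fun i => v (μ i) * N' i / N i with hr
  have hvμ : ∀ i, v (μ i) * N' i = r i * N i := fun i => by
    rw [hr, div_mul_cancel₀ _ (hN0 i)]
  have hdet : ∀ i j, i ≠ j → v γ.det = r i * r j := by
    intro i j hij
    have h := congrArg v (det_mul_rootDet hμ i j)
    rw [map_mul, map_mul, map_mul, hd i j hij, hd' i j hij, mul_mul_mul_comm, hvμ, hvμ,
      mul_mul_mul_comm] at h
    exact mul_right_cancel₀ (mul_ne_zero (hN0 i) (hN0 j)) h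
  have hrr : r i₀ * r i₀ ≤ v γ.det ∧ r i₁ = r i₀ := by
    have e1 := hdet _ _ h01
    have e2 := hdet _ _ h02
    have e3 := hdet _ _ h12
    have hd0 : v γ.det ≠ 0 := v.ne_zero_iff.mpr hγ
    have e4 : r i₁ = r i₂ :=
      mul_left_cancel₀ (left_ne_zero_of_mul (e1 ▸ hd0)) (e1.symm.trans e2)
    have e5 : r i₁ = r i₀ := by
      have h1 : r i₁ ≠ 0 := by rw [e3] at hd0; exact left_ne_zero_of_mul hd0
      rw [e3, ← e4] at e1
      exact mul_right_cancel₀ h1 e1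
    exact ⟨by rw [e1, e5], e5⟩
  have hkey : ∀ (x y z w g : L), v x ≤ N i₀ → v y ≤ N i₁ → v z ≤ N' i₀ → v w ≤ N' i₁ →
      rootDet α β i₀ i₁ * g = y * (μ i₀ * z) - x * (μ i₁ * w) → v g ≤ r i₀ := by
    intro x y z w g hx hy hz hw hg
    have h := congrArg v hg
    rw [map_mul, hd _ _ h01] at h
    have hle : v (y * (μ i₀ * z) - x * (μ i₁ * w)) ≤ N i₀ * N i₁ * r i₀ := by
      refine (v.map_sub _ _).trans (max_le ?_ ?_)
      · rw [map_mul, map_mul]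
        refine (mul_le_mul' hy (mul_le_mul' le_rfl hz)).trans_eq ?_
        rw [hvμ]
        ac_rfl
      · rw [map_mul, map_mul]
        refine (mul_le_mul' hx (mul_le_mul' le_rfl hw)).trans_eq ?_
        rw [hvμ, hrr.2]
        ac_rfl
    rw [← h] at hle
    exact le_of_mul_le_mul_left hle (zero_lt_iff.mpr (mul_ne_zero (hN0 _) (hN0 _)))
  have hα : ∀ i, v (α i) ≤ N i := fun i => hN i ▸ le_max_left _ _
  have hβ : ∀ i, v (β i) ≤ N i := fun i => hN i ▸ le_max_right _ _
  have hα' : ∀ i, v (α' i) ≤ N' i := fun i => hN' i ▸ le_max_left _ _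
  have hβ' : ∀ i, v (β' i) ≤ N' i := fun i => hN' i ▸ le_max_right _ _
  have hneg : ∀ {x : L} {y : Γ}, v x ≤ y → v (-x) ≤ y := fun h => by rwa [v.map_neg]
  obtain ⟨k1, k2, k3, k4⟩ := rootDet_mul_entry hμ i₀ i₁
  have hent : ∀ a b, v (γ a b) ≤ r i₀ := by
    intro a b
    fin_cases a <;> fin_cases b
    · exact hkey _ _ _ _ _ (hβ _) (hβ _) (hα' _) (hα' _) k1
    · exact hkey _ _ _ _ _ (hβ _) (hβ _) (hβ' _) (hβ' _) k2
    · exact hkey _ _ _ _ _ (hneg (hα _)) (hneg (hα _)) (hα' _) (hα' _) (k3.trans (by ring))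
    · exact hkey _ _ _ _ _ (hneg (hα _)) (hneg (hα _)) (hβ' _) (hβ' _) (k4.trans (by ring))
  rw [map_mul]
  exact (mul_le_mul' (hent a b) (hent c d)).trans hrr.1

end

end Projectivities

section Descent

variable {ι : Type*} {K M : Type*} [Field K] [Field M] [Algebra K M]

lemma exists_mapsRoots_descend [CharZero K] [FiniteDimensional K M] [IsGalois K M]
    {α β α' β' : ι → M} (hσ : ∀ σ : M ≃ₐ[K] M, ∃ π : ι → ι, π.Surjective ∧
      ∀ i, σ (α i) = α (π i) ∧ σ (β i) = β (π i) ∧ σ (α' i) = α' (π i) ∧ σ (β' i) = β' (π i))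
    {γ : Matrix (Fin 2) (Fin 2) M} (hγ : γ ≠ 0) (h : MapsRoots γ α β α' β') :
    ∃ γ₀ : Matrix (Fin 2) (Fin 2) K, γ₀ ≠ 0 ∧
      MapsRoots (γ₀.map (algebraMap K M)) α β α' β' := by
  obtain ⟨a, b, hab⟩ : ∃ a b, γ a b ≠ 0 := by
    by_contra! hc
    exact hγ (Matrix.ext hc)
  refine ⟨Matrix.of fun c d => Algebra.trace K M ((γ a b)⁻¹ * γ c d), fun h0 => ?_, fun i => ?_⟩
  · have h1 := congrFun (congrFun h0 a) b
    simp only [Matrix.of_apply, inv_mul_cancel₀ hab, Matrix.zero_apply] at h1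
    rw [← map_one (algebraMap K M), Algebra.trace_algebraMap, nsmul_one, Nat.cast_eq_zero] at h1
    exact Module.finrank_pos.ne' h1
  · simp only [Matrix.map_apply, Matrix.of_apply, trace_eq_sum_automorphisms, Finset.mul_sum,
      ← Finset.sum_add_distrib, Finset.sum_mul]
    refine Finset.sum_congr rfl fun σ _ => ?_
    obtain ⟨π, hπ, hπσ⟩ := hσ σ
    obtain ⟨j, rfl⟩ := hπ i
    obtain ⟨h1, h2, h3, h4⟩ := hπσ j
    rw [← h1, ← h2, ← h3, ← h4]
    simp only [← map_mul, ← map_add]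
    congr 1
    linear_combination (γ a b)⁻¹ * h j

lemma exists_integral_mapsRoots [NumberField K] [NumberField M] {α β α' β' : ι → M}
    {γ : Matrix (Fin 2) (Fin 2) K} (hγ : γ ≠ 0)
    (h : MapsRoots (γ.map (algebraMap K M)) α β α' β') :
    ∃ γ₀ : Matrix (Fin 2) (Fin 2) (𝓞 K), γ₀ ≠ 0 ∧
      MapsRoots ((γ₀.map (algebraMap (𝓞 K) K)).map (algebraMap K M)) α β α' β' := by
  obtain ⟨b, hb⟩ := IsLocalization.exist_integer_multiples_of_finite (nonZeroDivisors (𝓞 K))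
    (fun p : Fin 2 × Fin 2 => γ p.1 p.2)
  choose g hg using hb
  have hg' : ∀ c d, algebraMap (𝓞 K) K (g (c, d)) = algebraMap (𝓞 K) K b * γ c d := fun c d => by
    rw [hg, Algebra.smul_def]
  have hb0 : algebraMap (𝓞 K) K b ≠ 0 := by simp
  refine ⟨Matrix.of fun c d => g (c, d), fun h0 => hγ ?_, fun i => ?_⟩
  · ext c d
    have h1 := hg' c d
    have h2 : g (c, d) = 0 := congrFun (congrFun h0 c) d
    rw [h2, map_zero, eq_comm, mul_eq_zero] at h1
    simpa [hb0] using h1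
  · simp only [Matrix.map_apply, Matrix.of_apply, hg', map_mul]
    have := h i
    simp only [Matrix.map_apply] at this
    linear_combination algebraMap K M (algebraMap (𝓞 K) K b) * this

end Descent

section RootData

/-- The ring of `S`-integers. -/
noncomputable abbrev sIntegers {K : Type*} [Field K] [NumberField K]
    (S : Finset (HeightOneSpectrum (𝓞 K))) : Subalgebra (𝓞 K) K :=
  (S : Set (HeightOneSpectrum (𝓞 K))).integer K

open MvPolynomial Finset

variable {K : Type*} [Field K] [NumberField K] {M : Type*} [Field M] [Algebra K M]
  {S : Finset (HeightOneSpectrum (𝓞 K))} {n : ℕ}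

/-- `(a, α, β)` is a normalised factorisation over `M` of the form `f` with unit discriminant. -/
structure IsRootData (f : MvPolynomial (Fin 2) (sIntegers S))
    (a : M) (α β : Fin n → M) : Prop where
  map_eq : map ((algebraMap K M).comp
    (sIntegers S).val.toRingHom) f = formOfRoots a α β
  normalized : ∀ i, β i = 1 ∨ (α i = 1 ∧ β i = 0)
  disc : ∃ u : (sIntegers S)ˣ,
    a ^ (2 * n - 2) * ∏ i, ∏ j ∈ Ioi i, (α i * β j - α j * β i) ^ 2 =
      algebraMap K M ((u : sIntegers S) : K)

namespace IsRootData

variable {f : MvPolynomial (Fin 2) (sIntegers S)}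
    {a : M} {α β : Fin n → M}

lemma algebraMap_coeff (h : IsRootData f a α β) (m : Fin 2 →₀ ℕ) :
    algebraMap K M ((f.coeff m : sIntegers S) : K) = (formOfRoots a α β).coeff m := by
  rw [← h.map_eq, coeff_map]
  rfl

lemma disc_ne_zero (h : IsRootData f a α β) :
    a ^ (2 * n - 2) * ∏ i, ∏ j ∈ Ioi i, (α i * β j - α j * β i) ^ 2 ≠ 0 := by
  obtain ⟨u, hu⟩ := h.disc
  rw [hu]
  simp

lemma leading_ne_zero (h : IsRootData f a α β) (hn : 2 ≤ n) : a ≠ 0 := by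
  rintro rfl
  have := h.disc_ne_zero
  rw [zero_pow (by omega), zero_mul] at this
  exact this rfl

lemma rootDet_ne_zero (h : IsRootData f a α β) {i j : Fin n} (hij : i ≠ j) :
    rootDet α β i j ≠ 0 := by
  have key : ∀ {i j : Fin n}, i < j → rootDet α β i j ≠ 0 := by
    intro i j hij h0
    have h1 := right_ne_zero_of_mul h.disc_ne_zero
    rw [prod_ne_zero_iff] at h1
    have h2 := h1 i (mem_univ _)
    rw [prod_ne_zero_iff] at h2
    have h3 := h2 j (mem_Ioi.mpr hij)
    exact h3 (by rw [show α i * β j - α j * β i = 0 from h0]; simp)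
  rcases lt_or_gt_of_ne hij with h1 | h1
  · exact key h1
  · rw [← neg_ne_zero]
    simpa [rootDet] using key h1

lemma root_ne_zero (h : IsRootData f a α β) (i : Fin n) : α i ≠ 0 ∨ β i ≠ 0 := by
  rcases h.normalized i with h | h <;> simp [h]

lemma exists_galois_perm (h : IsRootData f a α β) (hn : 2 ≤ n) (σ : M ≃ₐ[K] M) (i : Fin n) :
    ∃ j, σ (α i) = α j ∧ σ (β i) = β j := by
  have h1 : formOfRoots (σ a) (σ ∘ α) (σ ∘ β) = formOfRoots a α β := by
    have := map_formOfRoots (σ : M →+* M) a α β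
    rw [← h.map_eq, MvPolynomial.map_map] at this
    refine Eq.trans this.symm ?_
    rw [← h.map_eq]
    congr 2
    ext x
    exact σ.commutes _
  have h2 := congrArg (eval ![σ (α i), σ (β i)]) h1
  have h3 : eval ![σ (α i), σ (β i)] (formOfRoots (σ a) (σ ∘ α) (σ ∘ β)) = 0 := by
    simp only [formOfRoots, map_mul, map_prod]
    rw [prod_eq_zero (mem_univ i), mul_zero]
    simp [mul_comm]
  rw [h3] at h2
  simp only [formOfRoots, map_mul, map_prod] at h2
  rw [eq_comm, mul_eq_zero, or_iff_right (by simpa using h.leading_ne_zero hn),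
    prod_eq_zero_iff] at h2
  obtain ⟨j, -, hj⟩ := h2
  refine ⟨j, ?_⟩
  simp only [map_sub, map_mul, eval_C, eval_X, Matrix.cons_val_zero, Matrix.cons_val_one,
    sub_eq_zero, Matrix.cons_val_fin_one] at hj
  rcases h.normalized j with hb | ⟨ha, hb⟩ <;> rcases h.normalized i with hb' | ⟨ha', hb'⟩ <;>
    simp_all

lemma surjective_of_galois_perm (h : IsRootData f a α β) {σ : M ≃ₐ[K] M} {π : Fin n → Fin n}
    (hπ : ∀ i, σ (α i) = α (π i) ∧ σ (β i) = β (π i)) : π.Surjective := by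
  refine Finite.injective_iff_surjective.mp fun i j hij => ?_
  by_contra hne
  refine h.rootDet_ne_zero hne ?_
  have h1 := (hπ i).1.trans ((congrArg α hij).trans (hπ j).1.symm)
  have h2 := (hπ i).2.trans ((congrArg β hij).trans (hπ j).2.symm)
  rw [σ.injective.eq_iff] at h1 h2
  simp [rootDet, h1, h2]

variable [NumberField M] {P : HeightOneSpectrum (𝓞 M)}

lemma valuation_coeff_le (h : IsRootData f a α β) (hP : P ∉ primesAbove M S) (m : Fin 2 →₀ ℕ) :
    P.valuation M ((formOfRoots a α β).coeff m) ≤ 1 := by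
  rw [← h.algebraMap_coeff]
  exact (algebraMap_mem_integer_iff M).mpr (f.coeff m : sIntegers S).2 P hP

omit [NumberField M] in
lemma _root_.valuation_unit_eq_one [NumberField M]
    (u : (sIntegers S)ˣ) (hP : P ∉ primesAbove M S) :
    P.valuation M (algebraMap K M ((u : sIntegers S) : K)) = 1 := by
  have h1 := (algebraMap_mem_integer_iff M).mpr
    (u : sIntegers S).2 P hP
  have h2 := (algebraMap_mem_integer_iff M).mpr
    ((u⁻¹ : (sIntegers S)ˣ) : sIntegers S).2 P hP
  refine h1.antisymm (le_of_mul_le_mul_right (a := P.valuation M (algebraMap K M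
    (((u⁻¹ : (sIntegers S)ˣ) : sIntegers S) : K))) ?_ ?_)
  · rw [← map_mul, ← map_mul, ← MulMemClass.coe_mul, Units.mul_inv]
    simpa using h2
  · simp [zero_lt_iff]

lemma valuation_disc (h : IsRootData f a α β) (hP : P ∉ primesAbove M S) :
    P.valuation M (a ^ (2 * n - 2) * ∏ i, ∏ j ∈ Ioi i, (α i * β j - α j * β i) ^ 2) = 1 := by
  obtain ⟨u, hu⟩ := h.disc
  rw [hu, valuation_unit_eq_one u hP]

lemma valuation_rootDet (h : IsRootData f a α β) (hn : 2 ≤ n) (hP : P ∉ primesAbove M S)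
    {i j : Fin n} (hij : i ≠ j) :
    P.valuation M (rootDet α β i j) =
      max (P.valuation M (α i)) (P.valuation M (β i)) *
        max (P.valuation M (α j)) (P.valuation M (β j)) :=
  valuation_det_eq _ hn (h.valuation_coeff_le hP) (h.valuation_disc hP) hij

end IsRootData

end RootData

section SubstForm

open MvPolynomial Finset

variable {R R' : Type*} [CommRing R] [CommRing R']

lemma map_substForm (φ : R →+* R') (γ : Matrix (Fin 2) (Fin 2) R) (f : MvPolynomial (Fin 2) R) :
    map φ (substForm γ f) = substForm (γ.map φ) (map φ f) := by
  simp [substForm, map_bind₁]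

lemma substForm_mul (γ δ : Matrix (Fin 2) (Fin 2) R) (f : MvPolynomial (Fin 2) R) :
    substForm (γ * δ) f = substForm γ (substForm δ f) := by
  simp only [substForm, bind₁_bind₁]
  congr 2
  ext1 i
  simp only [Matrix.mul_apply, Fin.sum_univ_two, map_add, map_mul, bind₁_C_right, bind₁_X_right]
  ring

lemma substForm_one (f : MvPolynomial (Fin 2) R) : substForm 1 f = f := by
  have : (fun i : Fin 2 => ∑ j, C ((1 : Matrix (Fin 2) (Fin 2) R) j i) * X j) =
      (X : Fin 2 → MvPolynomial (Fin 2) R) := by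
    ext1 i
    fin_cases i <;> simp [Matrix.one_apply]
  rw [substForm, this, bind₁_X_left, AlgHom.id_apply]

lemma substForm_C_mul (γ : Matrix (Fin 2) (Fin 2) R) (c : R) (f : MvPolynomial (Fin 2) R) :
    substForm γ (C c * f) = C c * substForm γ f := by
  simp [substForm]

lemma exists_substForm_formOfRoots {L : Type*} [Field L] {n : ℕ} {a a' : L}
    {α β α' β' : Fin n → L} {δ : Matrix (Fin 2) (Fin 2) L} (hδ : δ.det ≠ 0) (ha : a ≠ 0)
    (ha' : a' ≠ 0) (h : MapsRoots δ α β α' β') (hne : ∀ i, α i ≠ 0 ∨ β i ≠ 0)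
    (hne' : ∀ i, α' i ≠ 0 ∨ β' i ≠ 0) :
    ∃ κ : L, κ ≠ 0 ∧ substForm δ (formOfRoots a' α' β') = C κ * formOfRoots a α β := by
  obtain ⟨μ, hμ⟩ := h.exists_smul hne'
  have hμ0 : ∀ i, μ i ≠ 0 := by
    intro i h0
    have h1 : α i * δ.det = 0 := by
      rw [Matrix.det_fin_two]
      linear_combination δ 1 1 * (hμ i).1 - δ 1 0 * (hμ i).2 + (δ 1 1 * α' i - δ 1 0 * β' i) * h0
    have h2 : β i * δ.det = 0 := by
      rw [Matrix.det_fin_two]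
      linear_combination -δ 0 1 * (hμ i).1 + δ 0 0 * (hμ i).2 +
        (-δ 0 1 * α' i + δ 0 0 * β' i) * h0
    have := hne i
    simp_all
  have hfac : ∀ i, substForm δ (C (β' i) * X 0 - C (α' i) * X 1) =
      C (δ.det / μ i) * (C (β i) * X 0 - C (α i) * X 1) := by
    intro i
    have h1 : C (μ i) ≠ (0 : MvPolynomial (Fin 2) L) := by simpa using hμ0 i
    apply mul_left_cancel₀ h1
    rw [← mul_assoc, ← C_mul, mul_div_cancel₀ _ (hμ0 i), Matrix.det_fin_two]
    simp only [substForm, map_sub, map_mul, bind₁_C_right, bind₁_X_right, Fin.sum_univ_two]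
    have e1 := congrArg (C : L → MvPolynomial (Fin 2) L) (hμ i).1
    have e2 := congrArg (C : L → MvPolynomial (Fin 2) L) (hμ i).2
    simp only [map_add, map_mul] at e1 e2
    linear_combination (C (δ 0 1) * X 0 + C (δ 1 1) * X 1) * e1 -
      (C (δ 0 0) * X 0 + C (δ 1 0) * X 1) * e2
  refine ⟨a' * (∏ i, δ.det / μ i) / a, ?_, ?_⟩
  · exact div_ne_zero (mul_ne_zero ha' (prod_ne_zero_iff.mpr fun i _ => div_ne_zero hδ (hμ0 i))) ha
  · rw [formOfRoots, substForm_C_mul]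
    have : substForm δ (∏ i, (C (β' i) * X 0 - C (α' i) * X 1)) =
        ∏ i, substForm δ (C (β' i) * X 0 - C (α' i) * X 1) := by
      simp only [substForm, map_prod]
    rw [this, prod_congr rfl fun i _ => hfac i, prod_mul_distrib, formOfRoots, ← mul_assoc,
      ← mul_assoc, ← C_mul, div_mul_cancel₀ _ ha, C_mul, map_prod]

variable {K : Type*} [Field K] [NumberField K] {M : Type*} [Field M] [NumberField M] [Algebra K M]
  {S : Finset (HeightOneSpectrum (𝓞 K))} {n : ℕ}
  {f f' : MvPolynomial (Fin 2) (sIntegers S)} {a a' : M} {α β α' β' : Fin n → M}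

lemma IsRootData.mem_integer_of_C_mul (h : IsRootData f a α β) (hn : 2 ≤ n) {c : K}
    {g : MvPolynomial (Fin 2) (sIntegers S)}
    (hg : C (algebraMap K M c) * formOfRoots a α β =
      map ((algebraMap K M).comp (sIntegers S).val.toRingHom) g) :
    c ∈ sIntegers S := by
  refine (algebraMap_mem_integer_iff M).mp fun P hP => ?_
  refine valuation_le_one_of_mul_coeff _ hn (h.valuation_coeff_le hP) (h.valuation_disc hP)
    fun m => ?_
  rw [← coeff_C_mul, hg, coeff_map]
  exact (algebraMap_mem_integer_iff M).mpr (g.coeff m : sIntegers S).2 P hP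

lemma IsRootData.ksEquiv (h : IsRootData f a α β) (h' : IsRootData f' a' α' β') (hn : 2 ≤ n)
    (δ : GL (Fin 2) (sIntegers S))
    (hδ : MapsRoots ((δ : Matrix (Fin 2) (Fin 2) (sIntegers S)).map
      ((algebraMap K M).comp (sIntegers S).val.toRingHom)) α β α' β') :
    KSEquiv S f f' := by
  set φ := (algebraMap K M).comp (sIntegers S).val.toRingHom with hφ
  have hφi : Function.Injective φ := (algebraMap K M).injective.comp Subtype.val_injective
  have hdet : ((δ : Matrix (Fin 2) (Fin 2) (sIntegers S)).map φ).det ≠ 0 := by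
    rw [show (δ : Matrix (Fin 2) (Fin 2) (sIntegers S)).map φ =
      φ.mapMatrix (δ : Matrix (Fin 2) (Fin 2) (sIntegers S)) from rfl, ← RingHom.map_det,
      (map_ne_zero_iff φ hφi)]
    exact ((Matrix.isUnit_iff_isUnit_det _).mp δ.isUnit).ne_zero
  obtain ⟨κ, hκ0, hκ⟩ := exists_substForm_formOfRoots hdet (h.leading_ne_zero hn)
    (h'.leading_ne_zero hn) hδ h.root_ne_zero h'.root_ne_zero
  rw [← h.map_eq, ← h'.map_eq, ← hφ, ← map_substForm] at hκ
  have hf0 : f ≠ 0 := by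
    rintro rfl
    have h0 := h.map_eq
    rw [map_zero, formOfRoots, eq_comm, mul_eq_zero, prod_eq_zero_iff] at h0
    rcases h0 with h0 | ⟨i, -, h0⟩
    · exact h.leading_ne_zero hn (by simpa using h0)
    · exact linearForm_ne_zero (h.root_ne_zero i) h0
  obtain ⟨m, hm⟩ := MvPolynomial.ne_zero_iff.mp hf0
  obtain ⟨c, rfl⟩ : ∃ c : K, algebraMap K M c = κ := by
    refine ⟨((substForm (δ : Matrix (Fin 2) (Fin 2) (sIntegers S)) f').coeff m : sIntegers S) /
      ((f.coeff m : sIntegers S) : K), ?_⟩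
    have h1 := congrArg (coeff m) hκ
    rw [coeff_map, coeff_C_mul, coeff_map] at h1
    rw [map_div₀, div_eq_iff]
    · exact h1
    · exact (map_ne_zero_iff φ hφi).mpr hm
  have hc0 : c ≠ 0 := by simpa using hκ0
  have hc1 : c ∈ sIntegers S := h.mem_integer_of_C_mul hn (by rw [← h.map_eq, hκ])
  have hc2 : c⁻¹ ∈ sIntegers S := by
    refine h'.mem_integer_of_C_mul hn (g := substForm ((δ⁻¹ : GL (Fin 2) (sIntegers S)) :
      Matrix (Fin 2) (Fin 2) (sIntegers S)) f) ?_
    have h1 : f' = substForm ((δ⁻¹ : GL (Fin 2) (sIntegers S)) :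
      Matrix (Fin 2) (Fin 2) (sIntegers S)) (substForm
        (δ : Matrix (Fin 2) (Fin 2) (sIntegers S)) f') := by
      rw [← substForm_mul, ← Units.val_mul, inv_mul_cancel, Units.val_one, substForm_one]
    rw [← h'.map_eq]
    conv_lhs => rw [h1]
    rw [← hφ, map_substForm, hκ, substForm_C_mul, ← map_substForm, ← mul_assoc, ← C_mul,
      ← map_mul, inv_mul_cancel₀ hc0, map_one, C_1, one_mul]
  refine ⟨⟨⟨c, hc1⟩, ⟨c⁻¹, hc2⟩, Subtype.ext (mul_inv_cancel₀ hc0),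
    Subtype.ext (inv_mul_cancel₀ hc0)⟩, δ, ?_⟩
  apply map_injective φ hφi
  rw [hκ, map_mul, map_C]
  rfl

end SubstForm

section Gluing

variable {K : Type*} [Field K] [NumberField K] {S : Finset (HeightOneSpectrum (𝓞 K))}

/-- The ideal generated by the entries of a matrix. -/
def entryIdeal {R : Type*} [CommRing R] (γ : Matrix (Fin 2) (Fin 2) R) : Ideal R :=
  Ideal.span (Set.range fun p : Fin 2 × Fin 2 => γ p.1 p.2)

lemma entry_mem_entryIdeal {R : Type*} [CommRing R] (γ : Matrix (Fin 2) (Fin 2) R) (a b : Fin 2) :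
    γ a b ∈ entryIdeal γ :=
  Ideal.subset_span ⟨(a, b), rfl⟩

lemma entryIdeal_smul {R : Type*} [CommRing R] (x : R) (γ : Matrix (Fin 2) (Fin 2) R) :
    entryIdeal (x • γ) = Ideal.span {x} * entryIdeal γ := by
  rw [entryIdeal, entryIdeal, Ideal.span_mul_span']
  congr 1
  ext y
  simp only [Set.mem_range, Matrix.smul_apply, smul_eq_mul, Set.mem_mul, Set.mem_singleton_iff,
    exists_eq_left, exists_exists_eq_and]

lemma entryIdeal_ne_bot {R : Type*} [CommRing R] {γ : Matrix (Fin 2) (Fin 2) R} (h : γ ≠ 0) :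
    entryIdeal γ ≠ ⊥ := by
  contrapose! h
  ext a b
  simpa [h] using entry_mem_entryIdeal γ a b

lemma valuation_mul_entry_le {p : HeightOneSpectrum (𝓞 K)} {γ : Matrix (Fin 2) (Fin 2) (𝓞 K)}
    (h : ∀ a b c d, p.valuation K (algebraMap (𝓞 K) K (γ a b * γ c d)) ≤
      p.valuation K (γ.map (algebraMap (𝓞 K) K)).det)
    {x : 𝓞 K} (hx : x ∈ entryIdeal γ) (c d : Fin 2) :
    p.valuation K (algebraMap (𝓞 K) K (x * γ c d)) ≤
      p.valuation K (γ.map (algebraMap (𝓞 K) K)).det := by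
  induction hx using Submodule.span_induction with
  | mem x hx => obtain ⟨q, rfl⟩ := hx; exact h _ _ _ _
  | zero => simp
  | add x y _ _ hx hy =>
    rw [add_mul, map_add]
    exact (Valuation.map_add _ _ _).trans (max_le hx hy)
  | smul r x _ hx =>
    rw [smul_eq_mul, mul_assoc, map_mul, map_mul]
    exact (mul_le_of_le_one_left' (p.valuation_le_one r)).trans hx

lemma exists_GL_mul_eq_of_entryIdeal_eq {γ γ' : Matrix (Fin 2) (Fin 2) (𝓞 K)}
    (h0 : (γ.map (algebraMap (𝓞 K) K)).det ≠ 0) (h0' : (γ'.map (algebraMap (𝓞 K) K)).det ≠ 0)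
    (h : ∀ p ∉ S, ∀ a b c d, p.valuation K (algebraMap (𝓞 K) K (γ a b * γ c d)) ≤
      p.valuation K (γ.map (algebraMap (𝓞 K) K)).det)
    (h' : ∀ p ∉ S, ∀ a b c d, p.valuation K (algebraMap (𝓞 K) K (γ' a b * γ' c d)) ≤
      p.valuation K (γ'.map (algebraMap (𝓞 K) K)).det)
    (hI : entryIdeal γ = entryIdeal γ') :
    ∃ δ : GL (Fin 2) (sIntegers S),
      (δ : Matrix (Fin 2) (Fin 2) (sIntegers S)).map (sIntegers S).val.toRingHom *
        γ'.map (algebraMap (𝓞 K) K) = γ.map (algebraMap (𝓞 K) K) := by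
  have key : ∀ {γ γ' : Matrix (Fin 2) (Fin 2) (𝓞 K)},
      (γ'.map (algebraMap (𝓞 K) K)).det ≠ 0 →
      (∀ p ∉ S, ∀ a b c d, p.valuation K (algebraMap (𝓞 K) K (γ' a b * γ' c d)) ≤
        p.valuation K (γ'.map (algebraMap (𝓞 K) K)).det) → entryIdeal γ = entryIdeal γ' →
      ∃ δ : Matrix (Fin 2) (Fin 2) (sIntegers S),
        δ.map (sIntegers S).val.toRingHom =
          γ.map (algebraMap (𝓞 K) K) * (γ'.map (algebraMap (𝓞 K) K))⁻¹ := by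
    intro γ γ' h0' h' hI
    have hmem : ∀ a b, (γ.map (algebraMap (𝓞 K) K) * (γ'.map (algebraMap (𝓞 K) K))⁻¹) a b ∈
        sIntegers S := by
      intro a b p hp
      have hpos : 0 < p.valuation K (γ'.map (algebraMap (𝓞 K) K)).det :=
        zero_lt_iff.mpr ((Valuation.ne_zero_iff _).mpr h0')
      have hk : ∀ c d e f, p.valuation K ((γ'.map (algebraMap (𝓞 K) K)).det⁻¹ *
          (algebraMap (𝓞 K) K (γ c d * γ' e f))) ≤ 1 := by
        intro c d e f
        rw [map_mul, map_inv₀]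
        exact (inv_mul_le_one₀ hpos).mpr
          (valuation_mul_entry_le (h' p hp) (hI ▸ entry_mem_entryIdeal γ c d) e f)
      rw [Matrix.inv_def, Ring.inverse_eq_inv', Matrix.mul_smul, Matrix.smul_apply,
        Matrix.mul_apply,
        Fin.sum_univ_two, Matrix.adjugate_fin_two, smul_eq_mul, mul_add]
      refine (Valuation.map_add _ _ _).trans (max_le ?_ ?_) <;> fin_cases b <;>
        simpa [Valuation.map_neg, mul_assoc] using hk _ _ _ _
    exact ⟨Matrix.of fun a b => ⟨_, hmem a b⟩, rfl⟩
  obtain ⟨δ, hδ⟩ := key h0' h' hI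
  obtain ⟨δ', hδ'⟩ := key h0 h hI.symm
  have hinj : Function.Injective
      ((sIntegers S).val.toRingHom.mapMatrix : Matrix (Fin 2) (Fin 2) (sIntegers S) →+* _) :=
    fun A B hAB => Matrix.ext fun i j => Subtype.ext (congrFun (congrFun hAB i) j)
  have hu := (isUnit_iff_ne_zero.mpr h0)
  have hu' := (isUnit_iff_ne_zero.mpr h0')
  refine ⟨⟨δ, δ', hinj ?_, hinj ?_⟩, ?_⟩
  · rw [map_mul, map_one, RingHom.mapMatrix_apply, RingHom.mapMatrix_apply, hδ, hδ', mul_assoc,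
      ← mul_assoc _ (γ'.map _), Matrix.nonsing_inv_mul _ hu', one_mul, Matrix.mul_nonsing_inv _ hu]
  · rw [map_mul, map_one, RingHom.mapMatrix_apply, RingHom.mapMatrix_apply, hδ, hδ', mul_assoc,
      ← mul_assoc _ (γ.map _), Matrix.nonsing_inv_mul _ hu, one_mul, Matrix.mul_nonsing_inv _ hu']
  · rw [hδ, mul_assoc, Matrix.nonsing_inv_mul _ hu', mul_one]

end Gluing

section FinitenessOverSplittingField

/-- The cross ratio of the `i`-th point with respect to three fixed points. -/
noncomputable def crossRatio {ι L : Type*} [Field L] (α β : ι → L) (i₀ i₁ i₂ i : ι) : L :=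
  rootDet α β i i₁ * rootDet α β i₀ i₂ / (rootDet α β i₀ i * rootDet α β i₂ i₁)

variable {K : Type*} [Field K] [NumberField K] {M : Type*} [Field M] [NumberField M] [Algebra K M]
  {S : Finset (HeightOneSpectrum (𝓞 K))} {n : ℕ}
  {f f' g : MvPolynomial (Fin 2) (sIntegers S)} {a a' b : M} {α β α' β' : Fin n → M}
  {i₀ i₁ i₂ : Fin n}

lemma IsRootData.crossRatio_mem (h : IsRootData f a α β) (hn : 2 ≤ n) (h01 : i₀ ≠ i₁)
    (h02 : i₀ ≠ i₂) (h12 : i₁ ≠ i₂) (i : Fin n) :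
    crossRatio α β i₀ i₁ i₂ i ∈ {z : M | z ≠ 0 ∧ z ≠ 1 ∧
      z ∈ (primesAbove M S : Set (HeightOneSpectrum (𝓞 M))).integer M ∧
      z⁻¹ ∈ (primesAbove M S : Set (HeightOneSpectrum (𝓞 M))).integer M ∧
      (1 - z)⁻¹ ∈ (primesAbove M S : Set (HeightOneSpectrum (𝓞 M))).integer M} ∪ {0, 1} := by
  have d02 := h.rootDet_ne_zero h02
  have d21 := h.rootDet_ne_zero h12.symm
  have d01 := h.rootDet_ne_zero h01
  by_cases hi0 : i = i₀
  · right; left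
    simp [crossRatio, hi0, rootDet]
  by_cases hi1 : i = i₁
  · right; left
    simp [crossRatio, hi1, rootDet]
  have di1 := h.rootDet_ne_zero hi1
  have d0i := h.rootDet_ne_zero (Ne.symm hi0)
  by_cases hi2 : i = i₂
  · right; right
    rw [Set.mem_singleton_iff, crossRatio, hi2, div_eq_one_iff_eq (mul_ne_zero d02 d21), mul_comm]
  have d2i := h.rootDet_ne_zero (Ne.symm hi2)
  have hsub : 1 - crossRatio α β i₀ i₁ i₂ i =
      rootDet α β i₀ i₁ * rootDet α β i₂ i / (rootDet α β i₀ i * rootDet α β i₂ i₁) := by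
    rw [crossRatio, eq_div_iff (mul_ne_zero d0i d21), sub_mul,
      div_mul_cancel₀ _ (mul_ne_zero d0i d21)]
    simp only [rootDet]
    ring
  have hval : ∀ P ∉ primesAbove M S, P.valuation M (crossRatio α β i₀ i₁ i₂ i) = 1 ∧
      P.valuation M (1 - crossRatio α β i₀ i₁ i₂ i) = 1 := by
    intro P hP
    have hne : P.valuation M (rootDet α β i₀ i) * P.valuation M (rootDet α β i₂ i₁) ≠ 0 :=
      mul_ne_zero ((Valuation.ne_zero_iff _).mpr d0i) ((Valuation.ne_zero_iff _).mpr d21)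
    rw [hsub, crossRatio]
    simp only [map_div₀, map_mul]
    rw [div_eq_one_iff_eq hne, div_eq_one_iff_eq hne]
    simp only [h.valuation_rootDet hn hP hi1, h.valuation_rootDet hn hP h02,
      h.valuation_rootDet hn hP (Ne.symm hi0), h.valuation_rootDet hn hP h12.symm,
      h.valuation_rootDet hn hP h01, h.valuation_rootDet hn hP (Ne.symm hi2)]
    constructor <;> ac_rfl
  left
  refine ⟨?_, ?_, fun P hP => (hval P hP).1.le, fun P hP => ?_, fun P hP => ?_⟩
  · exact div_ne_zero (mul_ne_zero di1 d02) (mul_ne_zero d0i d21)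
  · rw [ne_comm, ← sub_ne_zero, hsub]
    exact div_ne_zero (mul_ne_zero d01 d2i) (mul_ne_zero d0i d21)
  · rw [map_inv₀, (hval P hP).1, inv_one]
  · rw [map_inv₀, (hval P hP).2, inv_one]

lemma IsRootData.exists_integral_mapsRoots [IsGalois K M] (h : IsRootData f a α β)
    (h' : IsRootData f' a' α' β') (h01 : i₀ ≠ i₁) (h02 : i₀ ≠ i₂) (h12 : i₁ ≠ i₂)
    (hc : crossRatio α β i₀ i₁ i₂ = crossRatio α' β' i₀ i₁ i₂)
    {π : (M ≃ₐ[K] M) → Fin n → Fin n}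
    (hπ : ∀ σ i, σ (α i) = α (π σ i) ∧ σ (β i) = β (π σ i))
    (hπ' : ∀ σ i, σ (α' i) = α' (π σ i) ∧ σ (β' i) = β' (π σ i)) :
    ∃ γ : Matrix (Fin 2) (Fin 2) (𝓞 K), γ ≠ 0 ∧
      MapsRoots ((γ.map (algebraMap (𝓞 K) K)).map (algebraMap K M)) α β α' β' := by
  have : FiniteDimensional K M := Module.Finite.of_restrictScalars_finite ℚ K M
  obtain ⟨γ, hγ, hγm⟩ := exists_mapsRoots (h.rootDet_ne_zero h01) (h.rootDet_ne_zero h02)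
    (h.rootDet_ne_zero h12.symm) (h'.rootDet_ne_zero h01) (h'.rootDet_ne_zero h02)
    (h'.rootDet_ne_zero h12.symm) fun i => by
      by_cases hi : i = i₀
      · simp [hi, rootDet]
      · have := congrFun hc i
        rw [crossRatio, crossRatio, div_eq_div_iff] at this
        · exact this
        · exact mul_ne_zero (h.rootDet_ne_zero (Ne.symm hi)) (h.rootDet_ne_zero h12.symm)
        · exact mul_ne_zero (h'.rootDet_ne_zero (Ne.symm hi)) (h'.rootDet_ne_zero h12.symm)
  obtain ⟨γ₁, h1, hm1⟩ := exists_mapsRoots_descend (K := K) (fun σ => ⟨π σ,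
    h.surjective_of_galois_perm (hπ σ), fun i => ⟨(hπ σ i).1, (hπ σ i).2, hπ' σ i⟩⟩)
    (by rintro rfl; simp at hγ) hγm
  exact _root_.exists_integral_mapsRoots h1 hm1

omit [NumberField M] in
lemma IsRootData.det_ne_zero (h : IsRootData f a α β) (h' : IsRootData f' a' α' β')
    (h01 : i₀ ≠ i₁) (h02 : i₀ ≠ i₂) (h12 : i₁ ≠ i₂) {γ : Matrix (Fin 2) (Fin 2) (𝓞 K)}
    (hγ : γ ≠ 0)
    (hm : MapsRoots ((γ.map (algebraMap (𝓞 K) K)).map (algebraMap K M)) α β α' β') :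
    (γ.map (algebraMap (𝓞 K) K)).det ≠ 0 := by
  obtain ⟨μ, hμ⟩ := hm.exists_smul h'.root_ne_zero
  have := det_ne_zero_of_mapsRoots hμ (h.rootDet_ne_zero h01) (h.rootDet_ne_zero h02)
    (h.rootDet_ne_zero h12) (h'.rootDet_ne_zero h01) (h'.rootDet_ne_zero h02)
    (h'.rootDet_ne_zero h12) (by
      contrapose! hγ
      ext i j
      have := congrFun (congrFun hγ i) j
      simpa using this)
  rintro h0
  apply this
  rw [← RingHom.mapMatrix_apply (algebraMap K M), ← RingHom.map_det, h0, map_zero]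

lemma IsRootData.valuation_entry_le (h : IsRootData f a α β) (h' : IsRootData f' a' α' β')
    (hn : 2 ≤ n) (h01 : i₀ ≠ i₁) (h02 : i₀ ≠ i₂) (h12 : i₁ ≠ i₂)
    {γ : Matrix (Fin 2) (Fin 2) (𝓞 K)} (hγ : γ ≠ 0)
    (hm : MapsRoots ((γ.map (algebraMap (𝓞 K) K)).map (algebraMap K M)) α β α' β')
    (p : HeightOneSpectrum (𝓞 K)) (hp : p ∉ S) (i j k l : Fin 2) :
    p.valuation K (algebraMap (𝓞 K) K (γ i j * γ k l)) ≤
      p.valuation K (γ.map (algebraMap (𝓞 K) K)).det := by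
  have hdet := h.det_ne_zero h' h01 h02 h12 hγ hm
  obtain ⟨P, rfl⟩ := exists_under_eq M p
  have hP : P ∉ primesAbove M S := fun hP => hp ((mem_primesAbove M).mp hP)
  obtain ⟨μ, hμ⟩ := hm.exists_smul h'.root_ne_zero
  have hN0 : ∀ i, max (P.valuation M (α i)) (P.valuation M (β i)) ≠ 0 := fun i => by
    rcases h.root_ne_zero i with h0 | h0
    · exact (lt_max_of_lt_left (zero_lt_iff.mpr ((Valuation.ne_zero_iff _).mpr h0))).ne'
    · exact (lt_max_of_lt_right (zero_lt_iff.mpr ((Valuation.ne_zero_iff _).mpr h0))).ne'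
  have hdm : ((γ.map (algebraMap (𝓞 K) K)).map (algebraMap K M)).det =
      algebraMap K M (γ.map (algebraMap (𝓞 K) K)).det := by
    rw [← RingHom.mapMatrix_apply (algebraMap K M), ← RingHom.map_det]
  have hdet' : ((γ.map (algebraMap (𝓞 K) K)).map (algebraMap K M)).det ≠ 0 := by
    rw [hdm]
    simpa using hdet
  have key := valuation_entry_mul_entry_le hμ (P.valuation M) _ _ (fun _ => rfl) (fun _ => rfl)
    hN0 (fun i j hij => h.valuation_rootDet hn hP hij)
    (fun i j hij => h'.valuation_rootDet hn hP hij) h01 h02 h12 hdet' i j k l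
  rw [hdm] at key
  simp only [Matrix.map_apply, ← map_mul] at key
  rw [← div_le_one₀ (zero_lt_iff.mpr ((Valuation.ne_zero_iff _).mpr hdet)), ← map_div₀,
    ← valuation_le_one_iff_under M, map_div₀, map_div₀]
  refine (div_le_one₀ (zero_lt_iff.mpr ((Valuation.ne_zero_iff _).mpr ?_))).mpr key
  simpa using hdet

lemma MapsRoots.smul {R ι : Type*} [CommRing R] {γ : Matrix (Fin 2) (Fin 2) R} {α β α' β' : ι → R}
    (h : MapsRoots γ α β α' β') (c : R) : MapsRoots (c • γ) α β α' β' := fun i => by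
  simp only [Matrix.smul_apply, smul_eq_mul]
  linear_combination c * h i

lemma MapsRoots.of_mul {L ι : Type*} [Field L] {δ γ : Matrix (Fin 2) (Fin 2) L}
    {α β α' β' α₀ β₀ : ι → L} (h : MapsRoots (δ * γ) α β α₀ β₀) (h' : MapsRoots γ α' β' α₀ β₀)
    (hγ : γ.det ≠ 0) (h₀ : ∀ i, α₀ i ≠ 0 ∨ β₀ i ≠ 0) : MapsRoots δ α β α' β' := by
  obtain ⟨μ, hμ⟩ := h.exists_smul h₀
  obtain ⟨μ', hμ'⟩ := h'.exists_smul h₀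
  intro i
  obtain ⟨h1, h2⟩ := hμ i
  obtain ⟨h3, h4⟩ := hμ' i
  simp only [Matrix.mul_apply, Fin.sum_univ_two] at h1 h2
  apply mul_right_cancel₀ hγ
  rw [Matrix.det_fin_two]
  linear_combination μ' i * β₀ i * h1 + (α i * (δ 0 0 * γ 0 0 + δ 0 1 * γ 1 0) +
    β i * (δ 1 0 * γ 0 0 + δ 1 1 * γ 1 0)) * h4 - μ' i * α₀ i * h2 -
    (α i * (δ 0 0 * γ 0 1 + δ 0 1 * γ 1 1) + β i * (δ 1 0 * γ 0 1 + δ 1 1 * γ 1 1)) * h3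

lemma IsRootData.ksEquiv_of_mk0_eq {α₀ β₀ : Fin n → M} (h : IsRootData f a α β)
    (h' : IsRootData f' a' α' β') (h₀ : IsRootData g b α₀ β₀) (hn : 2 ≤ n) (h01 : i₀ ≠ i₁)
    (h02 : i₀ ≠ i₂) (h12 : i₁ ≠ i₂) {γ γ' : Matrix (Fin 2) (Fin 2) (𝓞 K)} (hγ : γ ≠ 0)
    (hm : MapsRoots ((γ.map (algebraMap (𝓞 K) K)).map (algebraMap K M)) α β α₀ β₀)
    (hγ' : γ' ≠ 0)
    (hm' : MapsRoots ((γ'.map (algebraMap (𝓞 K) K)).map (algebraMap K M)) α' β' α₀ β₀)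
    (hJ : ClassGroup.mk0 ⟨entryIdeal γ, mem_nonZeroDivisors_of_ne_zero (entryIdeal_ne_bot hγ)⟩ =
      ClassGroup.mk0 ⟨entryIdeal γ', mem_nonZeroDivisors_of_ne_zero (entryIdeal_ne_bot hγ')⟩) :
    KSEquiv S f f' := by
  obtain ⟨x, y, hx, hy, hxy⟩ := ClassGroup.mk0_eq_mk0_iff.mp hJ
  simp only [← entryIdeal_smul] at hxy
  have hsm : ∀ (c : 𝓞 K) (γ : Matrix (Fin 2) (Fin 2) (𝓞 K)),
      ((c • γ).map (algebraMap (𝓞 K) K)).map (algebraMap K M) =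
        algebraMap K M (algebraMap (𝓞 K) K c) •
          (γ.map (algebraMap (𝓞 K) K)).map (algebraMap K M) := fun c γ => by
    ext i j
    simp
  replace hm := hm.smul (algebraMap K M (algebraMap (𝓞 K) K x))
  replace hm' := hm'.smul (algebraMap K M (algebraMap (𝓞 K) K y))
  rw [← hsm] at hm hm'
  replace hγ := smul_ne_zero hx hγ
  replace hγ' := smul_ne_zero hy hγ'
  generalize x • γ = γ at *
  generalize y • γ' = γ' at *
  obtain ⟨δ, hδ⟩ := exists_GL_mul_eq_of_entryIdeal_eq (S := S)
    (h.det_ne_zero h₀ h01 h02 h12 hγ hm) (h'.det_ne_zero h₀ h01 h02 h12 hγ' hm')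
    (h.valuation_entry_le h₀ hn h01 h02 h12 hγ hm)
    (h'.valuation_entry_le h₀ hn h01 h02 h12 hγ' hm') hxy
  refine h.ksEquiv h' hn δ (MapsRoots.of_mul (γ := (γ'.map (algebraMap (𝓞 K) K)).map
    (algebraMap K M)) ?_ hm' ?_ h₀.root_ne_zero)
  · rw [← hδ] at hm
    rwa [Matrix.map_mul, Matrix.map_map] at hm
  · rw [← RingHom.mapMatrix_apply (algebraMap K M), ← RingHom.map_det]
    simpa using h'.det_ne_zero h₀ h01 h02 h12 hγ' hm'

/-- A fibrewise choice of representatives for a map with finite image. -/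
lemma exists_finite_representatives {X I : Type*} (G : Set X) (inv : X → I)
    (h : (inv '' G).Finite) : ∃ R ⊆ G, R.Finite ∧ ∀ f ∈ G, ∃ g ∈ R, inv f = inv g := by
  obtain ⟨R, hR, hbij⟩ := G.exists_subset_bijOn inv
  refine ⟨R, hR, Set.Finite.of_finite_image (hbij.image_eq ▸ h) hbij.injOn, fun f hf => ?_⟩
  obtain ⟨g, hg, he⟩ := hbij.surjOn ⟨f, hf, rfl⟩
  exact ⟨g, hg, he.symm⟩

variable (M) in
theorem exists_finite_representatives_of_rootData [IsGalois K M] (hn : 3 ≤ n)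
    (G : Set (MvPolynomial (Fin 2) (sIntegers S)))
    (hG : ∀ f ∈ G, ∃ (a : M) (α β : Fin n → M), IsRootData f a α β) :
    ∃ R ⊆ G, R.Finite ∧ ∀ f ∈ G, ∃ g ∈ R, KSEquiv S f g := by
  have hn2 : 2 ≤ n := by omega
  have : FiniteDimensional K M := Module.Finite.of_restrictScalars_finite ℚ K M
  let i₀ : Fin n := ⟨0, by omega⟩
  let i₁ : Fin n := ⟨1, by omega⟩
  let i₂ : Fin n := ⟨2, by omega⟩
  have h01 : i₀ ≠ i₁ := by simp [i₀, i₁]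
  have h02 : i₀ ≠ i₂ := by simp [i₀, i₂]
  have h12 : i₁ ≠ i₂ := by simp [i₁, i₂]
  have hdata : ∀ f : MvPolynomial (Fin 2) (sIntegers S), ∃ (a : M) (α β : Fin n → M)
      (π : (M ≃ₐ[K] M) → Fin n → Fin n), f ∈ G → IsRootData f a α β ∧
        ∀ σ i, σ (α i) = α (π σ i) ∧ σ (β i) = β (π σ i) := by
    intro f
    by_cases hf : f ∈ G
    · obtain ⟨a, α, β, h⟩ := hG f hf
      choose π hπ using h.exists_galois_perm hn2
      exact ⟨a, α, β, π, fun _ => ⟨h, hπ⟩⟩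
    · exact ⟨0, 0, 0, fun _ => id, fun h => absurd h hf⟩
  choose a α β π hdata using hdata
  obtain ⟨R₁, hR₁G, hR₁, hR₁'⟩ := exists_finite_representatives G
    (fun f => (crossRatio (α f) (β f) i₀ i₁ i₂, π f)) (by
      refine ((Set.Finite.pi' fun _ => (finite_unit_equation (primesAbove M S)).union
        (Set.toFinite {0, 1})).prod (Set.finite_univ)).subset ?_
      rintro _ ⟨f, hf, rfl⟩
      exact ⟨fun i => (hdata f hf).1.crossRatio_mem hn2 h01 h02 h12 i, trivial⟩)
  have hstep : ∀ g ∈ R₁, ∃ R ⊆ G, R.Finite ∧ ∀ f ∈ G,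
      (crossRatio (α f) (β f) i₀ i₁ i₂, π f) = (crossRatio (α g) (β g) i₀ i₁ i₂, π g) →
        ∃ g ∈ R, KSEquiv S f g := by
    intro g hg
    have hgG := hR₁G hg
    have hγ : ∀ f, ∃ γ : Matrix (Fin 2) (Fin 2) (𝓞 K), γ ≠ 0 ∧ (f ∈ G →
        (crossRatio (α f) (β f) i₀ i₁ i₂, π f) = (crossRatio (α g) (β g) i₀ i₁ i₂, π g) →
        MapsRoots ((γ.map (algebraMap (𝓞 K) K)).map (algebraMap K M)) (α f) (β f) (α g) (β g)) := by
      intro f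
      by_cases hf : f ∈ G ∧
        (crossRatio (α f) (β f) i₀ i₁ i₂, π f) = (crossRatio (α g) (β g) i₀ i₁ i₂, π g)
      · obtain ⟨hf, he⟩ := hf
        rw [Prod.mk.injEq] at he
        obtain ⟨γ, h0, hm⟩ := (hdata f hf).1.exists_integral_mapsRoots (hdata g hgG).1 h01 h02 h12
          he.1 (hdata f hf).2 (he.2 ▸ (hdata g hgG).2)
        exact ⟨γ, h0, fun _ _ => hm⟩
      · exact ⟨1, one_ne_zero, fun h1 h2 => absurd ⟨h1, h2⟩ hf⟩
    choose γ hγ0 hγ using hγ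
    obtain ⟨R, hRG, hR, hR'⟩ := exists_finite_representatives
      {f | f ∈ G ∧ (crossRatio (α f) (β f) i₀ i₁ i₂, π f) =
        (crossRatio (α g) (β g) i₀ i₁ i₂, π g)}
      (fun f => ClassGroup.mk0 ⟨entryIdeal (γ f),
        mem_nonZeroDivisors_of_ne_zero (entryIdeal_ne_bot (hγ0 f))⟩) (Set.toFinite _)
    refine ⟨R, fun f hf => (hRG hf).1, hR, fun f hf he => ?_⟩
    obtain ⟨f', hf', hJ⟩ := hR' f ⟨hf, he⟩
    obtain ⟨hf'G, he'⟩ := hRG hf'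
    exact ⟨f', hf', (hdata f hf).1.ksEquiv_of_mk0_eq (hdata f' hf'G).1 (hdata g hgG).1 hn2 h01 h02
      h12 (hγ0 f) (hγ f hf he) (hγ0 f') (hγ f' hf'G he') hJ⟩
  choose! R hRG hR hR' using hstep
  refine ⟨⋃ g ∈ R₁, R g, Set.iUnion₂_subset hRG, hR₁.biUnion hR, fun f hf => ?_⟩
  obtain ⟨g, hg, he⟩ := hR₁' f hf
  obtain ⟨f', hf', hk⟩ := hR' g hg f hf he
  exact ⟨f', Set.mem_biUnion hg hf', hk⟩

end FinitenessOverSplittingField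

section Inertia

variable {K L : Type*} [Field K] [NumberField K] [Field L] [NumberField L] [Algebra K L]
  [IsGalois K L]

lemma not_dvd_differentIdeal_of_inertia_eq_bot (P : HeightOneSpectrum (𝓞 L))
    (h : P.asIdeal.inertia Gal(L/K) = ⊥) :
    ¬ P.asIdeal ∣ differentIdeal (𝓞 K) (𝓞 L) := by
  have hp : P.asIdeal.under (𝓞 K) ≠ ⊥ := (P.under (𝓞 K)).ne_bot
  have : (P.asIdeal.under (𝓞 K)).IsMaximal := Ideal.IsMaximal.under (𝓞 K) P.asIdeal
  have : Finite (𝓞 K ⧸ P.asIdeal.under (𝓞 K)) := Ring.HasFiniteQuotients.finiteQuotient hp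
  let := FractionRing.liftAlgebra (𝓞 K) (FractionRing (𝓞 L))
  rw [not_dvd_differentIdeal_iff, ← Ideal.ramificationIdx_eq_one_iff,
    ← Ideal.ramificationIdxIn_eq_ramificationIdx (P.asIdeal.under (𝓞 K)) P.asIdeal Gal(L/K),
    ← Ideal.card_inertia_eq_ramificationIdxIn (G := Gal(L/K)) _ P.asIdeal, h]
  simp

omit [NumberField K] [IsGalois K L] in
lemma valuation_galois_sub_lt_one {P : HeightOneSpectrum (𝓞 L)} {σ : Gal(L/K)}
    (hσ : σ ∈ P.asIdeal.inertia Gal(L/K)) {x : L} (hx : P.valuation L x ≤ 1) :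
    P.valuation L (σ x - x) < 1 := by
  obtain ⟨r, s, hr⟩ := P.exists_primeCompl_mul_eq_of_integer x hx
  have hσ' : ∀ y : 𝓞 L, P.valuation L (σ (y : L) - y) < 1 := fun y =>
    (P.valuation_lt_one_iff_mem (K := L) (σ • y - y)).mpr (hσ y)
  have hs : P.valuation L ((s : 𝓞 L) : L) = 1 := P.valuation_eq_one_iff_notMem.mpr s.2
  have hσs : P.valuation L (σ ((s : 𝓞 L) : L)) = 1 := by
    have := (P.valuation L).map_add_eq_of_lt_left ((hσ' s).trans_eq hs.symm)
    rwa [add_sub_cancel, hs] at this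
  have h1 : σ ((s : 𝓞 L) : L) * (σ x - x) =
      (σ (r : L) - r) - (σ ((s : 𝓞 L) : L) - (s : 𝓞 L)) * x := by
    rw [← show x * ((s : 𝓞 L) : L) = r from hr, map_mul]
    ring
  have h2 := congrArg (P.valuation L) h1
  rw [map_mul, hσs, one_mul] at h2
  rw [h2]
  refine (Valuation.map_sub _ _ _).trans_lt (max_lt (hσ' r) ?_)
  rw [map_mul]
  exact mul_lt_one_of_lt_of_le (hσ' s) hx

omit [NumberField K] [IsGalois K L] in
lemma valuation_galois_sub_lt {P : HeightOneSpectrum (𝓞 L)} {σ : Gal(L/K)}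
    (hσ : σ ∈ P.asIdeal.inertia Gal(L/K)) (x : L) :
    P.valuation L (σ x - x) < max (P.valuation L x) 1 * max (P.valuation L (σ x)) 1 := by
  rcases le_or_gt (P.valuation L x) 1 with hx | hx
  · exact (valuation_galois_sub_lt_one hσ hx).trans_le
      (one_le_mul (le_max_right _ _) (le_max_right _ _))
  · have hx0 : x ≠ 0 := by
      rintro rfl
      simp at hx
    have hσx0 : σ x ≠ 0 := by simpa
    have h1 := valuation_galois_sub_lt_one hσ (x := x⁻¹) (by
      rw [map_inv₀]
      exact inv_le_one_of_one_le₀ hx.le)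
    have h2 : σ x - x = (x * σ x) * -(σ x⁻¹ - x⁻¹) := by
      rw [map_inv₀]
      field_simp
      ring
    rw [h2, map_mul, Valuation.map_neg, map_mul]
    refine lt_of_lt_of_le (mul_lt_of_lt_one_right ?_ h1)
      (mul_le_mul' (le_max_left _ _) (le_max_left _ _))
    exact mul_pos (zero_lt_iff.mpr (by simpa)) (zero_lt_iff.mpr (by simpa))

omit [IsGalois K L] in
lemma IsRootData.galois_apply_root_of_mem_inertia {S : Finset (HeightOneSpectrum (𝓞 K))} {n : ℕ}
    {f : MvPolynomial (Fin 2) (sIntegers S)} {a : L} {α β : Fin n → L} (h : IsRootData f a α β)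
    (hn : 2 ≤ n) {P : HeightOneSpectrum (𝓞 L)} (hP : P ∉ primesAbove L S) {σ : Gal(L/K)}
    (hσ : σ ∈ P.asIdeal.inertia Gal(L/K)) (i : Fin n) : σ (α i) = α i := by
  rcases h.normalized i with hβ | ⟨hα, -⟩
  · obtain ⟨j, hj, hj'⟩ := h.exists_galois_perm hn σ i
    rcases eq_or_ne i j with rfl | hij
    · exact hj
    · have h1 := valuation_galois_sub_lt hσ (α i)
      have h2 := h.valuation_rootDet hn hP hij
      rw [rootDet, ← hj, ← hj', hβ, map_one, map_one, mul_one, mul_one,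
        Valuation.map_sub_swap] at h2
      exact absurd h2 h1.ne
  · rw [hα, map_one]

lemma IsRootData.not_dvd_differentIdeal {S : Finset (HeightOneSpectrum (𝓞 K))} {n : ℕ}
    {f : MvPolynomial (Fin 2) (sIntegers S)} {a : L} {α β : Fin n → L} (h : IsRootData f a α β)
    (hn : 2 ≤ n) (hα : ∀ σ : Gal(L/K), (∀ i, σ (α i) = α i) → σ = 1)
    {P : HeightOneSpectrum (𝓞 L)} (hP : P ∉ primesAbove L S) :
    ¬ P.asIdeal ∣ differentIdeal (𝓞 K) (𝓞 L) :=
  not_dvd_differentIdeal_of_inertia_eq_bot P <| (Subgroup.eq_bot_iff_forall _).mpr fun σ hσ =>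
    hα σ (h.galois_apply_root_of_mem_inertia hn hP hσ)

end Inertia

section Different

open scoped nonZeroDivisors Pointwise

variable {K L : Type*} [Field K] [NumberField K] [Field L] [NumberField L] [Algebra K L]

omit [NumberField K] in
lemma mem_one_fractionalIdeal_iff_isIntegral {x : K} :
    x ∈ (1 : FractionalIdeal (𝓞 K)⁰ K) ↔ IsIntegral ℤ x := by
  rw [FractionalIdeal.mem_one_iff]
  exact ⟨fun ⟨y, hy⟩ => hy ▸ y.2, fun h => ⟨⟨x, h⟩, rfl⟩⟩

lemma mem_differentIdeal_iff (x : 𝓞 L) :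
    x ∈ differentIdeal (𝓞 K) (𝓞 L) ↔
      ∀ y : L, (∀ z : 𝓞 L, IsIntegral ℤ (Algebra.trace K L (y * z))) → IsIntegral ℤ (x * y) := by
  have h1 : x ∈ differentIdeal (𝓞 K) (𝓞 L) ↔
      (x : L) ∈ (differentIdeal (𝓞 K) (𝓞 L) : FractionalIdeal (𝓞 L)⁰ L) := by
    rw [FractionalIdeal.mem_coeIdeal]
    exact ⟨fun h => ⟨x, h, rfl⟩, fun ⟨y, hy, hyx⟩ => RingOfIntegers.ext hyx ▸ hy⟩
  rw [h1, coeIdeal_differentIdeal (𝓞 K) K, FractionalIdeal.mem_inv_iff (by simp)]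
  refine forall_congr' fun y => imp_congr ?_ mem_one_fractionalIdeal_iff_isIntegral
  rw [FractionalIdeal.mem_dual (one_ne_zero (α := FractionalIdeal (𝓞 L)⁰ L))]
  constructor
  · intro h z
    obtain ⟨w, hw⟩ := h z (FractionalIdeal.coe_mem_one _ z)
    exact (hw : (w : K) = _) ▸ w.2
  · intro h z hz
    obtain ⟨w, rfl⟩ := (FractionalIdeal.mem_one_iff _).mp hz
    exact ⟨⟨_, h w⟩, rfl⟩

lemma smul_mem_differentIdeal (σ : Gal(L/K)) {x : 𝓞 L} (hx : x ∈ differentIdeal (𝓞 K) (𝓞 L)) :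
    σ • x ∈ differentIdeal (𝓞 K) (𝓞 L) := by
  rw [mem_differentIdeal_iff] at hx ⊢
  intro y hy
  have h1 := hx (σ.symm y) (fun z => by
    rw [← Algebra.trace_eq_of_algEquiv σ, map_mul, AlgEquiv.apply_symm_apply]
    exact hy (σ • z))
  have h2 := h1.map σ.toRingEquiv.toIntAlgEquiv
  rwa [show σ.toRingEquiv.toIntAlgEquiv (x * σ.symm y) = (σ • x : 𝓞 L) * y from
    (map_mul σ _ _).trans (by rw [AlgEquiv.apply_symm_apply]; rfl)] at h2

lemma smul_differentIdeal (σ : Gal(L/K)) :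
    σ • differentIdeal (𝓞 K) (𝓞 L) = differentIdeal (𝓞 K) (𝓞 L) := by
  ext x
  rw [Ideal.mem_pointwise_smul_iff_inv_smul_mem]
  exact ⟨fun h => by simpa using smul_mem_differentIdeal σ h, fun h => smul_mem_differentIdeal _ h⟩

lemma finrank_mem_of_map_dvd_differentIdeal {I : Ideal (𝓞 K)} (hI : I ≠ ⊥)
    (h : I.map (algebraMap (𝓞 K) (𝓞 L)) ∣ differentIdeal (𝓞 K) (𝓞 L)) :
    (Module.finrank K L : 𝓞 K) ∈ I := by
  have hI' : I.map (algebraMap (𝓞 K) (𝓞 L)) ≠ ⊥ :=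
    Ideal.map_eq_bot_iff_of_injective (FaithfulSMul.algebraMap_injective _ _) |>.not.mpr hI
  rw [Ideal.dvd_iff_le, differentialIdeal_le_iff (A := 𝓞 K) (K := K) (L := L) hI'] at h
  have h1 : ((Module.finrank K L : 𝓞 K) : K) ∈ ((I : FractionalIdeal (𝓞 K)⁰ K)⁻¹)⁻¹ := by
    rw [FractionalIdeal.mem_inv_iff (by simpa using hI)]
    intro y hy
    have h2 : algebraMap K L y ∈ (I.map (algebraMap (𝓞 K) (𝓞 L)) : FractionalIdeal (𝓞 L)⁰ L)⁻¹ := by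
      rw [FractionalIdeal.mem_inv_iff (by simpa using hI')]
      intro z hz
      obtain ⟨w, hw, rfl⟩ := (FractionalIdeal.mem_coeIdeal _).mp hz
      refine Submodule.span_induction ?_ ?_ ?_ ?_ hw
      · rintro _ ⟨v, hv, rfl⟩
        rw [FractionalIdeal.mem_inv_iff (by simpa using hI)] at hy
        have := mem_one_fractionalIdeal_iff_isIntegral.mp
          (hy v (FractionalIdeal.mem_coeIdeal_of_mem _ hv))
        rw [mem_one_fractionalIdeal_iff_isIntegral]
        exact map_mul (algebraMap K L) _ _ ▸ this.algebraMap
      · simp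
      · intro a b _ _ ha hb
        rw [map_add, mul_add]
        exact Submodule.add_mem _ ha hb
      · intro a b _ hb
        rw [smul_eq_mul, map_mul, mul_left_comm, ← Algebra.smul_def]
        exact Submodule.smul_mem _ a hb
    have h3 := h (Submodule.mem_map_of_mem h2)
    obtain ⟨w, hw⟩ := Submodule.mem_one.mp h3
    rw [mem_one_fractionalIdeal_iff_isIntegral]
    have h4 : (w : K) = Module.finrank K L * y := by
      rw [← nsmul_eq_mul, ← Algebra.trace_algebraMap (R := K) (S := L)]
      exact hw
    push_cast
    rw [← h4]
    exact w.2
  rw [inv_inv, FractionalIdeal.mem_coeIdeal] at h1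
  obtain ⟨y, hy, hy'⟩ := h1
  exact RingOfIntegers.ext hy' ▸ hy

end Different

section WildBound

open scoped Pointwise

variable {K L : Type*} [Field K] [NumberField K] [Field L] [NumberField L] [Algebra K L]
  [IsGalois K L]

lemma pow_dvd_differentIdeal_of_under_eq {P Q : HeightOneSpectrum (𝓞 L)}
    (h : P.under (𝓞 K) = Q.under (𝓞 K)) {m : ℕ}
    (hP : P.asIdeal ^ m ∣ differentIdeal (𝓞 K) (𝓞 L)) :
    Q.asIdeal ^ m ∣ differentIdeal (𝓞 K) (𝓞 L) := by
  have : P.asIdeal.LiesOver (Q.under (𝓞 K)).asIdeal := ⟨by rw [← h]; rfl⟩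
  have : Q.asIdeal.LiesOver (Q.under (𝓞 K)).asIdeal := ⟨rfl⟩
  obtain ⟨σ, hσ⟩ := Ideal.exists_smul_eq_of_isGaloisGroup (Q.under (𝓞 K)).asIdeal P.asIdeal
    Q.asIdeal Gal(L/K)
  rw [Ideal.dvd_iff_le] at hP ⊢
  rw [← hσ, ← smul_pow', ← smul_differentIdeal σ]
  exact Ideal.pointwise_smul_le_pointwise_smul_iff.mpr hP

lemma ramificationIdx'_under_le_finrank (P : HeightOneSpectrum (𝓞 L)) :
    (P.under (𝓞 K)).asIdeal.ramificationIdx' P.asIdeal ≤ Module.finrank K L := by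
  have : P.asIdeal.LiesOver (P.under (𝓞 K)).asIdeal := ⟨rfl⟩
  rw [Ideal.ramificationIdx'_eq_ramificationIdx _ _ (P.under (𝓞 K)).ne_bot,
    ← Ideal.ramificationIdxIn_eq_ramificationIdx (P.under (𝓞 K)).asIdeal P.asIdeal Gal(L/K),
    ← IsGaloisGroup.card_eq_finrank Gal(L/K) K L]
  refine Nat.le_of_dvd Nat.card_pos ?_
  rw [← Ideal.ncard_primesOver_mul_ramificationIdxIn_mul_inertiaDegIn
    (P.under (𝓞 K)).asIdeal (𝓞 L) Gal(L/K)]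
  exact (dvd_mul_right _ _).mul_left _

lemma finrank_mem_pow_under {P : HeightOneSpectrum (𝓞 L)} {N j : ℕ}
    (hN : Module.finrank K L ≤ N) (hP : P.asIdeal ^ (N * j) ∣ differentIdeal (𝓞 K) (𝓞 L)) :
    (Module.finrank K L : 𝓞 K) ∈ (P.under (𝓞 K)).asIdeal ^ j := by
  have hpj : (P.under (𝓞 K)).asIdeal ^ j ≠ ⊥ := pow_ne_zero _ (P.under (𝓞 K)).ne_bot
  have hmap : ((P.under (𝓞 K)).asIdeal ^ j).map (algebraMap (𝓞 K) (𝓞 L)) ≠ ⊥ :=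
    Ideal.map_eq_bot_iff_of_injective (FaithfulSMul.algebraMap_injective _ _) |>.not.mpr hpj
  refine finrank_mem_of_map_dvd_differentIdeal hpj
    ((UniqueFactorizationMonoid.dvd_iff_emultiplicity_le hmap).mpr fun Q hQ => ?_)
  obtain ⟨Q, rfl⟩ : ∃ Q' : HeightOneSpectrum (𝓞 L), Q'.asIdeal = Q :=
    ⟨⟨Q, Ideal.isPrime_of_prime hQ, hQ.ne_zero⟩, rfl⟩
  have : Q.asIdeal.LiesOver (Q.under (𝓞 K)).asIdeal := ⟨rfl⟩
  have : (Q.under (𝓞 K)).asIdeal.IsMaximal := (Q.under (𝓞 K)).isMaximal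
  rw [Ideal.IsDedekindDomain.emultiplicity_map_eq_ramificationIdx'_mul hpj
    (Q.under (𝓞 K)).irreducible Q.irreducible Q.ne_bot]
  by_cases hPQ : P.under (𝓞 K) = Q.under (𝓞 K)
  · refine le_trans ?_ (pow_dvd_iff_le_emultiplicity.mp (pow_dvd_differentIdeal_of_under_eq hPQ hP))
    rw [hPQ, emultiplicity_pow_self_of_prime (Q.under (𝓞 K)).prime]
    norm_cast
    exact Nat.mul_le_mul_right _ ((ramificationIdx'_under_le_finrank Q).trans hN)
  · rw [emultiplicity_pow (Q.under (𝓞 K)).prime, emultiplicity_eq_zero.mpr, mul_zero, mul_zero]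
    · exact zero_le
    · intro h
      rw [Ideal.dvd_iff_le] at h
      exact hPQ (HeightOneSpectrum.ext
        ((P.under (𝓞 K)).isMaximal.eq_of_le (Q.under (𝓞 K)).isPrime.ne_top h))

end WildBound

section DiscriminantBound

variable {K : Type*} [Field K] [NumberField K]

lemma exists_notMem_pow_of_ne_zero (S : Finset (HeightOneSpectrum (𝓞 K))) {x : 𝓞 K} (hx : x ≠ 0) :
    ∃ j, ∀ p ∈ S, x ∉ p.asIdeal ^ j := by
  have h : ∀ p : HeightOneSpectrum (𝓞 K), ∃ j, x ∉ p.asIdeal ^ j := by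
    intro p
    by_contra! h
    have := Ideal.iInf_pow_eq_bot_of_isDomain p.asIdeal p.isPrime.ne_top
    have h2 : x ∈ (⨅ j, p.asIdeal ^ j) := by simpa [Submodule.mem_iInf] using h
    rw [this] at h2
    exact hx h2
  choose j hj using h
  exact ⟨S.sup j, fun p hp hx => hj p (Ideal.pow_le_pow_right (Finset.le_sup hp) hx)⟩

lemma exists_differentIdeal_dvd_map.{u} (S : Finset (HeightOneSpectrum (𝓞 K))) (N : ℕ) :
    ∃ E : Ideal (𝓞 K), E ≠ ⊥ ∧ ∀ (L : Type u) [Field L] [NumberField L] [Algebra K L]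
      [IsGalois K L], Module.finrank K L ≤ N →
      (∀ P : HeightOneSpectrum (𝓞 L), P ∉ primesAbove L S →
        ¬ P.asIdeal ∣ differentIdeal (𝓞 K) (𝓞 L)) →
      differentIdeal (𝓞 K) (𝓞 L) ∣ E.map (algebraMap (𝓞 K) (𝓞 L)) := by
  obtain ⟨j, hj⟩ := exists_notMem_pow_of_ne_zero S (x := (N.factorial : 𝓞 K))
    (by exact_mod_cast N.factorial_ne_zero)
  refine ⟨∏ p ∈ S, p.asIdeal ^ (N * j), ?_, fun L _ _ _ _ hN hL => ?_⟩
  · exact Finset.prod_ne_zero_iff.mpr fun p _ => pow_ne_zero _ p.ne_bot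
  have hD : differentIdeal (𝓞 K) (𝓞 L) ≠ 0 := by
    let := FractionRing.liftAlgebra (𝓞 K) (FractionRing (𝓞 L))
    exact differentIdeal_ne_bot
  refine (UniqueFactorizationMonoid.dvd_iff_emultiplicity_le hD).mpr fun Q hQ => ?_
  obtain ⟨Q, rfl⟩ : ∃ Q' : HeightOneSpectrum (𝓞 L), Q'.asIdeal = Q :=
    ⟨⟨Q, Ideal.isPrime_of_prime hQ, hQ.ne_zero⟩, rfl⟩
  by_cases hQS : Q ∈ primesAbove L S
  · rw [mem_primesAbove] at hQS
    have h1 : emultiplicity Q.asIdeal (differentIdeal (𝓞 K) (𝓞 L)) < (N * j : ℕ) := by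
      rw [emultiplicity_lt_iff_not_dvd]
      intro hdvd
      have h2 := finrank_mem_pow_under hN hdvd
      refine hj _ hQS (Ideal.mem_of_dvd _ ?_ h2)
      exact Nat.cast_dvd_cast (Nat.dvd_factorial Module.finrank_pos hN)
    refine h1.le.trans (pow_dvd_iff_le_emultiplicity.mp ?_)
    have h3 : Q.asIdeal ∣ (Q.under (𝓞 K)).asIdeal.map (algebraMap (𝓞 K) (𝓞 L)) :=
      Ideal.dvd_iff_le.mpr Ideal.map_comap_le
    refine (pow_dvd_pow_of_dvd h3 _).trans ?_
    rw [← Ideal.map_pow]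
    exact Ideal.dvd_iff_le.mpr (Ideal.map_mono (Ideal.dvd_iff_le.mp (Finset.dvd_prod_of_mem
      (fun p : HeightOneSpectrum (𝓞 K) => p.asIdeal ^ (N * j)) hQS)))
  · rw [emultiplicity_eq_zero.mpr (hL Q hQS)]
    exact zero_le

theorem exists_natAbs_discr_le.{u} (S : Finset (HeightOneSpectrum (𝓞 K))) (N : ℕ) :
    ∃ C : ℕ, ∀ (L : Type u) [Field L] [NumberField L] [Algebra K L]
      [IsGalois K L], Module.finrank K L ≤ N →
      (∀ P : HeightOneSpectrum (𝓞 L), P ∉ primesAbove L S →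
        ¬ P.asIdeal ∣ differentIdeal (𝓞 K) (𝓞 L)) →
      (discr L).natAbs ≤ C := by
  obtain ⟨E, hE, h⟩ := exists_differentIdeal_dvd_map S N
  refine ⟨Ideal.absNorm E ^ N * (discr K).natAbs ^ N, fun L _ _ _ _ hN hL => ?_⟩
  rw [NumberField.natAbs_discr_eq_absNorm_differentIdeal_mul_natAbs_discr_pow K (𝓞 K) L (𝓞 L)]
  have hE' : Ideal.absNorm E ≠ 0 := Ideal.absNorm_ne_zero_iff_mem_nonZeroDivisors.mpr
    (mem_nonZeroDivisors_of_ne_zero hE)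
  have hdvd := map_dvd (Ideal.absNorm (S := 𝓞 L)) (h L hN hL)
  rw [Ideal.absNorm_algebraMap, ← IsFractionRing.finrank_eq (𝓞 K) K (𝓞 L) L] at hdvd
  refine mul_le_mul' ((Nat.le_of_dvd (by positivity) hdvd).trans ?_) ?_
  · exact Nat.pow_le_pow_right (by omega) hN
  · exact Nat.pow_le_pow_right (Int.natAbs_pos.mpr (discr_ne_zero K)) hN

end DiscriminantBound

section RootField

open MvPolynomial Finset

variable {K : Type*} [Field K] [NumberField K] {S : Finset (HeightOneSpectrum (𝓞 K))} {n : ℕ}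
  {f : MvPolynomial (Fin 2) (sIntegers S)}

lemma HasUnitDisc.exists_isRootData (h : HasUnitDisc S n f) :
    ∃ (a : AlgebraicClosure K) (α β : Fin n → AlgebraicClosure K), IsRootData f a α β := by
  obtain ⟨a, α, β, hf, u, hu⟩ := h
  have hc : ∀ i, ∃ c α' β' : AlgebraicClosure K, α i = c * α' ∧ β i = c * β' ∧
      (β' = 1 ∨ (α' = 1 ∧ β' = 0)) := by
    intro i
    by_cases hβ : β i = 0
    · exact ⟨α i, 1, 0, by simp, by simp [hβ], by simp⟩
    · exact ⟨β i, α i / β i, 1, by field_simp, by simp, by simp⟩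
  choose c α' β' hα hβ hnorm using hc
  refine ⟨a * ∏ i, c i, α', β', ?_, hnorm, u, ?_⟩
  · rw [hf, formOfRoots, C_mul, map_prod, mul_assoc, ← prod_mul_distrib]
    congr 1
    refine prod_congr rfl fun i _ => ?_
    rw [hα, hβ, C_mul, C_mul]
    ring
  · rw [← hu, mul_pow, ← prod_Ioi_mul_sq, mul_assoc, ← prod_mul_distrib]
    congr 1
    refine prod_congr rfl fun i _ => ?_
    rw [← prod_mul_distrib]
    refine prod_congr rfl fun j _ => ?_
    rw [hα, hα, hβ, hβ]
    ring

lemma IsRootData.descend {M Ω : Type*} [Field M] [Field Ω] [Algebra K M] [Algebra K Ω]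
    [Algebra M Ω] [IsScalarTower K M Ω] {a : Ω} {α β : Fin n → Ω} (h : IsRootData f a α β)
    {α' : Fin n → M} (hα : ∀ i, algebraMap M Ω (α' i) = α i) :
    ∃ (a' : M) (β' : Fin n → M), IsRootData f a' α' β' := by
  have hβ' : ∀ i, ∃ β' : M, algebraMap M Ω β' = β i ∧ (β' = 1 ∨ (α' i = 1 ∧ β' = 0)) := by
    intro i
    rcases h.normalized i with h1 | ⟨h1, h2⟩
    · exact ⟨1, by simp [h1], Or.inl rfl⟩
    · refine ⟨0, by simp [h2], Or.inr ⟨(algebraMap M Ω).injective ?_, rfl⟩⟩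
      rw [hα, h1, map_one]
  choose β' hβ hnorm using hβ'
  have hprod : formOfRoots (1 : M) α' β' ≠ 0 := by
    rw [formOfRoots, C_1, one_mul]
    refine prod_ne_zero_iff.mpr fun i _ => linearForm_ne_zero ?_
    rcases hnorm i with h | h <;> simp [h]
  obtain ⟨m, hm⟩ := ne_zero_iff.mp hprod
  obtain ⟨a', ha'⟩ : ∃ a' : M, algebraMap M Ω a' = a := by
    refine ⟨algebraMap K M ((f.coeff m : sIntegers S) : K) /
      coeff m (formOfRoots (1 : M) α' β'), ?_⟩
    rw [map_div₀, div_eq_iff (by simpa using hm), ← IsScalarTower.algebraMap_apply,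
      h.algebraMap_coeff, ← coeff_map, map_formOfRoots, map_one, formOfRoots, coeff_C_mul,
      formOfRoots, C_1, one_mul, ← funext hα, ← funext hβ]
    rfl
  refine ⟨a', β', ?_, hnorm, ?_⟩
  · refine map_injective _ (algebraMap M Ω).injective ?_
    rw [MvPolynomial.map_map, map_formOfRoots, ha', ← RingHom.comp_assoc,
      ← IsScalarTower.algebraMap_eq, h.map_eq,
      ← funext hα, ← funext hβ]
    rfl
  · obtain ⟨u, hu⟩ := h.disc
    refine ⟨u, (algebraMap M Ω).injective ?_⟩
    rw [← IsScalarTower.algebraMap_apply, ← hu]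
    simp [ha', hα, hβ]

end RootField

section NormalRootField

variable {K : Type*} [Field K] [NumberField K] {S : Finset (HeightOneSpectrum (𝓞 K))} {n : ℕ}
  {f : MvPolynomial (Fin 2) (sIntegers S)} {Ω : Type*} [Field Ω] [Algebra K Ω]

lemma IsRootData.normal_adjoin [Normal K Ω] {a : Ω} {α β : Fin n → Ω} (h : IsRootData f a α β)
    (hn : 2 ≤ n) : Normal K (IntermediateField.adjoin K (Set.range α)) := by
  refine IntermediateField.normal_iff_forall_map_le'.mpr fun σ => ?_
  rw [IntermediateField.adjoin_map, IntermediateField.adjoin_le_iff]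
  rintro _ ⟨_, ⟨i, rfl⟩, rfl⟩
  obtain ⟨j, hj, -⟩ := h.exists_galois_perm hn σ i
  exact IntermediateField.subset_adjoin _ _ ⟨j, hj.symm⟩

lemma IsRootData.finrank_le {L : Type*} [Field L] [Algebra K L] [FiniteDimensional K L]
    [IsGalois K L] {a : L} {α β : Fin n → L} (h : IsRootData f a α β) (hn : 2 ≤ n)
    (hα : ∀ σ : Gal(L/K), (∀ i, σ (α i) = α i) → σ = 1) : Module.finrank K L ≤ n ^ n := by
  choose π hπ _ using h.exists_galois_perm hn
  rw [← IsGalois.card_aut_eq_finrank]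
  refine (Nat.card_le_card_of_injective π fun σ τ hστ => ?_).trans_eq (by simp)
  rw [← inv_mul_eq_one]
  refine hα _ fun i => ?_
  rw [AlgEquiv.mul_apply, hπ τ, ← hστ, ← hπ σ, ← AlgEquiv.mul_apply, inv_mul_cancel,
    AlgEquiv.one_apply]

end NormalRootField

section Hermite

variable {K : Type*} [Field K] [NumberField K]

lemma finite_intermediateField_of_discr_le (Ω : Type*) [Field Ω] [CharZero Ω] [Algebra K Ω]
    (C : ℕ) : {L : IntermediateField K Ω | ∃ _ : NumberField L, (discr L).natAbs ≤ C}.Finite := by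
  have hinj : Function.Injective
      (IntermediateField.restrictScalars ℚ : IntermediateField K Ω → _) :=
    IntermediateField.restrictScalars_injective ℚ
  refine Set.Finite.of_finite_image
    (((finite_of_discr_bdd Ω C).image Subtype.val).subset ?_) hinj.injOn
  rintro _ ⟨L, ⟨hL, hC⟩, rfl⟩
  have : FiniteDimensional ℚ (L.restrictScalars ℚ) := hL.to_finiteDimensional
  refine ⟨⟨L.restrictScalars ℚ, this⟩, ?_, rfl⟩
  change |discr L| ≤ (C : ℤ)
  rw [Int.abs_eq_natAbs]
  exact_mod_cast hC

variable (K) in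
theorem exists_common_root_field (S : Finset (HeightOneSpectrum (𝓞 K))) {n : ℕ} (hn : 2 ≤ n) :
    ∃ M : IntermediateField K (AlgebraicClosure K), FiniteDimensional K M ∧ IsGalois K M ∧
      ∀ f : MvPolynomial (Fin 2) (sIntegers S), HasUnitDisc S n f →
        ∃ (a : M) (α β : Fin n → M), IsRootData f a α β := by
  obtain ⟨C, hC⟩ := exists_natAbs_discr_le S (n ^ n)
  set T : Set (IntermediateField K (AlgebraicClosure K)) :=
    {L | Normal K L ∧ ∃ _ : NumberField L, (discr L).natAbs ≤ C} with hT
  have hTfin : T.Finite :=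
    (finite_intermediateField_of_discr_le (AlgebraicClosure K) C).subset fun L hL => hL.2
  have : Finite T := hTfin
  have hnormal (L : T) : Normal K L.1 := L.2.1
  have hfd (L : T) : FiniteDimensional K L.1 := by
    obtain ⟨hL, -⟩ := L.2.2
    exact Module.Finite.of_restrictScalars_finite ℚ K L.1
  let M : IntermediateField K (AlgebraicClosure K) := ⨆ L : T, L.1
  have hM : Normal K M := IntermediateField.normal_iSup K _ _
  refine ⟨M, IntermediateField.finiteDimensional_iSup_of_finite, ⟨⟩, fun f hf => ?_⟩
  obtain ⟨a, α, β, h⟩ := hf.exists_isRootData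
  let L := IntermediateField.adjoin K (Set.range α)
  have hLn : Normal K L := h.normal_adjoin hn
  have hLfd : FiniteDimensional K L := IntermediateField.finiteDimensional_adjoin
    fun x _ => (Algebra.IsAlgebraic.isAlgebraic x).isIntegral
  have hLnf : NumberField L := NumberField.of_module_finite K L
  have hLg : IsGalois K L := ⟨⟩
  have hαL (i : Fin n) : α i ∈ L := IntermediateField.subset_adjoin _ _ ⟨i, rfl⟩
  have hLT : L ∈ T := by
    refine ⟨hLn, hLnf, ?_⟩
    obtain ⟨a', β', h'⟩ := h.descend (M := L) (α' := fun i => ⟨α i, hαL i⟩) fun i => rfl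
    have hσ : ∀ σ : Gal(L/K), (∀ i, σ ⟨α i, hαL i⟩ = ⟨α i, hαL i⟩) → σ = 1 := by
      intro σ hσ
      have : σ.toAlgHom = AlgHom.id K L := by
        refine IntermediateField.algHom_ext_of_eq_adjoin _ rfl ?_
        rintro _ ⟨i, rfl⟩
        exact hσ i
      exact AlgEquiv.ext fun x => DFunLike.congr_fun this x
    exact hC L (h'.finrank_le hn hσ) fun P hP => h'.not_dvd_differentIdeal hn hσ hP
  obtain ⟨a', β', h'⟩ := h.descend (M := M)
    (α' := fun i => ⟨α i, le_iSup (fun L : T => L.1) ⟨L, hLT⟩ (hαL i)⟩) fun i => rfl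
  exact ⟨a', _, β', h'⟩

end Hermite

/-- **Birch–Merriman.** For `n ≥ 3` there are only finitely many
`(K,S)`-equivalence classes of binary forms of degree `n` over `𝒪_{K,S}` whose
discriminant is a unit of `𝒪_{K,S}`. -/
theorem birch_merriman
    (K : Type*) [Field K] [NumberField K]
    (S : Finset (HeightOneSpectrum (𝓞 K))) (n : ℕ) (hn : 3 ≤ n) :
    ∃ R : Set (MvPolynomial (Fin 2) ↥((S : Set (HeightOneSpectrum (𝓞 K))).integer K)),
      R.Finite ∧
      (∀ g ∈ R, g.IsHomogeneous n ∧ HasUnitDisc S n g) ∧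
      ∀ f : MvPolynomial (Fin 2) ↥((S : Set (HeightOneSpectrum (𝓞 K))).integer K),
        f.IsHomogeneous n → HasUnitDisc S n f →
        ∃ g ∈ R, KSEquiv S f g := by
  obtain ⟨M, hMfd, hMg, hM⟩ := exists_common_root_field K S (show 2 ≤ n by omega)
  have hMnf : NumberField M := NumberField.of_module_finite K M
  obtain ⟨R, hRG, hR, h⟩ := exists_finite_representatives_of_rootData M hn
    {f : MvPolynomial (Fin 2) (sIntegers S) | f.IsHomogeneous n ∧ HasUnitDisc S n f}
    fun f hf => hM f hf.2
  exact ⟨R, hR, hRG, fun f hf hf' => h f ⟨hf, hf'⟩⟩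
end

section
/- Let G be a group acting by group automorphisms on a group Γ, and let X be a set carrying both a G-action and a Γ-action that are compatible in the sense that σ·(F·x) = (σ·F)·(σ·x) for all σ ∈ G, F ∈ Γ, x ∈ X. Let X^G = {B ∈ X : σ·B = B for all σ ∈ G} and Γ^G = {F ∈ Γ : σ·F = F for all σ ∈ G}. Suppose that (i) the elements of X^G meet only finitely many Γ-orbits in X, and (ii) for every A ∈ X^G the pointed set H¹(G, Stab_Γ(A)) is finite, where Stab_Γ(A) = {F ∈ Γ : F·A = A} with its natural G-action. Then the set of Γ^G-orbits on X^G is finite. -/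
section

variable {G Γ X : Type*} [Group G] [Group Γ] [MulDistribMulAction G Γ] [MulAction Γ X]

/-- The `1`-cocycles of `G` in `Γ` with values in the stabilizer of `A`. -/
abbrev StabilizerCocycle (G Γ : Type*) {X : Type*} [Group G] [Group Γ] [MulDistribMulAction G Γ]
    [MulAction Γ X] (A : X) : Type _ :=
  {f : G → Γ // (∀ σ : G, f σ • A = A) ∧ ∀ σ τ : G, f (σ * τ) = f σ * σ • f τ}

/-- Two cocycles are cohomologous if they differ by an element of the stabilizer of `A`. -/
abbrev StabilizerCocycle.Cohomologous {A : X} (f g : StabilizerCocycle G Γ A) : Prop :=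
  ∃ c : Γ, c • A = A ∧ ∀ σ : G, g.1 σ = c⁻¹ * f.1 σ * σ • c

theorem StabilizerCocycle.cohomologous_equivalence (A : X) :
    Equivalence (StabilizerCocycle.Cohomologous (G := G) (Γ := Γ) (A := A)) where
  refl f := ⟨1, one_smul _ _, fun σ => by simp⟩
  symm := by
    rintro f g ⟨c, hc, h⟩
    refine ⟨c⁻¹, by rw [inv_smul_eq_iff, hc], fun σ => ?_⟩
    rw [h, smul_inv']
    group
  trans := by
    rintro f g k ⟨c, hc, h⟩ ⟨d, hd, h'⟩
    refine ⟨c * d, by rw [mul_smul, hd, hc], fun σ => ?_⟩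
    rw [h', h, smul_mul']
    group

variable [MulAction G X]

/-- The cocycle `σ ↦ F⁻¹ * σ • F` attached to a `G`-fixed point `F • A` in the orbit of `A`. -/
def StabilizerCocycle.ofFixed
    (hcompat : ∀ (σ : G) (F : Γ) (x : X), σ • (F • x) = (σ • F) • (σ • x))
    {A : X} (hA : ∀ σ : G, σ • A = A) (F : Γ) (hF : ∀ σ : G, σ • (F • A) = F • A) :
    StabilizerCocycle G Γ A :=
  ⟨fun σ => F⁻¹ * σ • F, fun σ => by
    have h := hF σ
    rw [hcompat, hA] at h
    rw [mul_smul, h, inv_smul_smul], fun σ τ => by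
    simp only [smul_mul', smul_inv', mul_smul]
    group⟩

/-- Fixed points in the orbit of `A` with cohomologous cocycles lie in the same orbit of the
`G`-fixed elements of `Γ`. -/
theorem StabilizerCocycle.exists_fixed_smul_eq
    (hcompat : ∀ (σ : G) (F : Γ) (x : X), σ • (F • x) = (σ • F) • (σ • x))
    {A : X} (hA : ∀ σ : G, σ • A = A) {E F : Γ} (hE : ∀ σ : G, σ • (E • A) = E • A)
    (hF : ∀ σ : G, σ • (F • A) = F • A)
    (h : (ofFixed hcompat hA E hE).Cohomologous (ofFixed hcompat hA F hF)) :
    ∃ D : Γ, (∀ σ : G, σ • D = D) ∧ D • (E • A) = F • A := by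
  obtain ⟨c, hc, h⟩ := h
  refine ⟨F * c⁻¹ * E⁻¹, fun σ => ?_, ?_⟩
  · have h1 : F⁻¹ * σ • F = c⁻¹ * (E⁻¹ * σ • E) * σ • c := h σ
    rw [inv_mul_eq_iff_eq_mul] at h1
    rw [smul_mul', smul_mul', smul_inv', smul_inv', h1]
    group
  · have hcinv : c⁻¹ • A = A := by rw [inv_smul_eq_iff, hc]
    rw [mul_smul, inv_smul_smul, mul_smul, hcinv]

/-- If `H¹(G, Stab_Γ(A))` is finite, the fixed points in the `Γ`-orbit of `A` lie in finitely many
orbits of the `G`-fixed elements of `Γ`. -/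
theorem StabilizerCocycle.finite_fixed_orbits
    (hcompat : ∀ (σ : G) (F : Γ) (x : X), σ • (F • x) = (σ • F) • (σ • x))
    {A : X} (hA : ∀ σ : G, σ • A = A)
    (hfin : Finite (Quot (Cohomologous (G := G) (Γ := Γ) (A := A)))) :
    ∃ R : Set X, R.Finite ∧ (∀ B ∈ R, ∀ σ : G, σ • B = B) ∧
      ∀ F : Γ, (∀ σ : G, σ • (F • A) = F • A) →
        ∃ B ∈ R, ∃ D : Γ, (∀ σ : G, σ • D = D) ∧ D • B = F • A := by
  let q : {F : Γ // ∀ σ : G, σ • (F • A) = F • A} →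
      Quot (Cohomologous (G := G) (Γ := Γ) (A := A)) :=
    fun F => Quot.mk _ (ofFixed hcompat hA F.1 F.2)
  refine ⟨Set.range fun y : Set.range q => (Set.rangeSplitting q y).1 • A, Set.finite_range _, ?_,
    fun F hF => ?_⟩
  · rintro _ ⟨y, rfl⟩
    exact (Set.rangeSplitting q y).2
  · refine ⟨_, ⟨⟨q ⟨F, hF⟩, Set.mem_range_self _⟩, rfl⟩, ?_⟩
    refine exists_fixed_smul_eq hcompat hA (Set.rangeSplitting q _).2 hF ?_
    have h := Set.apply_rangeSplitting q ⟨q ⟨F, hF⟩, Set.mem_range_self _⟩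
    exact (cohomologous_equivalence A).eqvGen_iff.1 (Quot.eqvGen_exact h)

end

/-- Let `G` act by automorphisms on a group `Γ`, and let `X` carry
compatible `G`- and `Γ`-actions. If the `G`-fixed points of `X` meet only finitely
many `Γ`-orbits, and for every `G`-fixed `A ∈ X` the cohomology set
`H¹(G, Stab_Γ(A))` is finite, then the set of `Γ^G`-orbits on `X^G` is finite. -/
theorem finitely_many_fixed_orbits_of_finite_H1
    (G Γ X : Type*) [Group G] [Group Γ] [MulDistribMulAction G Γ]
    [MulAction G X] [MulAction Γ X]
    (hcompat : ∀ (σ : G) (F : Γ) (x : X), σ • (F • x) = (σ • F) • (σ • x))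
    -- (i) `X^G` meets only finitely many `Γ`-orbits
    (horb : ∃ R : Set X, R.Finite ∧
      ∀ B : X, (∀ σ : G, σ • B = B) → ∃ A ∈ R, ∃ F : Γ, F • A = B)
    -- (ii) `H¹(G, Stab_Γ(A))` is finite for every `A ∈ X^G`, where a cocycle is a
    -- map `G → Γ` with values in the stabilizer of `A`
    (hH1 : ∀ A : X, (∀ σ : G, σ • A = A) →
      Finite (Quot fun f g :
          {f : G → Γ // (∀ σ : G, f σ • A = A) ∧ ∀ σ τ : G, f (σ * τ) = f σ * σ • f τ} =>
        ∃ c : Γ, c • A = A ∧ ∀ σ : G, g.1 σ = c⁻¹ * f.1 σ * σ • c)) :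
    -- conclusion: finitely many `Γ^G`-orbits on `X^G`
    ∃ R : Set X, R.Finite ∧ (∀ B ∈ R, ∀ σ : G, σ • B = B) ∧
      ∀ B : X, (∀ σ : G, σ • B = B) →
        ∃ A ∈ R, ∃ F : Γ, (∀ σ : G, σ • F = F) ∧ F • A = B := by
  obtain ⟨R, hR, hcover⟩ := horb
  have hlocal : ∀ A : X, ∃ S : Set X, S.Finite ∧ (∀ B ∈ S, ∀ σ : G, σ • B = B) ∧
      ∀ B : X, (∀ σ : G, σ • B = B) → (∃ F : Γ, F • A = B) →
        ∃ C ∈ S, ∃ D : Γ, (∀ σ : G, σ • D = D) ∧ D • C = B := by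
    intro A
    by_cases h : ∃ E : Γ, ∀ σ : G, σ • (E • A) = E • A
    · obtain ⟨E, hE⟩ := h
      obtain ⟨S, hS, hfix, hSc⟩ :=
        StabilizerCocycle.finite_fixed_orbits hcompat hE (hH1 (E • A) hE)
      refine ⟨S, hS, hfix, ?_⟩
      rintro _ hB ⟨F, rfl⟩
      have hFE : (F * E⁻¹) • (E • A) = F • A := by rw [mul_smul, inv_smul_smul]
      rw [← hFE] at hB ⊢
      exact hSc _ hB
    · refine ⟨∅, Set.finite_empty, by simp, ?_⟩
      rintro _ hB ⟨F, rfl⟩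
      exact absurd ⟨F, hB⟩ h
  choose S hS hfix hSc using hlocal
  refine ⟨⋃ A ∈ R, S A, hR.biUnion fun A _ => hS A, fun B hB => ?_, fun B hB => ?_⟩
  · obtain ⟨A, -, hBA⟩ := Set.mem_iUnion₂.1 hB
    exact hfix A B hBA
  · obtain ⟨A, hA, hAB⟩ := hcover B hB
    obtain ⟨C, hC, hD⟩ := hSc A B hB hAB
    exact ⟨C, Set.mem_biUnion hA hC, hD⟩
end

section
/- Let H/K be a finite Galois extension of number fields with Galois group G, let S be a finite set of maximal ideals of O_K, and let T be the set of maximal ideals of O_H lying above the ideals of S (so T is stable under G and G acts on O_{H,T} and on O_{H,T}^×). Let B = O_{H,T} ⋊ O_{H,T}^× be the group of affine transformations x ↦ ax + b with a ∈ O_{H,T}^× and b ∈ O_{H,T}, i.e. the semidirect product with multiplication (b,a)·(b',a') = (b + ab', aa'), on which G acts componentwise by the Galois action. Then the pointed set H¹(G,B) is finite. -/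
open IsDedekindDomain NumberField

/-- Multiplication in the group of affine transformations `x ↦ ax + b` of a
commutative ring `R`, written as pairs `(b, a) ∈ R × Rˣ` with
`(b,a)·(b',a') = (b + ab', aa')` (the semidirect product `R ⋊ Rˣ`). -/
def affMul {R : Type*} [CommRing R] (x y : R × Rˣ) : R × Rˣ :=
  (x.1 + (x.2 : R) * y.1, x.2 * y.2)

/-- Inversion in the affine group `R ⋊ Rˣ`. -/
def affInv {R : Type*} [CommRing R] (x : R × Rˣ) : R × Rˣ :=
  (-((((x.2⁻¹ : Rˣ) : R)) * x.1), x.2⁻¹)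

/-- The componentwise action of a ring automorphism on the affine group `R ⋊ Rˣ`. -/
def affAct {R : Type*} [CommRing R] (e : R ≃+* R) (x : R × Rˣ) : R × Rˣ :=
  (e x.1, Units.map e.toRingHom.toMonoidHom x.2)

/-- Every 1-cocycle of a finite group with values in a finitely generated abelian group is
cohomologous to a member of a fixed finite set of functions. -/
theorem exists_finite_cocycle_representatives {G M : Type*} [Group G] [Finite G] [AddCommGroup M]
    [Module.Finite ℤ M] (act : G → M →+ M) :
    ∃ F : Set (G → M), F.Finite ∧ ∀ α : G → M,
      (∀ σ τ, α (σ * τ) = α σ + act σ (α τ)) →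
        ∃ m, (fun σ => -m + (α σ + act σ m)) ∈ F := by
  have := Fintype.ofFinite G
  let Z : Submodule ℤ (G → M) := AddSubgroup.toIntSubmodule
    { carrier := {α | ∀ σ τ, α (σ * τ) = α σ + act σ (α τ)}
      zero_mem' := by simp
      add_mem' := by
        intro a b ha hb σ τ
        simp only [Pi.add_apply, ha σ τ, hb σ τ, map_add]
        abel
      neg_mem' := by
        intro a ha σ τ
        simp only [Pi.neg_apply, ha σ τ, map_neg]
        abel }
  let n : ℤ := Fintype.card G
  let N : Submodule ℤ Z := LinearMap.range (LinearMap.lsmul ℤ Z n)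
  have hfin : Finite (Z ⧸ N) := by
    refine Module.finite_of_fg_torsion _ ?_
    intro x
    refine ⟨⟨n, mem_nonZeroDivisors_of_ne_zero (by simp [n])⟩, ?_⟩
    obtain ⟨y, rfl⟩ := Submodule.Quotient.mk_surjective _ x
    exact (Submodule.Quotient.mk_eq_zero N).2 ⟨y, rfl⟩
  refine ⟨Set.range fun q : Z ⧸ N => (q.out : Z).1, Set.finite_range _, fun α hα => ?_⟩
  let a : Z := ⟨α, hα⟩
  have hq : Submodule.Quotient.mk (p := N) (Submodule.Quotient.mk (p := N) a).out
      = Submodule.Quotient.mk a := Quotient.out_eq _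
  obtain ⟨g, hg⟩ := (Submodule.Quotient.eq N).1 hq
  refine ⟨-∑ τ, g.1 τ, Submodule.Quotient.mk a, ?_⟩
  funext σ
  have hsum : ∑ τ, g.1 τ = n • g.1 σ + act σ (∑ τ, g.1 τ) := by
    calc ∑ τ, g.1 τ = ∑ τ, g.1 (σ * τ) := (Equiv.sum_comp (Equiv.mulLeft σ) g.1).symm
      _ = ∑ τ, (g.1 σ + act σ (g.1 τ)) := Finset.sum_congr rfl fun τ _ => g.2 σ τ
      _ = n • g.1 σ + act σ (∑ τ, g.1 τ) := by simp [Finset.sum_add_distrib, n]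
  have hgσ : n • g.1 σ = (Submodule.Quotient.mk (p := N) a).out.1 σ - α σ :=
    congrFun (congrArg Subtype.val hg) σ
  rw [hgσ] at hsum
  simp only [map_neg, neg_neg]
  rw [add_left_comm, ← sub_eq_iff_eq_add', ← sub_eq_add_neg, eq_sub_iff_add_eq]
  exact hsum.symm

/-- If `A` embeds in a finite-dimensional rational vector space, then `A / nA` is finite. -/
theorem finite_quotient_span_natCast {A V : Type*} [CommRing A] [AddCommGroup V] [Module ℚ V]
    [FiniteDimensional ℚ V] (f : A →+ V) (hf : Function.Injective f) (n : ℕ) [NeZero n] :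
    Finite (A ⧸ Ideal.span {(n : A)}) := by
  classical
  by_contra hinf
  rw [not_finite_iff_infinite] at hinf
  obtain ⟨t, ht⟩ := Infinite.exists_subset_card_eq (A ⧸ Ideal.span {(n : A)})
    (n ^ Module.finrank ℚ V + 1)
  let M : Submodule ℤ A := Submodule.span ℤ (t.image Quotient.out : Finset A)
  have : Module.IsTorsionFree ℤ V := .trans_faithfulSMul ℤ ℚ V
  have : Module.IsTorsionFree ℤ A := hf.moduleIsTorsionFree _ (fun c x => map_zsmul f c x)
  have : Module.Finite ℤ M := Module.Finite.span_finset ℤ _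
  let b := Module.finBasis ℤ M
  have hli : LinearIndependent ℤ (fun i => f (b i)) := by
    have h := (b.linearIndependent.map' M.subtype (by simp)).map' f.toIntLinearMap
      (LinearMap.ker_eq_bot.2 hf)
    exact h
  have hrank : Module.finrank ℤ M ≤ Module.finrank ℚ V := by
    simpa using ((LinearIndependent.iff_fractionRing ℤ ℚ).1 hli).fintype_card_le_finrank
  have hmem (q : t) : (Quotient.out q.1 : A) ∈ M :=
    Submodule.subset_span (Finset.mem_coe.2 (Finset.mem_image_of_mem _ q.2))
  let φ : t → Fin (Module.finrank ℤ M) → ZMod n := fun q i => (b.repr ⟨_, hmem q⟩ i : ZMod n)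
  have hφ : Function.Injective φ := by
    intro p q h
    have hdvd (i) : ∃ c : ℤ, b.repr ⟨_, hmem p⟩ i - b.repr ⟨_, hmem q⟩ i = n * c :=
      (ZMod.intCast_eq_intCast_iff_dvd_sub _ _ n).1 (congrFun h i).symm
    choose c hc using hdvd
    have hM : (⟨_, hmem p⟩ - ⟨_, hmem q⟩ : M) = (n : ℤ) • ∑ i, c i • b i := by
      rw [← b.sum_repr (_ - _), Finset.smul_sum]
      exact Finset.sum_congr rfl fun i _ => by
        rw [map_sub, Finsupp.sub_apply, hc, mul_smul]
    have hA := congrArg Subtype.val hM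
    apply Subtype.ext
    rw [← Quotient.out_eq p.1, ← Quotient.out_eq q.1]
    refine Ideal.Quotient.eq.2 (Ideal.mem_span_singleton.2 ⟨(∑ i, c i • b i : M).1, ?_⟩)
    simpa using hA
  have hcard := Fintype.card_le_of_injective φ hφ
  have hpow := Nat.pow_le_pow_right (NeZero.pos n) hrank
  simp [ht] at hcard
  omega

/-- The primes above a finite set of primes form a finite set. -/
theorem finite_setOf_comap_eq {A B : Type*} [CommRing A] [IsDedekindDomain A] [CommRing B]
    [IsDedekindDomain B] [Algebra A B] [Module.Finite A B]
    (S : Finset (HeightOneSpectrum A)) (T : Set (HeightOneSpectrum B))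
    (hT : ∀ w ∈ T, ∃ v ∈ S, Ideal.comap (algebraMap A B) w.asIdeal = v.asIdeal) : T.Finite := by
  have hU : (⋃ v ∈ S, v.asIdeal.primesOver B).Finite :=
    S.finite_toSet.biUnion fun v _ => Algebra.QuasiFinite.finite_primesOver v.asIdeal
  refine (hU.preimage (f := HeightOneSpectrum.asIdeal)
    (fun _ _ _ _ h => HeightOneSpectrum.ext h)).subset fun w hw => ?_
  obtain ⟨v, hv, h⟩ := hT w hw
  exact Set.mem_biUnion hv ⟨w.isPrime, ⟨h.symm⟩⟩

/-- If `R` has a finitely generated unit group, then so does its ring of `T`-integers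
for every finite set `T` of primes. -/
theorem module_finite_additive_units_integer {R K : Type*} [CommRing R] [IsDedekindDomain R]
    [Field K] [Algebra R K] [IsFractionRing R K] [Module.Finite ℤ (Additive Rˣ)]
    (T : Set (HeightOneSpectrum R)) (hT : T.Finite) :
    Module.Finite ℤ (Additive (T.integer K)ˣ) := by
  have := hT.to_subtype
  let val : (T.integer K)ˣ →* Kˣ := Units.map (T.integer K).val.toRingHom.toMonoidHom
  let ψ : Additive (T.integer K)ˣ →ₗ[ℤ] (T → ℤ) := AddMonoidHom.toIntLinearMap
    (AddMonoidHom.mk' (fun x v => (v.1.valuationOfNeZero (val x.toMul)).toAdd)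
      (by intro x y; funext v; simp))
  let ι : Additive Rˣ →ₗ[ℤ] Additive (T.integer K)ˣ :=
    (MonoidHom.toAdditive (Units.map (algebraMap R (T.integer K)).toMonoidHom)).toIntLinearMap
  refine ⟨Submodule.fg_of_fg_map_of_fg_inf_ker ψ (IsNoetherian.noetherian _) ?_⟩
  have hker : LinearMap.ker ψ ≤ LinearMap.range ι := by
    intro x hx
    have h1 (v : HeightOneSpectrum R) : v.valuation K (val x.toMul : K) = 1 := by
      by_cases hv : v ∈ T
      · have h : (v.valuationOfNeZero (val x.toMul)) = 1 := congrFun hx ⟨v, hv⟩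
        rw [← HeightOneSpectrum.valuationOfNeZero_eq, h]
        rfl
      · exact T.unit_valuation_eq_one K ((T.unitEquivUnitsInteger K).symm x.toMul) hv
    obtain ⟨r, hr⟩ := HeightOneSpectrum.mem_integers_of_valuation_le_one K
      (val x.toMul : K) fun v => (h1 v).le
    obtain ⟨s, hs⟩ := HeightOneSpectrum.mem_integers_of_valuation_le_one (R := R) K
      ((val x.toMul)⁻¹ : Kˣ) fun v => by simp [h1 v, -Units.coe_map]
    have hrs : r * s = 1 := IsFractionRing.injective R K (by simp [hr, hs])
    refine ⟨Additive.ofMul (Units.mkOfMulEqOne r s hrs), ?_⟩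
    apply Additive.toMul.injective
    ext
    exact hr
  rw [top_inf_eq]
  exact isNoetherian_submodule.1 (inferInstanceAs (IsNoetherian ℤ (LinearMap.range ι))) _ hker
/-- Two cocycles with values in `R ⋊ Rˣ` with the same linear part whose translation parts agree
modulo the order of the group differ by conjugation by a translation. -/
theorem exists_conj_of_snd_eq_of_dvd_sub {G R : Type*} [Group G] [Finite G] [CommRing R]
    (ρ : G → R ≃+* R) (hreg : IsLeftRegular (Nat.card G : R)) {f g : G → R × Rˣ}
    (hf : ∀ σ τ, f (σ * τ) = affMul (f σ) (affAct (ρ σ) (f τ)))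
    (hg : ∀ σ τ, g (σ * τ) = affMul (g σ) (affAct (ρ σ) (g τ)))
    (hsnd : ∀ σ, (f σ).2 = (g σ).2) (hdvd : ∀ σ, (Nat.card G : R) ∣ (g σ).1 - (f σ).1) :
    ∃ c : R × Rˣ, ∀ σ, g σ = affMul (affInv c) (affMul (f σ) (affAct (ρ σ) c)) := by
  have := Fintype.ofFinite G
  choose h hh using hdvd
  have hcoc (σ τ) : h (σ * τ) = h σ + (g σ).2 * ρ σ (h τ) := by
    apply hreg
    have h1 := congrArg Prod.fst (hf σ τ)
    have h2 := congrArg Prod.fst (hg σ τ)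
    have h3 := congrArg (ρ σ) (hh τ)
    simp only [affMul, affAct, map_mul, map_sub, map_natCast, hsnd] at h1 h2 h3
    simp only
    linear_combination h2 - h1 - hh (σ * τ) + hh σ + (g σ).2 * h3
  have hsum (σ) : ∑ τ, h τ = Nat.card G * h σ + (g σ).2 * ρ σ (∑ τ, h τ) :=
    calc ∑ τ, h τ = ∑ τ, h (σ * τ) := (Equiv.sum_comp (Equiv.mulLeft σ) h).symm
      _ = ∑ τ, (h σ + (g σ).2 * ρ σ (h τ)) := Finset.sum_congr rfl fun τ _ => hcoc σ τ
      _ = _ := by simp [Finset.sum_add_distrib, Finset.mul_sum]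
  refine ⟨(-∑ τ, h τ, 1), fun σ => Prod.ext ?_ ?_⟩
  · simp only [affMul, affInv, affAct, map_neg, hsnd, inv_one, Units.val_one]
    linear_combination hh σ - hsum σ
  · simp [affMul, affInv, affAct, hsnd]

/-- Conjugating a cocycle with values in `R ⋊ Rˣ` yields a cocycle. -/
theorem affine_cocycle_conj {G R : Type*} [Group G] [CommRing R] (ρ : G → R ≃+* R)
    (hρ : ∀ σ τ x, ρ (σ * τ) x = ρ σ (ρ τ x)) {f : G → R × Rˣ}
    (hf : ∀ σ τ, f (σ * τ) = affMul (f σ) (affAct (ρ σ) (f τ))) (c : R × Rˣ) (σ τ : G) :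
    affMul (affInv c) (affMul (f (σ * τ)) (affAct (ρ (σ * τ)) c)) =
      affMul (affMul (affInv c) (affMul (f σ) (affAct (ρ σ) c)))
        (affAct (ρ σ) (affMul (affInv c) (affMul (f τ) (affAct (ρ τ) c)))) := by
  have hc : ρ σ c.2 * ρ σ ↑c.2⁻¹ = 1 := by rw [← map_mul, Units.mul_inv, map_one]
  refine Prod.ext ?_ (Units.ext ?_)
  · simp only [hf σ τ, affMul, affInv, affAct, map_add, map_mul, map_neg, hρ, Units.val_mul,
      Units.coe_map, RingHom.toMonoidHom_eq_coe, RingEquiv.toRingHom_eq_coe, MonoidHom.coe_coe,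
      RingHom.coe_coe]
    linear_combination (↑c.2⁻¹ * (f σ).2 * (ρ σ c.1 - ρ σ (f τ).1
      - ρ σ (f τ).2 * ρ σ (ρ τ c.1))) * hc
  · simp only [hf σ τ, affMul, affInv, affAct, map_mul, hρ, Units.val_mul,
      Units.coe_map, RingHom.toMonoidHom_eq_coe, RingEquiv.toRingHom_eq_coe, MonoidHom.coe_coe,
      RingHom.coe_coe]
    linear_combination (-(↑c.2⁻¹ * (f σ).2 * ρ σ (f τ).2 * ρ σ (ρ τ c.2))) * hc

/-- Finiteness of `H¹(G, R ⋊ Rˣ)` for a finite group `G` of order regular in `R`, when `Rˣ` is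
finitely generated and `R / |G|R` is finite. -/
theorem finite_H1_affine {G R : Type*} [Group G] [Finite G] [CommRing R]
    [Module.Finite ℤ (Additive Rˣ)] (ρ : G → R ≃+* R)
    (hρ : ∀ σ τ x, ρ (σ * τ) x = ρ σ (ρ τ x)) (hreg : IsLeftRegular (Nat.card G : R))
    [Finite (R ⧸ Ideal.span {(Nat.card G : R)})] :
    Finite (Quot fun f g : {f : G → R × Rˣ //
        ∀ σ τ, f (σ * τ) = affMul (f σ) (affAct (ρ σ) (f τ))} =>
      ∃ c : R × Rˣ, ∀ σ, g.1 σ = affMul (affInv c) (affMul (f.1 σ) (affAct (ρ σ) c))) := by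
  set r := fun f g : {f : G → R × Rˣ //
        ∀ σ τ, f (σ * τ) = affMul (f σ) (affAct (ρ σ) (f τ))} =>
      ∃ c : R × Rˣ, ∀ σ, g.1 σ = affMul (affInv c) (affMul (f.1 σ) (affAct (ρ σ) c))
  obtain ⟨F, hF, hrep⟩ := exists_finite_cocycle_representatives (M := Additive Rˣ) fun σ : G =>
    MonoidHom.toAdditive (Units.map (ρ σ).toRingHom.toMonoidHom)
  have := hF.to_subtype
  have hnorm (f) : ∃ f', r f f' ∧ (fun σ => Additive.ofMul (f'.1 σ).2) ∈ F := by
    obtain ⟨m, hm⟩ := hrep (fun σ => Additive.ofMul (f.1 σ).2) fun σ τ =>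
      congrArg (fun x => Additive.ofMul x.2) (f.2 σ τ)
    exact ⟨⟨fun σ => affMul (affInv (0, m.toMul)) (affMul (f.1 σ) (affAct (ρ σ) (0, m.toMul))),
      affine_cocycle_conj ρ hρ f.2 (0, m.toMul)⟩, ⟨_, fun _ => rfl⟩, hm⟩
  choose ν hν hνF using hnorm
  let φ (f) : F × (G → R ⧸ Ideal.span {(Nat.card G : R)}) :=
    (⟨_, hνF f⟩, fun σ => Ideal.Quotient.mk _ ((ν f).1 σ).1)
  have hφ (f g) (h : φ f = φ g) : Quot.mk r f = Quot.mk r g := by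
    have hsnd (σ) : ((ν f).1 σ).2 = ((ν g).1 σ).2 :=
      congrFun (congrArg (fun x => x.1.1) h) σ
    have hfst (σ) : (Nat.card G : R) ∣ ((ν g).1 σ).1 - ((ν f).1 σ).1 :=
      Ideal.mem_span_singleton.1 (Ideal.Quotient.eq.1 (congrFun (congrArg Prod.snd h) σ).symm)
    rw [Quot.sound (hν f), Quot.sound (hν g)]
    exact Quot.sound (exists_conj_of_snd_eq_of_dvd_sub ρ hreg (ν f).2 (ν g).2 hsnd hfst)
  refine Finite.of_injective (fun q : Quot r => φ q.out) fun p q h => ?_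
  rw [← Quot.out_eq p, ← Quot.out_eq q]
  exact hφ _ _ h

/-- Let `H/K` be a finite Galois extension of number fields with
Galois group `G`, `S` a finite set of maximal ideals of `𝒪_K` and `T` the set of
maximal ideals of `𝒪_H` above `S`. Let `G` act on `𝒪_{H,T}` by the Galois action
(`ρ` below) and componentwise on the affine group `B = 𝒪_{H,T} ⋊ 𝒪_{H,T}^×`.
Then the pointed set `H¹(G, B)` is finite. -/
theorem finite_H1_of_affine_group_of_S_integers
    (K H : Type*) [Field K] [NumberField K] [Field H] [NumberField H]
    [Algebra K H] [FiniteDimensional K H] [IsGalois K H]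
    (S : Finset (HeightOneSpectrum (𝓞 K)))
    (T : Set (HeightOneSpectrum (𝓞 H)))
    (hT : ∀ w : HeightOneSpectrum (𝓞 H),
      w ∈ T ↔ ∃ v ∈ S, Ideal.comap (algebraMap (𝓞 K) (𝓞 H)) w.asIdeal = v.asIdeal)
    -- the Galois action of `G = Gal(H/K)` on the ring `𝒪_{H,T}` of `T`-integers
    (ρ : (H ≃ₐ[K] H) → (↥(T.integer H) ≃+* ↥(T.integer H)))
    (hρ : ∀ (σ : H ≃ₐ[K] H) (x : ↥(T.integer H)), ((ρ σ x : H)) = σ (x : H)) :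
    -- `H¹(G, 𝒪_{H,T} ⋊ 𝒪_{H,T}^×)` is finite
    Finite (Quot fun f g :
        {f : (H ≃ₐ[K] H) → ↥(T.integer H) × (↥(T.integer H))ˣ //
          ∀ σ τ : H ≃ₐ[K] H, f (σ * τ) = affMul (f σ) (affAct (ρ σ) (f τ))} =>
      ∃ c : ↥(T.integer H) × (↥(T.integer H))ˣ,
        ∀ σ : H ≃ₐ[K] H,
          g.1 σ = affMul (affInv c) (affMul (f.1 σ) (affAct (ρ σ) c))) := by
  have := module_finite_additive_units_integer (K := H) T
    (finite_setOf_comap_eq S T fun w => (hT w).1)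
  have : NeZero (Nat.card (H ≃ₐ[K] H)) := ⟨Nat.card_pos.ne'⟩
  have := finite_quotient_span_natCast (T.integer H).val.toRingHom.toAddMonoidHom
    Subtype.val_injective (Nat.card (H ≃ₐ[K] H))
  refine finite_H1_affine ρ (fun σ τ x => Subtype.ext ?_) ?_
  · simp only [hρ, AlgEquiv.mul_apply]
  · intro x y h
    have h' := congrArg Subtype.val h
    simpa [NeZero.ne] using h'
end

section
/- Let H/K be an extension of fields, let A, B ⊆ ℙ¹(K) be finite subsets with #A ≥ 3, regard A and B as subsets of ℙ¹(H) via the inclusion K ⊆ H, and let γ ∈ GL₂(H) be such that the induced action of γ on ℙ¹(H) maps A onto B. Then for every field automorphism σ of H fixing K pointwise, the matrix σ(γ) (obtained by applying σ to each entry of γ) equals λγ for some scalar λ ∈ H^×; that is, γ and σ(γ) define the same element of PGL₂(H). -/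
open scoped LinearAlgebra.Projectivization MatrixGroups

/-- The action of `GL₂(F)` on `ℙ¹(F)`, `[α:β] ↦ [(α,β)g]` (scalar matrices act
trivially). -/
noncomputable def glPt {F : Type*} [Field F] (g : GL (Fin 2) F) (x : ℙ F (Fin 2 → F)) :
    ℙ F (Fin 2 → F) :=
  Projectivization.mk F (Matrix.vecMul x.rep (g : Matrix (Fin 2) (Fin 2) F)) (by
    intro h0
    apply x.rep_nonzero
    have h2 := congrArg
      (fun u => Matrix.vecMul u ((g⁻¹ : GL (Fin 2) F) : Matrix (Fin 2) (Fin 2) F)) h0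
    simp only [Matrix.vecMul_vecMul, Matrix.zero_vecMul] at h2
    rwa [← Units.val_mul, mul_inv_cancel, Units.val_one, Matrix.vecMul_one] at h2)

/-- The inclusion `ℙ¹(K) ↪ ℙ¹(H)` induced by a field extension `K ⊆ H`. -/
noncomputable def ptMap {K H : Type*} [Field K] [Field H] [Algebra K H]
    (x : ℙ K (Fin 2 → K)) : ℙ H (Fin 2 → H) :=
  Projectivization.mk H (fun i => algebraMap K H (x.rep i)) (by
    intro h
    apply x.rep_nonzero
    funext i
    have := congrFun h i
    simpa using this)

/-- A binary quadratic form vanishing at three pairwise non-proportional vectors is zero. -/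
theorem quadraticForm_coeffs_eq_zero {F : Type*} [Field F] {p q r : F} {u v w : Fin 2 → F}
    (huv : u 0 * v 1 - u 1 * v 0 ≠ 0) (huw : u 0 * w 1 - u 1 * w 0 ≠ 0)
    (hvw : v 0 * w 1 - v 1 * w 0 ≠ 0)
    (hu : p * u 0 ^ 2 + q * (u 0 * u 1) + r * u 1 ^ 2 = 0)
    (hv : p * v 0 ^ 2 + q * (v 0 * v 1) + r * v 1 ^ 2 = 0)
    (hw : p * w 0 ^ 2 + q * (w 0 * w 1) + r * w 1 ^ 2 = 0) :
    p = 0 ∧ q = 0 ∧ r = 0 := by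
  have hD := mul_ne_zero (mul_ne_zero huv huw) hvw
  refine ⟨(mul_eq_zero.mp ?_).resolve_right hD, (mul_eq_zero.mp ?_).resolve_right hD,
    (mul_eq_zero.mp ?_).resolve_right hD⟩
  · linear_combination (v 1 * w 1 * (v 0 * w 1 - v 1 * w 0)) * hu
      - (u 1 * w 1 * (u 0 * w 1 - u 1 * w 0)) * hv
      + (u 1 * v 1 * (u 0 * v 1 - u 1 * v 0)) * hw
  · linear_combination (-(v 0 ^ 2 * w 1 ^ 2 - v 1 ^ 2 * w 0 ^ 2)) * hu
      + (u 0 ^ 2 * w 1 ^ 2 - u 1 ^ 2 * w 0 ^ 2) * hv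
      - (u 0 ^ 2 * v 1 ^ 2 - u 1 ^ 2 * v 0 ^ 2) * hw
  · linear_combination (v 0 * w 0 * (v 0 * w 1 - v 1 * w 0)) * hu
      - (u 0 * w 0 * (u 0 * w 1 - u 1 * w 0)) * hv
      + (u 0 * v 0 * (u 0 * v 1 - u 1 * v 0)) * hw

/-- A `2 × 2` matrix with three pairwise non-proportional left eigenvectors is scalar. -/
theorem Matrix.exists_eq_smul_one_of_three_eigenvectors {F : Type*} [Field F]
    {M : Matrix (Fin 2) (Fin 2) F} {u v w : Fin 2 → F}
    (huv : u 0 * v 1 - u 1 * v 0 ≠ 0) (huw : u 0 * w 1 - u 1 * w 0 ≠ 0)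
    (hvw : v 0 * w 1 - v 1 * w 0 ≠ 0)
    (hu : ∃ c : F, Matrix.vecMul u M = c • u) (hv : ∃ c : F, Matrix.vecMul v M = c • v)
    (hw : ∃ c : F, Matrix.vecMul w M = c • w) :
    ∃ c : F, M = c • (1 : Matrix (Fin 2) (Fin 2) F) := by
  have key : ∀ x : Fin 2 → F, (∃ c : F, Matrix.vecMul x M = c • x) →
      -M 0 1 * x 0 ^ 2 + (M 0 0 - M 1 1) * (x 0 * x 1) + M 1 0 * x 1 ^ 2 = 0 := by
    rintro x ⟨c, hc⟩
    have h0 := congrFun hc 0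
    have h1 := congrFun hc 1
    simp only [Matrix.vecMul, dotProduct, Fin.sum_univ_two, Pi.smul_apply, smul_eq_mul] at h0 h1
    linear_combination x 1 * h0 - x 0 * h1
  obtain ⟨hp, hq, hr⟩ :=
    quadraticForm_coeffs_eq_zero huv huw hvw (key u hu) (key v hv) (key w hw)
  refine ⟨M 0 0, ?_⟩
  ext i j
  fin_cases i <;> fin_cases j <;> simp [neg_eq_zero.mp hp, hr, (sub_eq_zero.mp hq).symm]

/-- Representatives of distinct points of the projective line are non-proportional. -/
theorem Projectivization.rep_det_ne_zero {F : Type*} [Field F] {x y : ℙ F (Fin 2 → F)}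
    (hxy : x ≠ y) : x.rep 0 * y.rep 1 - x.rep 1 * y.rep 0 ≠ 0 := by
  intro h
  apply hxy
  rw [← x.mk_rep, ← y.mk_rep, Projectivization.mk_eq_mk_iff']
  by_cases h0 : y.rep 0 = 0
  · have h1 : y.rep 1 ≠ 0 := fun h1 => y.rep_nonzero (by
      ext i
      fin_cases i <;> simpa)
    refine ⟨x.rep 1 / y.rep 1, ?_⟩
    ext i
    fin_cases i
    · have : x.rep 0 = 0 := by simpa [h0, h1] using h
      simp [h0, this]
    · simp [h1]
  · refine ⟨x.rep 0 / y.rep 0, ?_⟩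
    ext i
    fin_cases i
    · simp [h0]
    · simp only [Fin.mk_one, Pi.smul_apply, smul_eq_mul]
      field_simp
      linear_combination h

/-- If `γ` maps a `K`-rational point to a `K`-rational point, then it maps any `K`-rational
representative of the former to a multiple of a `K`-rational vector. -/
theorem exists_vecMul_eq_smul_of_glPt_ptMap {K H : Type*} [Field K] [Field H] [Algebra K H]
    {γ : GL (Fin 2) H} {x y : ℙ K (Fin 2 → K)}
    (h : glPt γ (ptMap (H := H) x) = ptMap y) :
    ∃ c : H, c ≠ 0 ∧
      Matrix.vecMul (fun i => algebraMap K H (x.rep i)) (γ : Matrix (Fin 2) (Fin 2) H)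
        = c • fun i => algebraMap K H (y.rep i) := by
  obtain ⟨a, ha⟩ := (Projectivization.mk_eq_mk_iff' H _ _ _ _).mp
    (ptMap (H := H) x).mk_rep
  obtain ⟨b, hb⟩ := (Projectivization.mk_eq_mk_iff H _ _ _ _).mp h
  have ha0 : a ≠ 0 := by
    rintro rfl
    exact (ptMap (H := H) x).rep_nonzero (by rw [← ha, zero_smul])
  refine ⟨a⁻¹ * b, mul_ne_zero (inv_ne_zero ha0) b.ne_zero, ?_⟩
  rw [← ha, Matrix.smul_vecMul] at hb
  rw [mul_smul, ← Units.smul_def, hb, inv_smul_smul₀ ha0]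

/-- If `γ` maps a `K`-rational point to a `K`-rational point, then that point is fixed by
`σ(γ) γ⁻¹` for every automorphism `σ` fixing `K`. -/
theorem exists_vecMul_map_mul_inv_eq_smul {K H : Type*} [Field K] [Field H] [Algebra K H]
    {γ : GL (Fin 2) H} (σ : H ≃ₐ[K] H) {x y : ℙ K (Fin 2 → K)}
    (h : glPt γ (ptMap (H := H) x) = ptMap y) :
    ∃ c : H, Matrix.vecMul (fun i => algebraMap K H (x.rep i))
        ((γ : Matrix (Fin 2) (Fin 2) H).map ⇑σ * ((γ⁻¹ : GL (Fin 2) H) : Matrix _ _ H))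
      = c • fun i => algebraMap K H (x.rep i) := by
  obtain ⟨c, hc0, hc⟩ := exists_vecMul_eq_smul_of_glPt_ptMap h
  have hσ : Matrix.vecMul (fun i => algebraMap K H (x.rep i))
      ((γ : Matrix (Fin 2) (Fin 2) H).map ⇑σ) = σ c • fun i => algebraMap K H (y.rep i) := by
    ext j
    have := congrArg σ (congrFun hc j)
    simpa [Matrix.vecMul, dotProduct] using this
  refine ⟨σ c * c⁻¹, ?_⟩
  rw [← Matrix.vecMul_vecMul, hσ, ← inv_smul_smul₀ hc0 (fun i => algebraMap K H (y.rep i)),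
    ← hc, smul_smul, Matrix.smul_vecMul, Matrix.vecMul_vecMul, ← Units.val_mul, mul_inv_cancel,
    Units.val_one, Matrix.vecMul_one]

/-- If `γ ∈ GL₂(H)` maps a subset `A ⊆ ℙ¹(K)` with at least three
elements onto a subset `B ⊆ ℙ¹(K)`, then for every automorphism `σ` of `H` fixing `K`
pointwise, `σ(γ)` is a scalar multiple of `γ`, i.e. `γ` and `σ(γ)` agree in `PGL₂(H)`. -/
theorem galois_conjugate_eq_scalar_mul
    (K H : Type*) [Field K] [Field H] [Algebra K H]
    (A B : Set (ℙ K (Fin 2 → K))) (hAfin : A.Finite) (hBfin : B.Finite)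
    (hcard : 3 ≤ A.ncard)
    (γ : GL (Fin 2) H)
    (hγ : glPt γ '' (ptMap (H := H) '' A) = ptMap (H := H) '' B)
    (σ : H ≃ₐ[K] H) :
    ∃ lam : Hˣ,
      (γ : Matrix (Fin 2) (Fin 2) H).map ⇑σ
        = (lam : H) • (γ : Matrix (Fin 2) (Fin 2) H) := by
  obtain ⟨x, y, z, hx, hy, hz, hxy, hxz, hyz⟩ := (Set.two_lt_ncard_iff hAfin).mp hcard
  have hdet : ∀ {a b : ℙ K (Fin 2 → K)}, a ≠ b →
      algebraMap K H (a.rep 0) * algebraMap K H (b.rep 1)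
        - algebraMap K H (a.rep 1) * algebraMap K H (b.rep 0) ≠ 0 := by
    intro a b hab
    simpa only [← map_mul, ← map_sub] using
      (map_ne_zero (algebraMap K H)).mpr (Projectivization.rep_det_ne_zero hab)
  have heig : ∀ a ∈ A, ∃ c : H, Matrix.vecMul (fun i => algebraMap K H (a.rep i))
        ((γ : Matrix (Fin 2) (Fin 2) H).map ⇑σ * ((γ⁻¹ : GL (Fin 2) H) : Matrix _ _ H))
      = c • fun i => algebraMap K H (a.rep i) := by
    intro a ha
    obtain ⟨b, -, hb⟩ := hγ.subset ⟨_, ⟨a, ha, rfl⟩, rfl⟩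
    exact exists_vecMul_map_mul_inv_eq_smul σ hb.symm
  obtain ⟨lam, hM⟩ := Matrix.exists_eq_smul_one_of_three_eigenvectors (hdet hxy) (hdet hxz)
    (hdet hyz) (heig x hx) (heig y hy) (heig z hz)
  have hmap : (γ : Matrix (Fin 2) (Fin 2) H).map ⇑σ
      = lam • (γ : Matrix (Fin 2) (Fin 2) H) := by
    have := congrArg (· * (γ : Matrix (Fin 2) (Fin 2) H)) hM
    simpa only [Matrix.mul_assoc, ← Units.val_mul, inv_mul_cancel, Units.val_one, Matrix.mul_one,
      Matrix.smul_mul, Matrix.one_mul] using this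
  have hlam : lam ≠ 0 := by
    rintro rfl
    apply γ.ne_zero
    ext i j
    simpa using congrFun (congrFun hmap i) j
  exact ⟨Units.mk0 lam hlam, hmap⟩
end
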